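/- arXiv:2002.00648 — 2 statements merged into one kernel-verified Lean document; each statement's English description precedes it below -/
import Mathlib

section
/- Let p be an odd prime, q = p^m a power of p, and let L = PSL(4, F_q) be the quotient of the special linear group SL(4, F_q) by its center. Suppose L acts by linear automorphisms on a nonzero vector space W over a field of characteristic p. Then the spectrum of the semidirect product W ⋊ L (with respect to this action) is different from the spectrum of L, i.e. ω(W ⋊ L) ≠ ω(L). -/
open Matrix

/-- The spectrum of a group: the set of orders of its elements. -/
def elementOrders (G : Type*) [Monoid G] : Set ℕ := Set.range (orderOf : G → ℕ)

/-- A linear automorphism of `W` gives a multiplicative automorphism of `Multiplicative W`. -/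
def linToMulAut {K W : Type*} [Field K] [AddCommGroup W] [Module K W] :
    (W ≃ₗ[K] W) →* MulAut (Multiplicative W) where
  toFun e := AddEquiv.toMultiplicative e.toAddEquiv
  map_one' := rfl
  map_mul' _ _ := rfl

section PartA
open Matrix
section A
variable {K W : Type} [Field K] [AddCommGroup W] [Module K W] {L : Type} [Group L]

theorem sd_pow (ρ : L →* (W ≃ₗ[K] W)) (w : W) (g : L) (n : ℕ) :
    ((⟨Multiplicative.ofAdd w, g⟩ : SemidirectProduct (Multiplicative W) L (linToMulAut.comp ρ)) ^ n)
      = ⟨Multiplicative.ofAdd (∑ j ∈ Finset.range n, ρ (g ^ j) w), g ^ n⟩ := by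
  induction n with
  | zero => rw [pow_zero]; apply SemidirectProduct.ext <;> simp
  | succ n ih =>
    rw [pow_succ, ih]
    apply SemidirectProduct.ext
    · rw [SemidirectProduct.mul_left, Finset.sum_range_succ]
      rfl
    · rw [SemidirectProduct.mul_right, pow_succ]

/-- order in the semidirect product -/
theorem sd_order (p : ℕ) [Fact p.Prime] [CharP K p] (ρ : L →* (W ≃ₗ[K] W)) (g : L) (N : ℕ)
    (hN : orderOf g = N) (w : W) (hw : ∑ j ∈ Finset.range N, ρ (g ^ j) w ≠ 0)
    (he : elementOrders (SemidirectProduct (Multiplicative W) L (linToMulAut.comp ρ)) =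
      elementOrders L) : ∃ h : L, orderOf h = p * N := by
  have hp : p.Prime := Fact.out
  suffices h : p * N ∈ elementOrders (SemidirectProduct (Multiplicative W) L (linToMulAut.comp ρ)) by
    rw [he] at h; exact h
  set y := ∑ j ∈ Finset.range N, ρ (g ^ j) w with hy
  have hgN : g ^ N = 1 := hN ▸ pow_orderOf_eq_one g
  have key : ∀ a : ℕ, ∑ j ∈ Finset.range (a * N), ρ (g ^ j) w = a • y := by
    intro a
    induction a with
    | zero => simp
    | succ a ih =>
      rw [Nat.succ_mul, Finset.sum_range_add, ih, succ_nsmul]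
      congr 1
      apply Finset.sum_congr rfl
      intro j _
      rw [pow_add, mul_comm a, pow_mul, hgN, one_pow, one_mul]
  refine ⟨⟨Multiplicative.ofAdd w, g⟩, ?_⟩
  set x : SemidirectProduct (Multiplicative W) L (linToMulAut.comp ρ) := ⟨Multiplicative.ofAdd w, g⟩ with hx
  have hpow : ∀ a : ℕ, x ^ (a * N) = ⟨Multiplicative.ofAdd (a • y), 1⟩ := by
    intro a
    rw [hx, sd_pow, key, mul_comm a, pow_mul, hgN, one_pow]
  have hpy : ∀ a : ℕ, a • y = 0 ↔ p ∣ a := by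
    intro a
    rw [← Nat.cast_smul_eq_nsmul K, smul_eq_zero, CharP.cast_eq_zero_iff K p]
    simp [hw]
  have hdvdN : N ∣ orderOf x := by
    rw [← hN]
    apply orderOf_dvd_of_pow_eq_one
    have h1 := congrArg SemidirectProduct.right (pow_orderOf_eq_one x)
    rw [hx, sd_pow] at h1
    exact h1
  obtain ⟨a, ha⟩ := hdvdN
  apply Nat.dvd_antisymm
  · apply orderOf_dvd_of_pow_eq_one
    rw [hpow, (hpy p).2 dvd_rfl]; rfl
  · rw [ha, mul_comm]
    apply mul_dvd_mul_left
    rw [← hpy]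
    have h1 := pow_orderOf_eq_one x
    rw [ha, mul_comm, hpow] at h1
    have h2 := congrArg SemidirectProduct.left h1
    exact h2
end A
end PartA

section PartB
open Matrix Polynomial

set_option linter.unusedSectionVars false

section B
variable {F : Type} [Field F]

abbrev SL4 (F : Type) [Field F] := Matrix.SpecialLinearGroup (Fin 4) F
abbrev PSL4 (F : Type) [Field F] := SL4 F ⧸ Subgroup.center (SL4 F)

theorem smul_one_eq_scalar' {R : Type} [CommRing R] (c : R) :
    c • (1 : Matrix (Fin 4) (Fin 4) R) = scalar (Fin 4) c := by
  rw [scalar_apply, smul_one_eq_diagonal]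

theorem mk_eq_one_iff (M : SL4 F) :
    ((M : PSL4 F) = 1) ↔ ∃ r : F, (M : Matrix (Fin 4) (Fin 4) F) = scalar (Fin 4) r := by
  rw [QuotientGroup.eq_one_iff, Matrix.SpecialLinearGroup.mem_center_iff]
  constructor
  · rintro ⟨r, _, h⟩; exact ⟨r, h.symm⟩
  · rintro ⟨r, h⟩
    refine ⟨r, ?_, h.symm⟩
    have := M.2
    rw [h, ← smul_one_eq_scalar', det_smul, det_one, mul_one] at this
    exact this

theorem ord_dvd_iff (M : SL4 F) (n : ℕ) :
    orderOf (M : PSL4 F) ∣ n ↔ ∃ r : F, (M : Matrix (Fin 4) (Fin 4) F) ^ n = scalar (Fin 4) r := by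
  rw [orderOf_dvd_iff_pow_eq_one, ← QuotientGroup.mk_pow, mk_eq_one_iff, Matrix.SpecialLinearGroup.coe_pow]

variable {k : Type} [Field k] [IsAlgClosed k] (ι : F →+* k)

/-- eigenvalues over the closure -/
noncomputable def eig (M : SL4 F) : Multiset k := ((M : Matrix (Fin 4) (Fin 4) F).map ι).charpoly.roots

theorem eig_card (M : SL4 F) : Multiset.card (eig ι M) = 4 := by
  rw [eig, ← (IsAlgClosed.splits _).natDegree_eq_card_roots, charpoly_natDegree_eq_dim]; rfl

theorem eig_prod (M : SL4 F) : (eig ι M).prod = 1 := by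
  rw [eig, ← det_eq_prod_roots_charpoly]
  have := congrArg ι M.2
  rw [map_one] at this
  rw [← this, RingHom.map_det]; rfl

theorem map_pow_scalar_iff (A : Matrix (Fin 4) (Fin 4) F) (n : ℕ) :
    (∃ r : F, A ^ n = scalar (Fin 4) r) ↔ ∃ c : k, (A.map ι) ^ n = scalar (Fin 4) c := by
  have hmap : (A.map ι) ^ n = (A ^ n).map ι := by
    have := map_pow (ι.mapMatrix (m := Fin 4)) A n
    exact this.symm
  rw [hmap]
  constructor
  · rintro ⟨r, h⟩
    refine ⟨ι r, ?_⟩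
    rw [h]
    ext i j
    simp [scalar_apply, diagonal_apply]
    split_ifs <;> simp
  · rintro ⟨c, h⟩
    refine ⟨(A ^ n) 0 0, ?_⟩
    have h0 := congrFun (congrFun h 0) 0
    simp [scalar_apply] at h0
    ext i j
    apply ι.injective
    have h1 := congrFun (congrFun h i) j
    rw [map_apply] at h1
    rw [h1, ← h0]
    simp [scalar_apply, diagonal_apply]
    split_ifs <;> simp [h0]

theorem ord_dvd_iff' (M : SL4 F) (n : ℕ) :
    orderOf (M : PSL4 F) ∣ n ↔
      ∃ c : k, ((M : Matrix (Fin 4) (Fin 4) F).map ι) ^ n = scalar (Fin 4) c := by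
  rw [ord_dvd_iff]
  exact map_pow_scalar_iff ι _ n

theorem eig_pow_of_scalar (M : SL4 F) (n : ℕ) (c : k)
    (h : ((M : Matrix (Fin 4) (Fin 4) F).map ι) ^ n = scalar (Fin 4) c) (a : k) (ha : a ∈ eig ι M) :
    a ^ n = c := by
  set A := ((M : Matrix (Fin 4) (Fin 4) F).map ι) with hA
  have hr := isRoot_of_mem_roots ha
  rw [IsRoot, eval_charpoly, ← exists_mulVec_eq_zero_iff] at hr
  obtain ⟨v, hv, hv0⟩ := hr
  have h1 : A *ᵥ v = a • v := by
    rw [sub_mulVec, sub_eq_zero] at hv0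
    rw [← hv0, ← smul_one_eq_scalar', smul_mulVec, one_mulVec]
  have h2 : ∀ n : ℕ, A ^ n *ᵥ v = a ^ n • v := by
    intro n
    induction n with
    | zero => simp
    | succ n ih => rw [pow_succ, ← mulVec_mulVec, h1, mulVec_smul, ih, smul_smul, pow_succ']
  have h3 := h2 n
  rw [h, ← smul_one_eq_scalar', smul_mulVec, one_mulVec] at h3
  by_contra hne
  have : (a ^ n - c) • v = 0 := by rw [sub_smul, ← h3, sub_self]
  rw [smul_eq_zero, sub_eq_zero] at this
  tauto

open Classical in
theorem ord_dvd_of_eig (p : ℕ) [Fact p.Prime] [CharP k p] (M : SL4 F) (n e f : ℕ) (hn : 0 < n) (c : k)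
    (h : ∀ a ∈ eig ι M, a ^ n = c) (he : ∀ a, (eig ι M).count a ≤ e) (hf : e ≤ p ^ f) :
    orderOf (M : PSL4 F) ∣ n * p ^ f := by
  rw [ord_dvd_iff' ι]
  refine ⟨c ^ p ^ f, ?_⟩
  set A := ((M : Matrix (Fin 4) (Fin 4) F).map ι) with hA
  have hne : (X ^ n - C c : k[X]) ≠ 0 := X_pow_sub_C_ne_zero hn c
  have hd : A.charpoly ∣ (X ^ n - C c) ^ e := by
    rw [(IsAlgClosed.splits A.charpoly).eq_prod_roots, (charpoly_monic A).leadingCoeff, C_1, one_mul,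
      Multiset.prod_X_sub_C_dvd_iff_le_roots (pow_ne_zero _ hne), roots_pow, Multiset.le_iff_count]
    intro a
    rw [Multiset.count_nsmul]
    by_cases ha : a ∈ eig ι M
    · have h1 : 0 < Multiset.count a (X ^ n - C c : k[X]).roots := by
        rw [Multiset.count_pos, mem_roots hne]
        simp [h a ha]
      exact (he a).trans (Nat.le_mul_of_pos_right _ h1)
    · have : Multiset.count a A.charpoly.roots = 0 := Multiset.count_eq_zero_of_notMem ha
      omega
  have hd2 : A.charpoly ∣ (X ^ n - C c) ^ p ^ f := hd.trans (pow_dvd_pow _ hf)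
  rw [sub_pow_char_pow] at hd2
  have h2 := Polynomial.aeval_dvd (A := Matrix (Fin 4) (Fin 4) k) A hd2
  rw [aeval_self_charpoly, zero_dvd_iff] at h2
  simp only [map_sub, map_pow, aeval_X, aeval_C] at h2
  rw [pow_mul, sub_eq_zero.1 h2, ← map_pow]
  rfl
end B
end PartB

section PartB2
open Matrix Polynomial

def BadN (q n0 : ℕ) : Prop :=
  n0 = q - 1 ∨ n0 = q + 1 ∨ (q % 4 = 1 ∧ n0 = (q ^ 2 - 1) / 4) ∨ (q % 4 = 3 ∧ n0 = (q ^ 2 - 1) / 2)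

theorem q_arith1 (q : ℕ) (h : q % 4 = 1) : (q ^ 2 - 1) / 4 = (q + 1) * ((q - 1) / 4) := by
  obtain ⟨t, rfl⟩ : ∃ t, q = 4 * t + 1 := ⟨q / 4, by omega⟩
  have h1 : (4 * t + 1) ^ 2 - 1 = 4 * ((4 * t + 1 + 1) * t) := by
    have : (4 * t + 1) ^ 2 = 4 * ((4 * t + 1 + 1) * t) + 1 := by ring
    omega
  have h2 : (4 * t + 1 - 1) / 4 = t := by omega
  rw [h1, h2]; omega

theorem q_arith3 (q : ℕ) (h : q % 4 = 3) : (q ^ 2 - 1) / 2 = (q + 1) * ((q - 1) / 2) := by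
  obtain ⟨t, rfl⟩ : ∃ t, q = 2 * t + 1 := ⟨q / 2, by omega⟩
  have h1 : (2 * t + 1) ^ 2 - 1 = 2 * ((2 * t + 1 + 1) * t) := by
    have : (2 * t + 1) ^ 2 = 2 * ((2 * t + 1 + 1) * t) + 1 := by ring
    omega
  have h2 : (2 * t + 1 - 1) / 2 = t := by omega
  rw [h1, h2]; omega

theorem BadN_pos {q n0 : ℕ} (hq : 3 ≤ q) (h : BadN q n0) : 0 < n0 := by
  rcases h with h | h | ⟨h1, h⟩ | ⟨h1, h⟩
  · omega
  · omega
  · rw [h, q_arith1 q h1]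
    have : 0 < (q - 1) / 4 := by omega
    positivity
  · rw [h, q_arith3 q h1]
    have : 0 < (q - 1) / 2 := by omega
    positivity

theorem repeated_case {k : Type} [Field k] (q : ℕ) (hq : 3 ≤ q) (hodd : q % 2 = 1)
    (hinj : Function.Injective (fun x : k => x ^ q)) (R : Multiset k) (hc : Multiset.card R = 4)
    (hprod : R.prod = 1) (hfr : R.map (fun x => x ^ q) = R) (hnd : ¬ R.Nodup) :
    ∃ n0, BadN q n0 ∧ ∃ c, ∀ a ∈ R, a ^ n0 = c := by
  classical
  obtain ⟨a, ha⟩ : ∃ a, a ::ₘ a ::ₘ 0 ≤ R := by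
    by_contra hne
    push Not at hne
    exact hnd (Multiset.nodup_iff_le.2 hne)
  obtain ⟨S, rfl⟩ := Multiset.le_iff_exists_add.1 ha
  have hS : Multiset.card S = 2 := by simp at hc; omega
  obtain ⟨b, c, rfl⟩ := Multiset.card_eq_two.1 hS
  have hq1 : q - 1 + 1 = q := by omega
  have e1 : (a ::ₘ a ::ₘ 0 + {b, c} : Multiset k) = a ::ₘ a ::ₘ {b, c} := by
    rw [Multiset.cons_add, Multiset.cons_add, zero_add]
  rw [e1] at hprod hfr ⊢
  simp only [Multiset.map_cons, Multiset.prod_cons, Multiset.insert_eq_cons, Multiset.prod_singleton,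
    Multiset.map_singleton] at hprod hfr
  have ha0 : a ≠ 0 := by rintro rfl; simp at hprod
  have hb0 : b ≠ 0 := by rintro rfl; simp at hprod
  have hc0 : c ≠ 0 := by rintro rfl; simp at hprod
  have hF1 : ∀ x : k, x ≠ 0 → x ^ q = x → x ^ (q - 1) = 1 := by
    intro x hx h
    have : x ^ (q - 1) * x = 1 * x := by rw [← pow_succ, hq1, h, one_mul]
    exact mul_right_cancel₀ hx this
  by_cases haq : a ^ q = a
  · rw [haq, Multiset.cons_inj_right, Multiset.cons_inj_right] at hfr
    have h1 : (b ^ q = b ∧ c ^ q = c) ∨ (b ^ q = c ∧ c ^ q = b) := by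
      have hb : b ^ q ∈ (b ::ₘ {c} : Multiset k) := by rw [← hfr]; simp
      simp at hb
      rcases hb with hb | hb
      · left
        rw [hb, Multiset.cons_inj_right, Multiset.singleton_inj] at hfr
        exact ⟨hb, hfr⟩
      · right
        have h5 : (b ::ₘ {c} : Multiset k) = c ::ₘ {b} := Multiset.pair_comm b c
        rw [hb, h5, Multiset.cons_inj_right, Multiset.singleton_inj] at hfr
        exact ⟨hb, hfr⟩
    rcases h1 with ⟨hb, hc'⟩ | ⟨hb, hc'⟩
    · refine ⟨q - 1, Or.inl rfl, 1, ?_⟩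
      intro x hx
      simp at hx
      rcases hx with rfl | rfl | rfl
      · exact hF1 _ ha0 haq
      · exact hF1 _ hb0 hb
      · exact hF1 _ hc0 hc'
    · -- b^q = c
      have ha1 := hF1 a ha0 haq
      have hbq : b ^ (q + 1) = b * c := by rw [pow_succ, hb, mul_comm]
      have hcq : c ^ (q + 1) = b * c := by rw [pow_succ, hc']
      have haq1 : a ^ (q + 1) = a * a := by rw [pow_succ, haq]
      have hr : ∀ n, a ^ (4 * n) = 1 → (a * a) ^ n = (b * c) ^ n := by
        intro n hn
        have h2 : (a * a) ^ n * (b * c) ^ n = 1 := by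
          rw [← mul_pow, mul_assoc, hprod, one_pow]
        have h3 : (a * a) ^ n * (a * a) ^ n = 1 := by
          rw [← hn]; ring
        exact mul_left_cancel₀ (pow_ne_zero n (mul_ne_zero ha0 ha0)) (h3.trans h2.symm)
      have fin : ∀ n, a ^ (4 * n) = 1 → ∀ x ∈ (a ::ₘ a ::ₘ {b, c} : Multiset k),
          x ^ ((q + 1) * n) = (a * a) ^ n := by
        intro n hn x hx
        simp at hx
        rcases hx with rfl | rfl | rfl
        · rw [pow_mul, haq1]
        · rw [pow_mul, hbq, hr n hn]
        · rw [pow_mul, hcq, hr n hn]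
      have h4 : q % 4 = 1 ∨ q % 4 = 3 := by omega
      rcases h4 with h4 | h4
      · refine ⟨_, Or.inr (Or.inr (Or.inl ⟨h4, rfl⟩)), (a * a) ^ ((q - 1) / 4), ?_⟩
        · rw [q_arith1 q h4]
          apply fin
          have : 4 * ((q - 1) / 4) = q - 1 := by omega
          rw [this, ha1]
      · refine ⟨_, Or.inr (Or.inr (Or.inr ⟨h4, rfl⟩)), (a * a) ^ ((q - 1) / 2), ?_⟩
        · rw [q_arith3 q h4]
          apply fin
          have : 4 * ((q - 1) / 2) = (q - 1) * 2 := by omega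
          rw [this, pow_mul, ha1, one_pow]
  · -- a^q ≠ a
    have hcount : 2 ≤ Multiset.count (a ^ q) (a ::ₘ a ::ₘ b ::ₘ {c} : Multiset k) := by
      rw [← hfr, Multiset.count_cons_self, Multiset.count_cons_self]; omega
    have hbc : b = a ^ q ∧ c = a ^ q := by
      rw [Multiset.count_cons_of_ne haq, Multiset.count_cons_of_ne haq, Multiset.count_cons,
        Multiset.count_singleton] at hcount
      split_ifs at hcount with h1 h2 <;> first | omega | exact ⟨h2.symm, h1.symm⟩ | exact ⟨h1.symm, h2.symm⟩
    obtain ⟨rfl, rfl⟩ := hbc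
    have h2 : (a ^ q) ^ q = a := by
      have : a ∈ (a ^ q ::ₘ a ^ q ::ₘ (a ^ q) ^ q ::ₘ {(a ^ q) ^ q} : Multiset k) := by
        rw [hfr]; simp
      simp at this
      rcases this with h | h
      · exact absurd h.symm haq
      · exact h.symm
    refine ⟨q + 1, Or.inr (Or.inl rfl), a ^ (q + 1), ?_⟩
    intro x hx
    simp at hx
    rcases hx with rfl | rfl
    · rfl
    · rw [pow_succ, h2, pow_succ, mul_comm]

set_option linter.unusedSectionVars false

section
variable {F : Type} [Field F] [Fintype F] {k : Type} [Field k] [IsAlgClosed k] (ι : F →+* k)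
variable (p m : ℕ) [Fact p.Prime] [CharP k p]

theorem eig_frob (hF : Fintype.card F = p ^ m) (M : SL4 F) :
    (eig ι M).map (fun x => x ^ (p ^ m)) = eig ι M := by
  have h := (IsAlgClosed.splits (((M : Matrix (Fin 4) (Fin 4) F).map ι).charpoly)).roots_map
    (iterateFrobenius k p m)
  rw [charpoly_map, Polynomial.map_map] at h
  have h2 : (iterateFrobenius k p m).comp ι = ι := by
    ext x
    rw [RingHom.comp_apply, iterateFrobenius_def, ← map_pow, ← hF, FiniteField.pow_card]
  rw [h2, ← charpoly_map] at h
  exact h.symm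

theorem q_ge {p m : ℕ} [Fact p.Prime] (hp : Odd p) (hF : Fintype.card F = p ^ m) :
    3 ≤ p ^ m ∧ p ^ m % 2 = 1 := by
  have h1 : p ^ m % 2 = 1 := Nat.odd_iff.1 hp.pow
  have h2 : 1 < p ^ m := hF ▸ Fintype.one_lt_card
  omega

theorem frob_inj : Function.Injective (fun x : k => x ^ (p ^ m)) := by
  intro x y h
  exact (iterateFrobenius k p m).injective (by simpa [iterateFrobenius_def] using h)

/-- membership restriction in the spectrum of `PSL4` -/
theorem order_restrict (ι : F →+* k) (hp : Odd p) (hF : Fintype.card F = p ^ m) (g : PSL4 F) (N : ℕ)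
    (hN : p.Coprime N) (hg : orderOf g = p * N) : ∃ n0, BadN (p ^ m) n0 ∧ N ∣ n0 := by
  classical
  have hpp : p.Prime := Fact.out
  have hp3 : 3 ≤ p := by
    have := hpp.two_le
    rcases hp with ⟨t, rfl⟩; omega
  obtain ⟨hq3, hq2⟩ := q_ge (F := F) hp hF
  obtain ⟨M, rfl⟩ := QuotientGroup.mk_surjective g
  have hN0 : 0 < N := by
    rcases Nat.eq_zero_or_pos N with rfl | h
    · simp at hN; omega
    · exact h
  by_cases hnd : (eig ι M).Nodup
  · exfalso
    obtain ⟨c, hc⟩ := (ord_dvd_iff' ι M (p * N)).1 (hg ▸ dvd_rfl)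
    have h1 := eig_pow_of_scalar ι M _ c hc
    have hR : ∃ d, d ∈ eig ι M := by
      apply Multiset.card_pos_iff_exists_mem.1
      rw [eig_card]; omega
    obtain ⟨d, hd⟩ := hR
    have h2 : ∀ a ∈ eig ι M, a ^ N = d ^ N := by
      intro a ha
      apply frob_inj (k := k) p 1
      simp only [pow_one]
      rw [← pow_mul, ← pow_mul, mul_comm, h1 a ha, h1 d hd]
    have h3 := ord_dvd_of_eig ι p M N 1 0 hN0 _ h2 (Multiset.nodup_iff_count_le_one.1 hnd) (by simp)
    rw [hg, pow_zero, mul_one] at h3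
    have := Nat.le_of_dvd hN0 h3
    nlinarith
  · obtain ⟨n0, hbad, c, hc⟩ := repeated_case (p ^ m) hq3 hq2 (frob_inj p m) (eig ι M) (eig_card ι M)
      (eig_prod ι M) (eig_frob ι p m hF M) hnd
    refine ⟨n0, hbad, ?_⟩
    have h3 := ord_dvd_of_eig ι p M n0 4 2 (BadN_pos hq3 hbad) _ hc
      (fun a => (Multiset.count_le_card a _).trans (eig_card ι M).le) (by nlinarith)
    rw [hg] at h3
    have : N ∣ n0 * p ^ 2 := (dvd_mul_left N p).trans h3
    exact (Nat.Coprime.pow_right 2 hN.symm).dvd_of_dvd_mul_right this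

theorem exists_n0 (M : SL4 F) : ∃ n0, 0 < n0 ∧ p.Coprime n0 ∧ ∀ a ∈ eig ι M, a ^ n0 = 1 := by
  have hpp : p.Prime := Fact.out
  have ho : 0 < orderOf M := orderOf_pos M
  obtain ⟨e, n, hn, h⟩ := Nat.exists_eq_pow_mul_and_not_dvd ho.ne' p hpp.ne_one
  refine ⟨n, Nat.pos_of_ne_zero (by rintro rfl; simp at hn), (Nat.Prime.coprime_iff_not_dvd hpp).2 hn, ?_⟩
  intro a ha
  have h1 : ((M : Matrix (Fin 4) (Fin 4) F).map ι) ^ orderOf M = scalar (Fin 4) 1 := by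
    have h2 : (M : Matrix (Fin 4) (Fin 4) F) ^ orderOf M = 1 := by
      rw [← Matrix.SpecialLinearGroup.coe_pow, pow_orderOf_eq_one, Matrix.SpecialLinearGroup.coe_one]
    have := map_pow (ι.mapMatrix (m := Fin 4)) (M : Matrix (Fin 4) (Fin 4) F) (orderOf M)
    rw [h2, map_one] at this
    rw [map_one]
    exact this.symm
  have h3 := eig_pow_of_scalar ι M _ _ h1 a ha
  rw [h, mul_comm, pow_mul] at h3
  apply frob_inj (k := k) p e
  simp [h3]

theorem order_p_sq (ι : F →+* k) (hp : 5 ≤ p) (g : PSL4 F) : orderOf g ≠ p * p := by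
  classical
  intro hg
  have hpp : p.Prime := Fact.out
  obtain ⟨M, rfl⟩ := QuotientGroup.mk_surjective g
  obtain ⟨n0, hn0, hco, h⟩ := exists_n0 ι p M
  have h3 := ord_dvd_of_eig ι p M n0 4 1 hn0 _ h
      (fun a => (Multiset.count_le_card a _).trans (eig_card ι M).le) (by rw [pow_one]; omega)
  rw [hg, pow_one, Nat.mul_dvd_mul_iff_right hpp.pos] at h3
  exact ((Nat.Prime.coprime_iff_not_dvd hpp).1 hco) h3

theorem order_18 (ι : F →+* k) [CharP k 3] (g : PSL4 F) : orderOf g ≠ 18 := by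
  classical
  have : Fact (Nat.Prime 3) := ⟨by norm_num⟩
  intro hg
  obtain ⟨M, rfl⟩ := QuotientGroup.mk_surjective g
  by_cases hall : ∃ c, ∀ a ∈ eig ι M, a = c
  · obtain ⟨c, hc⟩ := hall
    have h3 := ord_dvd_of_eig ι 3 M 1 4 2 one_pos c (by simpa using hc)
      (fun a => (Multiset.count_le_card a _).trans (eig_card ι M).le) (by norm_num)
    rw [hg] at h3
    norm_num at h3
  · obtain ⟨n0, hn0, hco, h⟩ := exists_n0 ι 3 M
    have h3 := ord_dvd_of_eig ι 3 M n0 3 1 hn0 _ h ?_ (by norm_num)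
    · rw [hg] at h3
      have : ¬ 3 ∣ n0 := (Nat.Prime.coprime_iff_not_dvd (by norm_num)).1 hco
      omega
    · intro a
      by_contra hlt
      push Not at hlt hall
      obtain ⟨b, hb, hba⟩ := hall a
      have hl : Multiset.card (eig ι M) ≤ Multiset.count a (eig ι M) := by rw [eig_card]; omega
      have h4 := (Multiset.count_eq_card).1 (le_antisymm (Multiset.count_le_card a _) hl)
      exact hba (h4 b hb).symm
end
end PartB2

section PartE1
open Matrix

theorem pfix (p : ℕ) [hp : Fact p.Prime] {V : Type} [AddCommGroup V] (hpV : ∀ v : V, p • v = 0)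
    {Q : Type} [Group Q] [Finite Q] (hQ : IsPGroup p Q) (act : Q →* AddMonoid.End V)
    (S : AddSubgroup V) (hS : ∀ q, ∀ v ∈ S, act q v ∈ S) (v : V) (hv : v ∈ S) (hv0 : v ≠ 0) :
    ∃ w ∈ S, w ≠ 0 ∧ ∀ q, act q w = w := by
  set A : AddSubgroup V := AddSubgroup.closure (Set.range (fun q => act q v)) with hA
  have hAS : A ≤ S := by
    rw [hA, AddSubgroup.closure_le]
    rintro _ ⟨q, rfl⟩
    exact hS q v hv
  have hAinv : ∀ q, ∀ a ∈ A, act q a ∈ A := by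
    intro q a ha
    have : A ≤ A.comap (act q) := by
      conv_lhs => rw [hA]
      rw [AddSubgroup.closure_le]
      rintro _ ⟨q', rfl⟩
      change act q (act q' v) ∈ A
      apply AddSubgroup.subset_closure
      exact ⟨q * q', by simp only [map_mul]; rfl⟩
    exact this ha
  have hvA : v ∈ A := AddSubgroup.subset_closure ⟨1, by simp only [map_one]; rfl⟩
  have hfg : AddGroup.FG A := by
    rw [hA]
    exact AddGroup.closure_finite_fg _
  have hfin : Finite A := by
    apply AddCommGroup.finite_of_fg_isAddTorsion
    intro a
    rw [isOfFinAddOrder_iff_nsmul_eq_zero]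
    exact ⟨p, hp.out.pos, Subtype.ext (hpV a)⟩
  let : MulAction Q A :=
    { smul := fun q a => ⟨act q a, hAinv q a a.2⟩
      one_smul := fun a => Subtype.ext (by change act 1 (a : V) = a; rw [map_one]; rfl)
      mul_smul := fun q q' a => Subtype.ext (by
        change act (q * q') (a : V) = act q (act q' a); rw [map_mul]; rfl) }
  have hdvd : p ∣ Nat.card A := by
    have h1 : addOrderOf (⟨v, hvA⟩ : A) = p := by
      apply addOrderOf_eq_prime
      · exact Subtype.ext (hpV v)
      · intro h; exact hv0 (congrArg Subtype.val h)
    rw [← h1]; exact addOrderOf_dvd_natCard _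
  have h0 : (0 : A) ∈ MulAction.fixedPoints Q A := by
    intro q; exact Subtype.ext (map_zero (act q))
  obtain ⟨b, hb, hb0⟩ := hQ.exists_fixed_point_of_prime_dvd_card_of_fixed_point A hdvd h0
  refine ⟨b, hAS b.2, fun h => hb0 (Subtype.ext h.symm), fun q => congrArg Subtype.val (hb q)⟩

section proj
variable {F : Type} [Field F] [Fintype F] {k : Type} [Field k] (ι : F →+* k)

/-- projection to a torus weight -/
theorem torus_proj {G : Type} [Group G] (h : Fˣ →* G) (S : Submodule k (G → k))
    (hS : ∀ c ∈ S, ∀ t, (fun g => c (g * h t)) ∈ S) (c : G → k) (hc : c ∈ S) (hc0 : c ≠ 0) :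
    ∃ r < Fintype.card F - 1, ∃ c' ∈ S, c' ≠ 0 ∧ ∀ g t, c' (g * h t) = (ι t) ^ r * c' g := by
  classical
  set n := Fintype.card F - 1 with hn
  have hnpos : 0 < n := by have := Fintype.one_lt_card (α := F); omega
  have hpow : ∀ t : Fˣ, (t : F) ^ n = 1 := fun t => FiniteField.pow_card_sub_one_eq_one _ t.ne_zero
  let P : ℕ → (G → k) := fun r g => ∑ t : Fˣ, (ι (t⁻¹ : Fˣ)) ^ r * c (g * h t)
  have hP : ∀ r, P r ∈ S := by
    intro r
    have : P r = ∑ t : Fˣ, ((ι (t⁻¹ : Fˣ)) ^ r) • (fun g => c (g * h t)) := by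
      ext g; simp [P]
    rw [this]
    exact S.sum_mem fun t _ => S.smul_mem _ (hS c hc t)
  have hsum : ∀ g, ∑ r ∈ Finset.range n, P r g = (n : k) * c g := by
    intro g
    simp only [P]
    rw [Finset.sum_comm]
    rw [Finset.sum_eq_single 1]
    · simp
    · intro t _ ht
      rw [← Finset.sum_mul]
      have h1 : ι (t⁻¹ : Fˣ) ≠ 1 := by
        intro h; apply ht
        have : ((t⁻¹ : Fˣ) : F) = 1 := ι.injective (by rw [h, map_one])
        rw [Units.val_eq_one] at this
        exact inv_eq_one.1 this
      rw [geom_sum_eq h1, ← map_pow, hpow]; simp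
    · simp
  have hn0 : (n : k) ≠ 0 := by
    have h1 : ((Fintype.card F : ℕ) : k) = 0 := by
      have : ((Fintype.card F : ℕ) : F) = 0 := FiniteField.cast_card_eq_zero F
      rw [← map_natCast ι, this, map_zero]
    have h2 : (n : k) + 1 = 0 := by
      rw [← h1, hn]; norm_cast; have := Fintype.one_lt_card (α := F); congr 1; omega
    intro h; rw [h, zero_add] at h2; exact one_ne_zero h2
  by_contra hcon
  push Not at hcon
  have hall : ∀ r < n, P r = 0 := by
    intro r hr
    by_contra hne
    obtain ⟨g, t, hgt⟩ := hcon r hr (P r) (hP r) hne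
    apply hgt
    simp only [P]
    rw [Finset.mul_sum]
    apply Fintype.sum_equiv (Equiv.mulLeft t)
    intro s
    simp only [Equiv.coe_mulLeft]
    rw [map_mul, mul_assoc, mul_inv, Units.val_mul, map_mul, mul_pow, ← mul_assoc (ι t ^ r), ← mul_assoc (ι t ^ r),
      ← mul_pow, ← map_mul ι (t : F), Units.mul_inv, map_one, one_pow, one_mul]
  apply hc0
  ext g
  have := hsum g
  rw [Finset.sum_eq_zero (fun r hr => by rw [hall r (Finset.mem_range.1 hr)]; rfl)] at this
  exact (mul_eq_zero.1 this.symm).resolve_left hn0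
end proj
end PartE1

section PartE2
open Matrix

section minors
variable {R : Type} [CommRing R]

def D1 (A : Matrix (Fin 4) (Fin 4) R) : R := A 0 0
def D2 (A : Matrix (Fin 4) (Fin 4) R) : R := A 0 0 * A 1 1 - A 0 1 * A 1 0
def D3 (A : Matrix (Fin 4) (Fin 4) R) : R :=
  A 0 0 * (A 1 1 * A 2 2 - A 1 2 * A 2 1) - A 0 1 * (A 1 0 * A 2 2 - A 1 2 * A 2 0)
    + A 0 2 * (A 1 0 * A 2 1 - A 1 1 * A 2 0)
def PP (r s t : ℕ) (A : Matrix (Fin 4) (Fin 4) R) : R := D1 A ^ r * D2 A ^ s * D3 A ^ t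

def UT (B : Matrix (Fin 4) (Fin 4) R) : Prop :=
  (B 0 0 = 1 ∧ B 1 1 = 1 ∧ B 2 2 = 1 ∧ B 3 3 = 1) ∧
  (B 1 0 = 0 ∧ B 2 0 = 0 ∧ B 2 1 = 0 ∧ B 3 0 = 0 ∧ B 3 1 = 0 ∧ B 3 2 = 0)

theorem UT.eq {B : Matrix (Fin 4) (Fin 4) R} (h : UT B) :
    B = !![1, B 0 1, B 0 2, B 0 3; 0, 1, B 1 2, B 1 3; 0, 0, 1, B 2 3; 0, 0, 0, 1] := by
  obtain ⟨⟨h1, h2, h3, h4⟩, h5, h6, h7, h8, h9, h10⟩ := h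
  ext i j
  fin_cases i <;> fin_cases j <;> simp [*]

theorem UT.one : UT (1 : Matrix (Fin 4) (Fin 4) R) := by simp [UT]

theorem UT.mul {A B : Matrix (Fin 4) (Fin 4) R} (hA : UT A) (hB : UT B) : UT (A * B) := by
  obtain ⟨⟨h1, h2, h3, h4⟩, h5, h6, h7, h8, h9, h10⟩ := hA
  obtain ⟨⟨i1, i2, i3, i4⟩, i5, i6, i7, i8, i9, i10⟩ := hB
  simp [UT, mul_apply, Fin.sum_univ_four, *]

theorem UT.nil {B : Matrix (Fin 4) (Fin 4) R} (h : UT B) : (B - 1) ^ 4 = 0 := by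
  rw [h.eq]
  generalize B 0 1 = a; generalize B 0 2 = b; generalize B 0 3 = c
  generalize B 1 2 = d; generalize B 1 3 = e; generalize B 2 3 = f
  have : (!![1, a, b, c; 0, 1, d, e; 0, 0, 1, f; 0, 0, 0, 1] - 1 : Matrix (Fin 4) (Fin 4) R) =
      !![0, a, b, c; 0, 0, d, e; 0, 0, 0, f; 0, 0, 0, 0] := by
    ext i j
    fin_cases i <;> fin_cases j <;> simp
  rw [this, pow_succ, pow_succ, pow_two]
  ext i j
  fin_cases i <;> fin_cases j <;> simp [mul_apply, Fin.sum_univ_four]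

theorem D_mul_UT {A B : Matrix (Fin 4) (Fin 4) R} (hB : UT B) :
    D1 (A * B) = D1 A ∧ D2 (A * B) = D2 A ∧ D3 (A * B) = D3 A := by
  obtain ⟨⟨i1, i2, i3, i4⟩, i5, i6, i7, i8, i9, i10⟩ := hB
  simp only [D1, D2, D3, mul_apply, Fin.sum_univ_four, i1, i2, i3, i5, i6, i7, i8, i9, i10]
  refine ⟨?_, ?_, ?_⟩ <;> ring

theorem D_transpose (A : Matrix (Fin 4) (Fin 4) R) : D1 Aᵀ = D1 A ∧ D2 Aᵀ = D2 A ∧ D3 Aᵀ = D3 A := by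
  simp only [D1, D2, D3, transpose_apply]
  refine ⟨trivial, ?_, ?_⟩ <;> ring

theorem D_UT_mul {A B : Matrix (Fin 4) (Fin 4) R} (hB : UT B) :
    D1 (Bᵀ * A) = D1 A ∧ D2 (Bᵀ * A) = D2 A ∧ D3 (Bᵀ * A) = D3 A := by
  have h := D_mul_UT (A := Aᵀ) hB
  have h2 := D_transpose (Aᵀ * B)
  have h3 := D_transpose A
  rw [transpose_mul, transpose_transpose] at h2
  rw [h2.1, h2.2.1, h2.2.2, h.1, h.2.1, h.2.2]
  exact h3

theorem PP_transpose (r s t : ℕ) (A : Matrix (Fin 4) (Fin 4) R) : PP r s t Aᵀ = PP r s t A := by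
  obtain ⟨h1, h2, h3⟩ := D_transpose A
  rw [PP, PP, h1, h2, h3]

theorem D_mul_diag (A : Matrix (Fin 4) (Fin 4) R) (d : Fin 4 → R) :
    D1 (A * diagonal d) = D1 A * d 0 ∧ D2 (A * diagonal d) = D2 A * (d 0 * d 1) ∧
    D3 (A * diagonal d) = D3 A * (d 0 * d 1 * d 2) := by
  simp only [D1, D2, D3, mul_diagonal]
  refine ⟨trivial, ?_, ?_⟩ <;> ring

theorem det4 (A : Matrix (Fin 4) (Fin 4) R) : A.det =
    A 0 0 * (A 1 1 * (A 2 2 * A 3 3 - A 2 3 * A 3 2) - A 1 2 * (A 2 1 * A 3 3 - A 2 3 * A 3 1)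
      + A 1 3 * (A 2 1 * A 3 2 - A 2 2 * A 3 1))
    - A 0 1 * (A 1 0 * (A 2 2 * A 3 3 - A 2 3 * A 3 2) - A 1 2 * (A 2 0 * A 3 3 - A 2 3 * A 3 0)
      + A 1 3 * (A 2 0 * A 3 2 - A 2 2 * A 3 0))
    + A 0 2 * (A 1 0 * (A 2 1 * A 3 3 - A 2 3 * A 3 1) - A 1 1 * (A 2 0 * A 3 3 - A 2 3 * A 3 0)
      + A 1 3 * (A 2 0 * A 3 1 - A 2 1 * A 3 0))
    - A 0 3 * (A 1 0 * (A 2 1 * A 3 2 - A 2 2 * A 3 1) - A 1 1 * (A 2 0 * A 3 2 - A 2 2 * A 3 0)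
      + A 1 2 * (A 2 0 * A 3 1 - A 2 1 * A 3 0)) := by
  have h : A = !![A 0 0, A 0 1, A 0 2, A 0 3; A 1 0, A 1 1, A 1 2, A 1 3;
      A 2 0, A 2 1, A 2 2, A 2 3; A 3 0, A 3 1, A 3 2, A 3 3] := by
    ext i j
    fin_cases i <;> fin_cases j <;> rfl
  conv_lhs => rw [h]
  simp [det_succ_row_zero, Fin.sum_univ_succ, Fin.succAbove]
  ring
end minors

section SLs
variable {F : Type} [Field F]

def upSL (a b c d e f : F) : SL4 F :=
  ⟨!![1, a, b, c; 0, 1, d, e; 0, 0, 1, f; 0, 0, 0, 1], by rw [det4]; simp⟩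

theorem upSL_UT (a b c d e f : F) : UT (upSL a b c d e f).1 := by
  simp [UT, upSL]

def trSL (g : SL4 F) : SL4 F := ⟨g.1ᵀ, by rw [det_transpose]; exact g.2⟩

theorem trSL_mul (g h : SL4 F) : trSL (g * h) = trSL h * trSL g :=
  Subtype.ext (transpose_mul g.1 h.1)

/-- `y i u`: lower elementary matrix -/
def yy (i : Fin 3) (u : F) : SL4 F :=
  Matrix.SpecialLinearGroup.transvection (i := i.succ) (j := i.castSucc) (Fin.castSucc_lt_succ).ne' u

theorem mul_yy0 (g : SL4 F) (u : F) (a : Fin 4) : (g * yy 0 u).1 a 0 = g.1 a 0 + u * g.1 a 1 ∧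
    (g * yy 0 u).1 a 1 = g.1 a 1 ∧ (g * yy 0 u).1 a 2 = g.1 a 2 ∧ (g * yy 0 u).1 a 3 = g.1 a 3 := by
  have : (g * yy 0 u).1 = g.1 * (1 + single 1 0 u) := rfl
  rw [this]
  refine ⟨?_, ?_, ?_, ?_⟩ <;> simp [mul_apply, Fin.sum_univ_four, single_apply, mul_comm]

theorem mul_yy1 (g : SL4 F) (u : F) (a : Fin 4) : (g * yy 1 u).1 a 1 = g.1 a 1 + u * g.1 a 2 ∧
    (g * yy 1 u).1 a 0 = g.1 a 0 ∧ (g * yy 1 u).1 a 2 = g.1 a 2 ∧ (g * yy 1 u).1 a 3 = g.1 a 3 := by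
  have : (g * yy 1 u).1 = g.1 * (1 + single 2 1 u) := rfl
  rw [this]
  refine ⟨?_, ?_, ?_, ?_⟩ <;> simp [mul_apply, Fin.sum_univ_four, single_apply, mul_comm]

theorem mul_yy2 (g : SL4 F) (u : F) (a : Fin 4) : (g * yy 2 u).1 a 2 = g.1 a 2 + u * g.1 a 3 ∧
    (g * yy 2 u).1 a 0 = g.1 a 0 ∧ (g * yy 2 u).1 a 1 = g.1 a 1 ∧ (g * yy 2 u).1 a 3 = g.1 a 3 := by
  have : (g * yy 2 u).1 = g.1 * (1 + single 3 2 u) := rfl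
  rw [this]
  refine ⟨?_, ?_, ?_, ?_⟩ <;> simp [mul_apply, Fin.sum_univ_four, single_apply, mul_comm]

end SLs
end PartE2

section PartE3
open Matrix

set_option linter.unusedSectionVars false
section van
variable {F : Type} [Field F] [Fintype F] {k : Type} [Field k]

theorem trv (u g v : SL4 F) : (trSL u * g * v).1 = u.1ᵀ * g.1 * v.1 := rfl

theorem trv2 (a b c d e f a' b' c' d' e' f' : F) (g : SL4 F) :
    (trSL (upSL a b c d e f) * g * upSL a' b' c' d' e' f').1 =
    !![1, a, b, c; 0, 1, d, e; 0, 0, 1, f; 0, 0, 0, 1]ᵀ * g.1 *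
    !![1, a', b', c'; 0, 1, d', e'; 0, 0, 1, f'; 0, 0, 0, 1] := rfl

theorem clear0 (g : SL4 F) (h0 : g.1 0 0 ≠ 0) : ∃ u v : SL4 F, UT u.1 ∧ UT v.1 ∧
    ∀ j : Fin 4, j ≠ 0 → (trSL u * g * v).1 0 j = 0 ∧ (trSL u * g * v).1 j 0 = 0 := by
  refine ⟨upSL (-(g.1 1 0 / g.1 0 0)) (-(g.1 2 0 / g.1 0 0)) (-(g.1 3 0 / g.1 0 0)) 0 0 0,
    upSL (-(g.1 0 1 / g.1 0 0)) (-(g.1 0 2 / g.1 0 0)) (-(g.1 0 3 / g.1 0 0)) 0 0 0,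
    upSL_UT _ _ _ _ _ _, upSL_UT _ _ _ _ _ _, ?_⟩
  intro j hj
  rw [trv2]
  fin_cases j
  · exact absurd rfl hj
  all_goals
    constructor <;> simp [mul_apply, Fin.sum_univ_four]
  all_goals try field_simp
  all_goals try ring

theorem clear1 (g : SL4 F) (h0 : g.1 1 1 ≠ 0)
    (hz : ∀ j : Fin 4, j ≠ 0 → g.1 0 j = 0 ∧ g.1 j 0 = 0) : ∃ u v : SL4 F, UT u.1 ∧ UT v.1 ∧
    (∀ j : Fin 4, j ≠ 0 → (trSL u * g * v).1 0 j = 0 ∧ (trSL u * g * v).1 j 0 = 0) ∧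
    ∀ j : Fin 4, j ≠ 1 → (trSL u * g * v).1 1 j = 0 ∧ (trSL u * g * v).1 j 1 = 0 := by
  refine ⟨upSL 0 0 0 (-(g.1 2 1 / g.1 1 1)) (-(g.1 3 1 / g.1 1 1)) 0,
    upSL 0 0 0 (-(g.1 1 2 / g.1 1 1)) (-(g.1 1 3 / g.1 1 1)) 0,
    upSL_UT _ _ _ _ _ _, upSL_UT _ _ _ _ _ _, ?_, ?_⟩
  all_goals
    have h1 := hz 1 (by decide)
    have h2 := hz 2 (by decide)
    have h3 := hz 3 (by decide)
    intro j hj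
    rw [trv2]
    fin_cases j
  all_goals first | exact absurd rfl hj | skip
  all_goals
    constructor <;> simp [mul_apply, Fin.sum_univ_four, h1, h2, h3]
  all_goals try field_simp
  all_goals try ring

theorem clear2 (g : SL4 F) (h0 : g.1 2 2 ≠ 0)
    (hz : ∀ j : Fin 4, j ≠ 0 → g.1 0 j = 0 ∧ g.1 j 0 = 0)
    (hy : ∀ j : Fin 4, j ≠ 1 → g.1 1 j = 0 ∧ g.1 j 1 = 0) : ∃ u v : SL4 F, UT u.1 ∧ UT v.1 ∧
    (∀ i j : Fin 4, i ≠ j → (trSL u * g * v).1 i j = 0) := by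
  refine ⟨upSL 0 0 0 0 0 (-(g.1 3 2 / g.1 2 2)),
    upSL 0 0 0 0 0 (-(g.1 2 3 / g.1 2 2)),
    upSL_UT _ _ _ _ _ _, upSL_UT _ _ _ _ _ _, ?_⟩
  have h1 := hz 1 (by decide)
  have h2 := hz 2 (by decide)
  have h3 := hz 3 (by decide)
  have h5 := hy 2 (by decide)
  have h6 := hy 3 (by decide)
  intro i j hj
  rw [trv2]
  fin_cases i <;> fin_cases j
  all_goals first | exact absurd rfl hj | skip
  all_goals
    simp [mul_apply, Fin.sum_univ_four, h1, h2, h3, h5, h6]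
  all_goals try field_simp
  all_goals try ring

theorem vanish (e : SL4 F → k) (eU : ∀ g u, UT u.1 → e (g * u) = e g)
    (eL : ∀ g u, UT u.1 → e (trSL u * g) = e g)
    (eT : ∀ g : SL4 F, (∀ i j : Fin 4, i ≠ j → g.1 i j = 0) → e g = 0)
    (eY : ∀ i g, ∑ u : F, e (g * yy i u) = 0) : ∀ g, e g = 0 := by
  have eY' : ∀ i g, (∀ u : F, u ≠ 0 → e (g * yy i u) = 0) → e g = 0 := by
    intro i g h
    have h1 := eY i g
    rw [Finset.sum_eq_single 0 (fun u _ hu => h u hu) (by simp)] at h1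
    rwa [yy, Matrix.SpecialLinearGroup.transvection_coeff_zero, mul_one] at h1
  have inv : ∀ g u v : SL4 F, UT u.1 → UT v.1 → e (trSL u * g * v) = e g ∧
      D1 (trSL u * g * v).1 = D1 g.1 ∧ D2 (trSL u * g * v).1 = D2 g.1 ∧
      D3 (trSL u * g * v).1 = D3 g.1 := by
    intro g u v hu hv
    have h1 := D_mul_UT (A := (trSL u * g).1) hv
    have h2 := D_UT_mul (A := g.1) hu
    refine ⟨by rw [eU _ _ hv, eL _ _ hu], ?_, ?_, ?_⟩
    · exact h1.1.trans h2.1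
    · exact h1.2.1.trans h2.2.1
    · exact h1.2.2.trans h2.2.2
  have C1 : ∀ g : SL4 F, D1 g.1 ≠ 0 → D2 g.1 ≠ 0 → D3 g.1 ≠ 0 → e g = 0 := by
    intro g h1 h2 h3
    obtain ⟨u, v, hu, hv, hz⟩ := clear0 g h1
    obtain ⟨i0, i1, i2, i3⟩ := inv g u v hu hv
    rw [← i0]; rw [← i1] at h1; rw [← i2] at h2; rw [← i3] at h3
    generalize trSL u * g * v = g at *
    clear i0 i1 i2 i3
    have h11 : g.1 1 1 ≠ 0 := by
      intro h; apply h2; simp [D2, h, hz 1 (by decide)]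
    obtain ⟨u, v, hu, hv, hz', hy⟩ := clear1 g h11 hz
    obtain ⟨i0, i1, i2, i3⟩ := inv g u v hu hv
    rw [← i0]; rw [← i1] at h1; rw [← i2] at h2; rw [← i3] at h3
    generalize trSL u * g * v = g at *
    clear i0 i1 i2 i3
    have h22 : g.1 2 2 ≠ 0 := by
      intro h; apply h3; simp [D3, h, hz' 1 (by decide), hz' 2 (by decide), hy 2 (by decide)]
    obtain ⟨u, v, hu, hv, hd⟩ := clear2 g h22 hz' hy
    obtain ⟨i0, i1, i2, i3⟩ := inv g u v hu hv
    rw [← i0]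
    exact eT _ hd
  have C2 : ∀ g : SL4 F, D1 g.1 ≠ 0 → D2 g.1 ≠ 0 → e g = 0 := by
    intro g h1 h2
    by_cases h3 : D3 g.1 = 0
    · apply eY' 2
      intro u hu
      have y0 := mul_yy2 g u 0
      have y1 := mul_yy2 g u 1
      have y2 := mul_yy2 g u 2
      apply C1
      · simpa only [D1, y0] using h1
      · simpa only [D2, y0, y1] using h2
      · intro h3'
        have hm : g.1 0 0 * (g.1 1 1 * g.1 2 3 - g.1 1 3 * g.1 2 1)
            - g.1 0 1 * (g.1 1 0 * g.1 2 3 - g.1 1 3 * g.1 2 0)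
            + g.1 0 3 * (g.1 1 0 * g.1 2 1 - g.1 1 1 * g.1 2 0) = 0 := by
          have : u * (g.1 0 0 * (g.1 1 1 * g.1 2 3 - g.1 1 3 * g.1 2 1)
            - g.1 0 1 * (g.1 1 0 * g.1 2 3 - g.1 1 3 * g.1 2 0)
            + g.1 0 3 * (g.1 1 0 * g.1 2 1 - g.1 1 1 * g.1 2 0)) = 0 := by
            simp only [D3, y0, y1, y2] at h3' h3
            linear_combination h3' - h3
          exact (mul_eq_zero.1 this).resolve_left hu
        apply h2
        have hdet := g.2
        rw [det4] at hdet
        simp only [D2, D3] at *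
        linear_combination (- (g.1 0 0 * g.1 1 1 - g.1 0 1 * g.1 1 0)) * hdet
          + (g.1 0 0 * (g.1 1 1 * g.1 3 3 - g.1 1 3 * g.1 3 1)
            - g.1 0 1 * (g.1 1 0 * g.1 3 3 - g.1 1 3 * g.1 3 0)
            + g.1 0 3 * (g.1 1 0 * g.1 3 1 - g.1 1 1 * g.1 3 0)) * h3
          - (g.1 0 0 * (g.1 1 1 * g.1 3 2 - g.1 1 2 * g.1 3 1)
            - g.1 0 1 * (g.1 1 0 * g.1 3 2 - g.1 1 2 * g.1 3 0)
            + g.1 0 2 * (g.1 1 0 * g.1 3 1 - g.1 1 1 * g.1 3 0)) * hm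
    · exact C1 g h1 h2 h3
  have C3 : ∀ g : SL4 F, D1 g.1 ≠ 0 → g.1 0 0 * g.1 1 2 - g.1 0 2 * g.1 1 0 ≠ 0 → e g = 0 := by
    intro g h1 h2
    by_cases h3 : D2 g.1 = 0
    · apply eY' 1
      intro u hu
      have y0 := mul_yy1 g u 0
      have y1 := mul_yy1 g u 1
      apply C2
      · simpa only [D1, y0] using h1
      · intro h
        apply mul_ne_zero hu h2
        simp only [D2, y0, y1] at h h3
        linear_combination h - h3
    · exact C2 g h1 h3
  have C4 : ∀ g : SL4 F, D1 g.1 ≠ 0 → e g = 0 := by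
    intro g h1
    by_cases h2 : D2 g.1 = 0
    · by_cases h3 : g.1 0 0 * g.1 1 2 - g.1 0 2 * g.1 1 0 = 0
      · apply eY' 2
        intro u hu
        have y0 := mul_yy2 g u 0
        have y1 := mul_yy2 g u 1
        apply C3
        · simpa only [D1, y0] using h1
        · rw [y0.1, y0.2.1, y1.1, y1.2.1]
          intro h
          have h4 : g.1 0 0 * g.1 1 3 - g.1 0 3 * g.1 1 0 = 0 := by
            have : u * (g.1 0 0 * g.1 1 3 - g.1 0 3 * g.1 1 0) = 0 := by linear_combination h - h3
            exact (mul_eq_zero.1 this).resolve_left hu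
          have hdet := g.2
          rw [det4] at hdet
          simp only [D1, D2] at h1 h2
          apply h1
          linear_combination (- g.1 0 0) * hdet + g.1 0 0 * (g.1 2 2 * g.1 3 3 - g.1 2 3 * g.1 3 2) * h2
            - g.1 0 0 * (g.1 2 1 * g.1 3 3 - g.1 2 3 * g.1 3 1) * h3
            + g.1 0 0 * (g.1 2 1 * g.1 3 2 - g.1 2 2 * g.1 3 1) * h4
            + (g.1 2 0 * g.1 3 3 - g.1 2 3 * g.1 3 0) * (g.1 0 1 * h3 - g.1 0 2 * h2)
            - (g.1 2 0 * g.1 3 2 - g.1 2 2 * g.1 3 0) * (g.1 0 1 * h4 - g.1 0 3 * h2)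
            + (g.1 2 0 * g.1 3 1 - g.1 2 1 * g.1 3 0) * (g.1 0 2 * h4 - g.1 0 3 * h3)
      · exact C3 g h1 h3
    · exact C2 g h1 h2
  have C5 : ∀ g : SL4 F, g.1 0 1 ≠ 0 → e g = 0 := by
    intro g h
    by_cases h1 : D1 g.1 = 0
    · apply eY' 0
      intro u hu
      apply C4
      rw [D1] at h1 ⊢
      rw [(mul_yy0 g u 0).1, h1, zero_add]
      exact mul_ne_zero hu h
    · exact C4 g h1
  have C6 : ∀ g : SL4 F, g.1 0 2 ≠ 0 → e g = 0 := by
    intro g h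
    by_cases h1 : g.1 0 1 = 0
    · apply eY' 1
      intro u hu
      apply C5
      rw [(mul_yy1 g u 0).1, h1, zero_add]
      exact mul_ne_zero hu h
    · exact C5 g h1
  intro g
  by_cases h1 : g.1 0 2 = 0
  · by_cases h2 : g.1 0 3 = 0
    · by_cases h3 : g.1 0 1 = 0
      · apply C4
        intro h4
        have hdet := g.2
        rw [det4] at hdet
        rw [D1] at h4
        simp [h1, h2, h3, h4] at hdet
      · exact C5 g h3
    · apply eY' 2
      intro u hu
      apply C6
      rw [(mul_yy2 g u 0).1, h1, zero_add]
      exact mul_ne_zero hu h2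
  · exact C6 g h1
end van
end PartE3

section PartE4
open Matrix
set_option linter.unusedSectionVars false

section E4
variable {F : Type} [Field F] [Fintype F]

theorem sum_affine_pow (A B : F) (r : ℕ) (hr : r < Fintype.card F - 1) :
    ∑ u : F, (A + u * B) ^ r = 0 := by
  simp_rw [add_comm A, add_pow, mul_pow]
  rw [Finset.sum_comm]
  apply Finset.sum_eq_zero
  intro j hj
  have h := FiniteField.sum_pow_lt_card_sub_one F j (by have := Finset.mem_range.1 hj; omega)
  have : ∀ u : F, u ^ j * B ^ j * A ^ (r - j) * (r.choose j : F) =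
      u ^ j * (B ^ j * A ^ (r - j) * (r.choose j : F)) := fun u => by ring
  simp_rw [this]
  rw [← Finset.sum_mul, h, zero_mul]

theorem sumPP (r s t : ℕ) (hr : r < Fintype.card F - 1) (hs : s < Fintype.card F - 1)
    (ht : t < Fintype.card F - 1) (i : Fin 3) (g : SL4 F) :
    ∑ u : F, PP r s t (g * yy i u).1 = 0 := by
  have key : ∀ (A B C : F) (n : ℕ) (hn : n < Fintype.card F - 1),
      ∑ u : F, C * (A + u * B) ^ n = 0 := by
    intro A B C n hn
    rw [← Finset.mul_sum, sum_affine_pow _ _ _ hn, mul_zero]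
  fin_cases i
  · rw [← key (g.1 0 0) (g.1 0 1) (D2 g.1 ^ s * D3 g.1 ^ t) r hr]
    refine Finset.sum_congr rfl fun u _ => ?_
    have y0 := mul_yy0 g u 0
    have y1 := mul_yy0 g u 1
    have y2 := mul_yy0 g u 2
    have e2 : D2 (g * yy 0 u).1 = D2 g.1 := by simp only [D2, y0, y1]; ring
    have e3 : D3 (g * yy 0 u).1 = D3 g.1 := by simp only [D3, y0, y1, y2]; ring
    have e1 : D1 (g * yy 0 u).1 = g.1 0 0 + u * g.1 0 1 := y0.1
    change PP r s t (g * yy 0 u).1 = _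
    rw [PP, e1, e2, e3]; ring
  · rw [← key (D2 g.1) (g.1 0 0 * g.1 1 2 - g.1 0 2 * g.1 1 0) (D1 g.1 ^ r * D3 g.1 ^ t) s hs]
    refine Finset.sum_congr rfl fun u _ => ?_
    have y0 := mul_yy1 g u 0
    have y1 := mul_yy1 g u 1
    have y2 := mul_yy1 g u 2
    have e2 : D2 (g * yy 1 u).1 = D2 g.1 + u * (g.1 0 0 * g.1 1 2 - g.1 0 2 * g.1 1 0) := by
      simp only [D2, y0, y1]; ring
    have e3 : D3 (g * yy 1 u).1 = D3 g.1 := by simp only [D3, y0, y1, y2]; ring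
    have e1 : D1 (g * yy 1 u).1 = D1 g.1 := y0.2.1
    change PP r s t (g * yy 1 u).1 = _
    rw [PP, e1, e2, e3]; ring
  · rw [← key (D3 g.1) (g.1 0 0 * (g.1 1 1 * g.1 2 3 - g.1 1 3 * g.1 2 1)
            - g.1 0 1 * (g.1 1 0 * g.1 2 3 - g.1 1 3 * g.1 2 0)
            + g.1 0 3 * (g.1 1 0 * g.1 2 1 - g.1 1 1 * g.1 2 0)) (D1 g.1 ^ r * D2 g.1 ^ s) t ht]
    refine Finset.sum_congr rfl fun u _ => ?_
    have y0 := mul_yy2 g u 0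
    have y1 := mul_yy2 g u 1
    have y2 := mul_yy2 g u 2
    have e2 : D2 (g * yy 2 u).1 = D2 g.1 := by simp only [D2, y0, y1]
    have e1 : D1 (g * yy 2 u).1 = D1 g.1 := y0.2.1
    have e3 : D3 (g * yy 2 u).1 = D3 g.1 + u * (g.1 0 0 * (g.1 1 1 * g.1 2 3 - g.1 1 3 * g.1 2 1)
            - g.1 0 1 * (g.1 1 0 * g.1 2 3 - g.1 1 3 * g.1 2 0)
            + g.1 0 3 * (g.1 1 0 * g.1 2 1 - g.1 1 1 * g.1 2 0)) := by
      simp only [D3, y0, y1, y2]; ring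
    change PP r s t (g * yy 2 u).1 = _
    rw [PP, e1, e2, e3]

/-- upper unitriangular subgroup -/
def Usub (F : Type) [Field F] [Fintype F] : Subgroup (SL4 F) where
  carrier := {g | UT g.1}
  mul_mem' := fun {a b} ha hb => UT.mul ha hb
  one_mem' := UT.one
  inv_mem' := by
    classical
    intro g hg
    have h1 : g⁻¹ = g ^ (orderOf g - 1) := by
      apply inv_eq_of_mul_eq_one_right
      rw [← pow_succ', Nat.sub_add_cancel (orderOf_pos g), pow_orderOf_eq_one]
    have h2 : ∀ n : ℕ, UT (g ^ n).1 := by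
      intro n
      induction n with
      | zero => rw [pow_zero]; exact UT.one
      | succ n ih => rw [pow_succ]; exact UT.mul ih hg
    rw [h1]
    exact h2 _

theorem Usub_pow (p : ℕ) [Fact p.Prime] [CharP F p] (u : Usub F) : u ^ (p ^ 2) = 1 := by
  apply Subtype.ext
  apply Subtype.ext
  have hu : UT u.1.1 := u.2
  have h1 : (u.1.1 - 1) ^ (p ^ 2) = 0 := by
    have h2 : 4 ≤ p ^ 2 := by nlinarith [(Fact.out : p.Prime).two_le]
    exact pow_eq_zero_of_le h2 hu.nil
  have h3 := sub_pow_char_pow_of_commute (p := p) (n := 2) (Commute.one_right u.1.1)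
  rw [h1, one_pow] at h3
  have h4 : u.1.1 ^ (p ^ 2) = 1 := (sub_eq_zero.1 h3.symm)
  simpa using h4

/-- torus -/
def dg (F : Type) [Field F] : Fˣ × Fˣ × Fˣ →* SL4 F where
  toFun x := ⟨diagonal ![(x.1 : F), (x.2.1 : F), (x.2.2 : F), ((x.1 * x.2.1 * x.2.2)⁻¹ : Fˣ)], by
    rw [det_diagonal, Fin.prod_univ_four]
    simp only [cons_val]
    rw [← Units.val_mul, ← Units.val_mul, ← Units.val_mul, mul_inv_cancel, Units.val_one]⟩
  map_one' := by
    apply Subtype.ext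
    ext i j
    fin_cases i <;> fin_cases j <;> simp
  map_mul' := by
    intro x y
    apply Subtype.ext
    change _ = diagonal _ * diagonal _
    rw [diagonal_mul_diagonal]
    refine congrArg diagonal (funext fun i => ?_)
    fin_cases i <;> simp <;> ring

theorem dg_UT (x : Fˣ × Fˣ × Fˣ) (u : SL4 F) (hu : UT u.1) : UT ((dg F x)⁻¹ * u * dg F x).1 := by
  rw [← map_inv]
  have : (dg F x⁻¹ * u * dg F x).1 = diagonal ![((x⁻¹).1 : F), ((x⁻¹).2.1 : F), ((x⁻¹).2.2 : F), (((x⁻¹).1 * (x⁻¹).2.1 * (x⁻¹).2.2)⁻¹ : Fˣ)] * u.1 * diagonal ![(x.1 : F), (x.2.1 : F), (x.2.2 : F), ((x.1 * x.2.1 * x.2.2)⁻¹ : Fˣ)] := rfl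
  rw [this]
  obtain ⟨⟨i1, i2, i3, i4⟩, i5, i6, i7, i8, i9, i10⟩ := hu
  simp only [UT, mul_diagonal, diagonal_mul, i1, i2, i3, i4, i5, i6, i7, i8, i9, i10]
  have h1 := x.1.ne_zero
  have h2 := x.2.1.ne_zero
  have h3 := x.2.2.ne_zero
  refine ⟨⟨?_, ?_, ?_, ?_⟩, ?_, ?_, ?_, ?_, ?_, ?_⟩ <;> simp
  field_simp

theorem dg_PP (r s t : ℕ) (g : SL4 F) (x : Fˣ × Fˣ × Fˣ) : PP r s t (g * dg F x).1 =
    (x.1 : F) ^ (r + s + t) * (x.2.1 : F) ^ (s + t) * (x.2.2 : F) ^ t * PP r s t g.1 := by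
  have h := D_mul_diag g.1 ![(x.1 : F), (x.2.1 : F), (x.2.2 : F), ((x.1 * x.2.1 * x.2.2)⁻¹ : Fˣ)]
  have : (g * dg F x).1 = g.1 * diagonal ![(x.1 : F), (x.2.1 : F), (x.2.2 : F), ((x.1 * x.2.1 * x.2.2)⁻¹ : Fˣ)] := rfl
  rw [PP, PP, this, h.1, h.2.1, h.2.2]
  simp only [cons_val]
  ring

theorem diag_eq_dg (g : SL4 F) (h : ∀ i j : Fin 4, i ≠ j → g.1 i j = 0) : ∃ x, g = dg F x := by
  have hd : g.1 = diagonal (fun i => g.1 i i) := by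
    ext i j
    by_cases hij : i = j
    · subst hij; simp
    · rw [h i j hij, diagonal_apply_ne _ hij]
  have h2 := g.2
  rw [hd, det_diagonal, Fin.prod_univ_four] at h2
  have n0 : g.1 0 0 ≠ 0 := by intro h; simp [h] at h2
  have n1 : g.1 1 1 ≠ 0 := by intro h; simp [h] at h2
  have n2 : g.1 2 2 ≠ 0 := by intro h; simp [h] at h2
  refine ⟨⟨Units.mk0 _ n0, Units.mk0 _ n1, Units.mk0 _ n2⟩, ?_⟩
  apply Subtype.ext
  refine hd.trans ?_
  refine congrArg diagonal (funext fun i => ?_)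
  fin_cases i <;> simp
  field_simp
  linear_combination h2

variable {k : Type} [Field k]

theorem PP_mem (ι : F →+* k) (p : ℕ) [Fact p.Prime] [CharP F p] [CharP k p]
    (S : Submodule k (SL4 F → k))
    (hS : ∀ c ∈ S, ∀ a b : SL4 F, (fun g => c (a * g * b)) ∈ S)
    (hY : ∀ c ∈ S, ∀ i g, ∑ u : F, c (g * yy i u) = 0) (c : SL4 F → k) (hc : c ∈ S) (hc0 : c ≠ 0) :
    ∃ r s t : ℕ, r < Fintype.card F - 1 ∧ s < Fintype.card F - 1 ∧ t < Fintype.card F - 1 ∧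
      (fun g => ι (PP r s t g.1)) ∈ S := by
  classical
  set n := Fintype.card F - 1 with hn
  have hnpos : 0 < n := by have := Fintype.one_lt_card (α := F); omega
  -- unipotent invariants
  let act : (Usub F × Usub F) →* AddMonoid.End (SL4 F → k) :=
    { toFun := fun q =>
        { toFun := fun c g => c (trSL q.1.1 * g * q.2.1)
          map_zero' := rfl
          map_add' := fun _ _ => rfl }
      map_one' := by
        ext c g
        change c (trSL 1 * g * 1) = c g
        have : trSL (1 : SL4 F) = 1 := Subtype.ext transpose_one
        rw [this, one_mul, mul_one]
      map_mul' := by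
        intro q q'
        ext c g
        change c (trSL (q.1.1 * q'.1.1) * g * (q.2.1 * q'.2.1)) =
          c (trSL q'.1.1 * (trSL q.1.1 * g * q.2.1) * q'.2.1)
        rw [trSL_mul]; simp only [mul_assoc] }
  obtain ⟨c1, hc1, hc10, hc1U⟩ := pfix p (V := SL4 F → k)
    (fun v => by ext g; simp) (Q := Usub F × Usub F)
    (fun q => ⟨2, Prod.ext (Usub_pow p q.1) (Usub_pow p q.2)⟩) act S.toAddSubgroup
    (fun q v hv => hS v hv _ _) c hc hc0
  let S1 : Submodule k (SL4 F → k) := S ⊓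
    { carrier := {c | ∀ g u, UT u.1 → c (g * u) = c g ∧ c (trSL u * g) = c g}
      add_mem' := fun {a b} ha hb g u hu => by
        simp only [Pi.add_apply, (ha g u hu).1, (ha g u hu).2, (hb g u hu).1, (hb g u hu).2]
        exact ⟨trivial, trivial⟩
      zero_mem' := fun g u hu => ⟨rfl, rfl⟩
      smul_mem' := fun x a ha g u hu => by
        simp only [Pi.smul_apply, (ha g u hu).1, (ha g u hu).2]
        exact ⟨trivial, trivial⟩ }
  have hc1S : c1 ∈ S1 := by
    refine ⟨hc1, fun g u hu => ⟨?_, ?_⟩⟩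
    · have := congrFun (hc1U (1, ⟨u, hu⟩)) g
      change c1 (trSL 1 * g * u) = c1 g at this
      have h1 : trSL (1 : SL4 F) = 1 := Subtype.ext transpose_one
      rwa [h1, one_mul] at this
    · have := congrFun (hc1U (⟨u, hu⟩, 1)) g
      change c1 (trSL u * g * 1) = c1 g at this
      rwa [mul_one] at this
  have st1 : ∀ c ∈ S1, ∀ x, (fun g => c (g * dg F x)) ∈ S1 := by
    intro c hc x
    refine ⟨?_, fun g u hu => ⟨?_, ?_⟩⟩
    · have := hS c hc.1 1 (dg F x)
      simp only [one_mul] at this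
      exact this
    · have := (hc.2 (g * dg F x) _ (dg_UT x u hu)).1
      refine Eq.trans ?_ this
      simp only [mul_assoc, mul_inv_cancel_left]
    · have := (hc.2 (g * dg F x) u hu).2
      simp only [← mul_assoc] at this ⊢
      exact this
  -- weight spaces
  have wt : ∀ (T : Submodule k (SL4 F → k)) (st : ∀ c ∈ T, ∀ x, (fun g => c (g * dg F x)) ∈ T)
      (f : Fˣ →* Fˣ × Fˣ × Fˣ), ∀ c ∈ T, c ≠ 0 → ∃ r, ∃ T' : Submodule k (SL4 F → k), T' ≤ T ∧
      (∀ c ∈ T', ∀ x, (fun g => c (g * dg F x)) ∈ T') ∧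
      (∀ c ∈ T', ∀ g t, c (g * dg F (f t)) = (ι t) ^ r * c g) ∧ ∃ c ∈ T', c ≠ 0 := by
    intro T st f c hc hc0
    obtain ⟨r, hr, c', hc', hc0', hw⟩ := torus_proj ι ((dg F).comp f) T
      (fun c hc t => st c hc (f t)) c hc hc0
    refine ⟨r, T ⊓
      { carrier := {c | ∀ g t, c (g * dg F (f t)) = (ι t) ^ r * c g}
        add_mem' := fun {a b} ha hb g t => by
          simp only [Pi.add_apply, ha g t, hb g t]; ring
        zero_mem' := fun g t => by simp
        smul_mem' := fun x a ha g t => by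
          simp only [Pi.smul_apply, ha g t, smul_eq_mul]; ring }, inf_le_left, ?_, ?_, ?_⟩
    · intro c hc x
      refine ⟨st c hc.1 x, fun g t => ?_⟩
      have := hc.2 (g * dg F x) t
      rw [← this]
      simp only [mul_assoc, ← map_mul]
      rw [mul_comm x]
    · intro c hc; exact hc.2
    · exact ⟨c', ⟨hc', hw⟩, hc0'⟩
  obtain ⟨x1, T1, hT1, stT1, w1, c2, hc2, hc20⟩ := wt S1 st1 (MonoidHom.inl _ _) c1 hc1S hc10
  obtain ⟨x2, T2, hT2, stT2, w2, c3, hc3, hc30⟩ := wt T1 stT1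
    ((MonoidHom.inr _ _).comp (MonoidHom.inl _ _)) c2 hc2 hc20
  obtain ⟨x3, T3, hT3, stT3, w3, c4, hc4, hc40⟩ := wt T2 stT2
    ((MonoidHom.inr _ _).comp (MonoidHom.inr _ _)) c3 hc3 hc30
  have W1 := w1 c4 (hT2 (hT3 hc4))
  have W2 := w2 c4 (hT3 hc4)
  have W3 := w3 c4 hc4
  have hcS1 : c4 ∈ S1 := hT1 (hT2 (hT3 hc4))
  have hcw : ∀ g x, c4 (g * dg F x) = ι x.1 ^ x1 * ι x.2.1 ^ x2 * ι x.2.2 ^ x3 * c4 g := by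
    intro g x
    have : x = (MonoidHom.inl Fˣ (Fˣ × Fˣ) x.1) *
      (((MonoidHom.inr Fˣ (Fˣ × Fˣ)).comp (MonoidHom.inl Fˣ Fˣ)) x.2.1) *
      (((MonoidHom.inr Fˣ (Fˣ × Fˣ)).comp (MonoidHom.inr Fˣ Fˣ)) x.2.2) := by
      ext <;> simp
    conv_lhs => rw [this]
    rw [map_mul, map_mul, ← mul_assoc, ← mul_assoc, W3, W2, W1]
    ring
  have hpow : ∀ (a : Fˣ) (i j : ℕ), i ≡ j [MOD n] → ι a ^ i = ι a ^ j := by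
    intro a i j hij
    rw [← map_pow, ← map_pow]
    congr 1
    have h1 : (a : F) ^ n = 1 := FiniteField.pow_card_sub_one_eq_one _ a.ne_zero
    have h2 : ((a : F)) ^ (i % n) = (a : F) ^ (j % n) := congrArg _ hij
    rw [← Nat.div_add_mod i n, ← Nat.div_add_mod j n, pow_add, pow_add, pow_mul, pow_mul, h1,
      one_pow, one_pow, h2]
  have hmod : ∀ a b : ℕ, (a + n * b - b) % n + b ≡ a [MOD n] := by
    intro a b
    refine ((Nat.mod_modEq _ _).add_right b).trans ?_
    have : b ≤ n * b := Nat.le_mul_of_pos_left _ hnpos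
    rw [show a + n * b - b + b = a + n * b by omega]
    simp [Nat.ModEq]
  set t := x3 % n with ht
  set s := (x2 + n * x3 - x3) % n with hs
  set r := (x1 + n * x2 - x2) % n with hr
  have m3 : t ≡ x3 [MOD n] := Nat.mod_modEq _ _
  have m2 : s + t ≡ x2 [MOD n] := (m3.add_left s).trans (hmod _ _)
  have m1 : r + s + t ≡ x1 [MOD n] := by
    rw [add_assoc]
    exact (m2.add_left r).trans (hmod _ _)
  have hrn : r < n := Nat.mod_lt _ hnpos
  have hsn : s < n := Nat.mod_lt _ hnpos
  have htn : t < n := Nat.mod_lt _ hnpos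
  refine ⟨r, s, t, hrn, hsn, htn, ?_⟩
  have PU : ∀ (g u : SL4 F), UT u.1 → PP r s t (g * u).1 = PP r s t g.1 := by
    intro g u hu
    obtain ⟨h1, h2, h3⟩ := D_mul_UT (A := g.1) hu
    change PP r s t (g.1 * u.1) = _
    rw [PP, PP, h1, h2, h3]
  have PL : ∀ (g u : SL4 F), UT u.1 → PP r s t (trSL u * g).1 = PP r s t g.1 := by
    intro g u hu
    obtain ⟨h1, h2, h3⟩ := D_UT_mul (A := g.1) hu
    change PP r s t (u.1ᵀ * g.1) = _
    rw [PP, PP, h1, h2, h3]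
  have P1 : PP r s t (1 : SL4 F).1 = 1 := by
    change PP r s t (1 : Matrix (Fin 4) (Fin 4) F) = 1
    simp [PP, D1, D2, D3]
  have key := vanish (fun g => c4 g - c4 1 * ι (PP r s t g.1))
    (fun g u hu => by simp only [(hcS1.2 g u hu).1, PU g u hu])
    (fun g u hu => by simp only [(hcS1.2 g u hu).2, PL g u hu])
    (fun g hg => by
      obtain ⟨x, rfl⟩ := diag_eq_dg g hg
      have a1 := hcw 1 x
      have a2 := dg_PP r s t 1 x
      rw [one_mul] at a1 a2
      simp only [a1, a2, P1, map_mul, map_pow, mul_one]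
      rw [hpow _ _ _ m1, hpow _ _ _ m2, hpow _ _ _ m3]
      ring)
    (fun i g => by
      rw [Finset.sum_sub_distrib, hY c4 hcS1.1 i g, ← Finset.mul_sum, ← map_sum,
        sumPP r s t hrn hsn htn i g]
      simp)
  have hc41 : c4 1 ≠ 0 := by
    intro h
    apply hc40
    ext g
    have := key g
    simpa [h] using this
  have : (fun g : SL4 F => ι (PP r s t g.1)) = (c4 1)⁻¹ • c4 := by
    ext g
    have h1 : c4 g - c4 1 * ι (PP r s t g.1) = 0 := key g
    rw [Pi.smul_apply, smul_eq_mul, sub_eq_zero.1 h1, inv_mul_cancel_left₀ hc41]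
  rw [this]
  exact S.smul_mem _ hcS1.1
end E4
end PartE4

section PartE4b
open Matrix
set_option linter.unusedSectionVars false

section E4b
variable {F : Type} [Field F] [Fintype F]
variable {k : Type} [Field k]

/-- the conclusion of the key step -/
structure Good {K W : Type} [Field K] [AddCommGroup W] [Module K W]
    (ι : F →+* k) (ρ : SL4 F →* (W ≃ₗ[K] W)) (r s t : ℕ) : Prop where
  rel : ∀ (J : Type) [Fintype J] (γ : J → SL4 F), (∀ w, ∑ j, ρ (γ j) w = 0) →
    ∀ g g', ∑ j, ι (PP r s t (g * γ j * g').1) = 0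
  triv : ∀ z, ρ z = 1 → ι (PP r s t z.1) = 1

theorem key_PP {K W : Type} [Field K] [AddCommGroup W] [Module K W] [Nontrivial W] (κ : K →+* k)
    (ι : F →+* k) (p : ℕ) [Fact p.Prime] [CharP F p] [CharP k p] (ρ : SL4 F →* (W ≃ₗ[K] W))
    (hY : ∀ i w, ∑ u : F, ρ (yy i u) w = 0) :
    ∃ r s t : ℕ, r < Fintype.card F - 1 ∧ s < Fintype.card F - 1 ∧ t < Fintype.card F - 1 ∧
      Good ι ρ r s t := by
  let S : Submodule k (SL4 F → k) :=
    { carrier := {c | (∀ (J : Type) [Fintype J] (γ : J → SL4 F), (∀ w, ∑ j, ρ (γ j) w = 0) →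
        ∀ g g', ∑ j, c (g * γ j * g') = 0) ∧ ∀ z, ρ z = 1 → ∀ g g', c (g * z * g') = c (g * g')}
      add_mem' := by
        rintro a b ⟨ha, ha'⟩ ⟨hb, hb'⟩
        refine ⟨fun J _ γ h g g' => ?_, fun z hz g g' => ?_⟩
        · simp only [Pi.add_apply, Finset.sum_add_distrib, ha J γ h, hb J γ h, add_zero]
        · simp only [Pi.add_apply, ha' z hz, hb' z hz]
      zero_mem' := ⟨fun J _ γ h g g' => by simp, fun z hz g g' => rfl⟩
      smul_mem' := by
        rintro x a ⟨ha, ha'⟩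
        refine ⟨fun J _ γ h g g' => ?_, fun z hz g g' => ?_⟩
        · simp only [Pi.smul_apply, ← Finset.smul_sum, ha J γ h, smul_zero]
        · simp only [Pi.smul_apply, ha' z hz] }
  have hS : ∀ c ∈ S, ∀ a b : SL4 F, (fun g => c (a * g * b)) ∈ S := by
    rintro c ⟨hc, hc'⟩ a b
    refine ⟨fun J _ γ h g g' => ?_, fun z hz g g' => ?_⟩
    · have := hc J γ h (a * g) (g' * b)
      simpa only [mul_assoc] using this
    · have := hc' z hz (a * g) (g' * b)
      simpa only [mul_assoc] using this
  obtain ⟨w, hw⟩ := exists_ne (0 : W)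
  obtain ⟨φ, hφ⟩ : ∃ φ : Module.Dual K W, φ w ≠ 0 := by
    by_contra h
    push Not at h
    exact hw ((Module.forall_dual_apply_eq_zero_iff K w).1 h)
  have hc : (fun g => κ (φ (ρ g w))) ∈ S := by
    refine ⟨fun J _ γ h g g' => ?_, fun z hz g g' => ?_⟩
    · rw [← map_sum, ← map_sum]
      have : ∑ j, ρ (g * γ j * g') w = ρ g (∑ j, ρ (γ j) (ρ g' w)) := by
        rw [map_sum]
        refine Finset.sum_congr rfl fun j _ => ?_
        rw [map_mul, map_mul]; rfl
      rw [this, h]; simp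
    · simp only [map_mul, hz, mul_one]
  have hc0 : (fun g => κ (φ (ρ g w))) ≠ 0 := by
    intro h
    have := congrFun h 1
    simp only [map_one, Pi.zero_apply] at this
    exact hφ ((map_eq_zero κ).1 this)
  obtain ⟨r, s, t, hr, hs, ht, h⟩ := PP_mem ι p S hS (fun c hc i g => by
    have := hc.1 F (fun u => yy i u) (hY i) g 1
    simpa only [mul_one] using this) _ hc hc0
  refine ⟨r, s, t, hr, hs, ht, ⟨h.1, fun z hz => ?_⟩⟩
  have := h.2 z hz 1 1
  simp only [mul_one, one_mul] at this
  rw [this]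
  change ι (PP r s t (1 : Matrix (Fin 4) (Fin 4) F)) = 1
  simp [PP, D1, D2, D3]
end E4b
end PartE4b

section PartD
open Matrix
set_option linter.unusedSectionVars false

section D
variable {K W : Type} [Field K] [AddCommGroup W] [Module K W] {L : Type} [Group L]

theorem N18 [CharP K 3] (ρ : L →* (W ≃ₗ[K] W)) (x s : L) (hx : orderOf x = 3) (hs : orderOf s = 2)
    (hc : Commute x s) (w : W)
    (hw : ∑ j ∈ Finset.range 3, ρ (x ^ j) w + ρ s (∑ j ∈ Finset.range 3, ρ (x ^ j) w) ≠ 0)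
    (he : elementOrders (SemidirectProduct (Multiplicative W) L (linToMulAut.comp ρ)) =
      elementOrders L) : ∃ h : L, orderOf h = 18 := by
  have : Fact (Nat.Prime 3) := ⟨by norm_num⟩
  have ho : orderOf (x * s) = 6 := by
    rw [hc.orderOf_mul_eq_mul_orderOf_of_coprime (by rw [hx, hs]; norm_num), hx, hs]
  have hx3 : x ^ 3 = 1 := hx ▸ pow_orderOf_eq_one x
  have hs2 : s ^ 2 = 1 := hs ▸ pow_orderOf_eq_one s
  obtain ⟨h, hh⟩ := sd_order 3 ρ (x * s) 6 ho w (by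
    have e2 : (x * s) ^ 2 = x ^ 2 := by rw [hc.mul_pow, hs2, mul_one]
    have e3 : (x * s) ^ 3 = s := by rw [hc.mul_pow, hx3, one_mul, pow_succ, hs2, one_mul]
    have e4 : (x * s) ^ 4 = x := by
      rw [hc.mul_pow, pow_succ x 3, hx3, one_mul, show 4 = 2 * 2 by rfl, pow_mul, hs2, one_pow, mul_one]
    have e5 : (x * s) ^ 5 = s * x ^ 2 := by
      rw [show 5 = 3 + 2 by rfl, pow_add, e3, e2]
    rw [Finset.sum_range_succ, Finset.sum_range_succ, Finset.sum_range_succ, Finset.sum_range_succ,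
      Finset.sum_range_succ, Finset.sum_range_one, e2, e3, e4, e5]
    rw [Finset.sum_range_succ, Finset.sum_range_succ, Finset.sum_range_one] at hw
    convert hw using 1
    rw [map_add, map_add, pow_one, pow_one, hc.eq, map_mul, map_mul, pow_zero]
    simp only [LinearEquiv.mul_apply, pow_zero, map_one, LinearEquiv.coe_one, id]
    abel) he
  exact ⟨h, hh⟩
end D

section D2
variable {F : Type} [Field F] [Fintype F] {K W : Type} [Field K] [AddCommGroup W] [Module K W]
  (p : ℕ) [Fact p.Prime] [CharP F p] [CharP K p]

abbrev tv {a b : Fin 4} (hab : a ≠ b) (u : F) : SL4 F := Matrix.SpecialLinearGroup.transvection hab u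

theorem tv_pow {a b : Fin 4} (hab : a ≠ b) (u : F) (n : ℕ) : (tv hab u) ^ n = tv hab (n * u) := by
  induction n with
  | zero => rw [pow_zero, Nat.cast_zero, zero_mul, tv, Matrix.SpecialLinearGroup.transvection_coeff_zero]
  | succ n ih =>
    rw [pow_succ, ih, tv, tv, tv, ← Matrix.SpecialLinearGroup.transvection_add]
    congr 1; push_cast; ring

theorem tv_order {a b : Fin 4} (hab : a ≠ b) (u : F) (hu : u ≠ 0) :
    orderOf ((tv hab u : SL4 F) : PSL4 F) = p := by
  apply orderOf_eq_prime
  · rw [← QuotientGroup.mk_pow, tv_pow, CharP.cast_eq_zero, zero_mul, tv,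
      Matrix.SpecialLinearGroup.transvection_coeff_zero]; rfl
  · rw [Ne, mk_eq_one_iff]
    rintro ⟨r, hr⟩
    have := congrFun (congrFun hr a) b
    rw [Matrix.SpecialLinearGroup.transvection_coe] at this
    simp [hab] at this
    exact hu this

theorem diag_comm_tv {a b : Fin 4} (hab : a ≠ b) (u : F) (g : SL4 F) (d : Fin 4 → F)
    (hg : g.1 = diagonal d) (hd : d a = d b) : Commute ((tv hab u : SL4 F) : PSL4 F) (g : PSL4 F) := by
  have : Commute (tv hab u : SL4 F) g := by
    apply Subtype.ext
    change (tv hab u).1 * g.1 = g.1 * (tv hab u).1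
    rw [hg, Matrix.SpecialLinearGroup.transvection_coe]
    rw [add_mul, mul_add, one_mul, mul_one]
    congr 1
    ext i j
    rw [mul_diagonal, diagonal_mul, single_apply]
    split_ifs with h
    · rw [← h.1, ← h.2, hd]; ring
    · simp
  exact this.map (QuotientGroup.mk' _)

theorem diag_order2 (g : SL4 F) (d : Fin 4 → F) (hg : g.1 = diagonal d) (c : F) (hc : ∀ i, d i ^ 2 = c)
    (i j : Fin 4) (hij : d i ≠ d j) : orderOf (g : PSL4 F) = 2 := by
  apply orderOf_eq_prime
  · rw [← QuotientGroup.mk_pow, mk_eq_one_iff]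
    refine ⟨c, ?_⟩
    rw [Matrix.SpecialLinearGroup.coe_pow]
    rw [hg, diagonal_pow, scalar_apply]
    congr 1
    ext i; exact hc i
  · rw [Ne, mk_eq_one_iff]
    rintro ⟨r, hr⟩
    change g.1 = _ at hr
    rw [hg, scalar_apply, diagonal_eq_diagonal_iff] at hr
    exact hij ((hr i).trans (hr j).symm)

theorem four_idx : ∀ a b : Fin 4, a ≠ b → ∃ c d : Fin 4, c ≠ a ∧ c ≠ b ∧ d ≠ a ∧ d ≠ b ∧ c ≠ d := by
  decide

theorem four_univ : ∀ a b c d : Fin 4, a ≠ b → c ≠ a → c ≠ b → d ≠ a → d ≠ b → c ≠ d →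
    (Finset.univ : Finset (Fin 4)) = {a, b, c, d} := by
  decide

theorem factN {k : Type} [Field k] [IsAlgClosed k] (ι : F →+* k) [CharP k p] (ρ : PSL4 F →* (W ≃ₗ[K] W))
    (he : elementOrders (SemidirectProduct (Multiplicative W) (PSL4 F) (linToMulAut.comp ρ)) =
      elementOrders (PSL4 F)) (hcase : 5 ≤ p ∨ (p = 3 ∧ ∃ ζ : F, ζ ^ 4 = -1))
    {a b : Fin 4} (hab : a ≠ b) (u : F) (hu : u ≠ 0) (w : W) :
    ∑ j ∈ Finset.range p, ρ (((tv hab u : SL4 F) : PSL4 F) ^ j) w = 0 := by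
  by_contra hne
  have ho := tv_order p hab u hu
  rcases hcase with hp5 | ⟨rfl, ζ, hζ⟩
  · obtain ⟨h, hh⟩ := sd_order p ρ _ p ho w hne he
    exact order_p_sq p ι hp5 h hh
  · obtain ⟨c, d, hca, hcb, hda, hdb, hcd⟩ : ∃ c d : Fin 4, c ≠ a ∧ c ≠ b ∧ d ≠ a ∧ d ≠ b ∧ c ≠ d :=
      four_idx a b hab
    have h2F : (-1 : F) ≠ 1 := by
      intro h
      have h3 : (3 : F) = 0 := by exact_mod_cast CharP.cast_eq_zero F 3
      exact one_ne_zero (α := F) (by linear_combination h3 + h)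
    have h2K : (2 : K) ≠ 0 := by
      intro h
      have h3 : (3 : K) = 0 := by exact_mod_cast CharP.cast_eq_zero K 3
      exact one_ne_zero (α := K) (by linear_combination h3 - h)
    have hζ0 : ζ ≠ 0 := by
      rintro rfl
      simp at hζ
    have hprod : ∀ f : Fin 4 → F, ∏ i, f i = f a * f b * f c * f d := by
      intro f
      rw [four_univ a b c d hab hca hcb hda hdb hcd, Finset.prod_insert, Finset.prod_insert,
        Finset.prod_pair hcd]
      · ring
      · simp [hcb.symm, hdb.symm]
      · simp [hab, hca.symm, hda.symm]
    let d1 : Fin 4 → F := fun i => if i = c ∨ i = d then -1 else 1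
    let d2 : Fin 4 → F := fun i => if i = d then -ζ else ζ
    let d3 : Fin 4 → F := fun i => if i = c then -ζ else ζ
    let s1 : SL4 F := ⟨diagonal d1, by
      rw [det_diagonal, hprod]; simp [d1, hca.symm, hcb.symm, hda.symm, hdb.symm]⟩
    let s2 : SL4 F := ⟨diagonal d2, by
      rw [det_diagonal, hprod]; simp [d2, hda.symm, hdb.symm, hcd]; linear_combination -hζ⟩
    let s3 : SL4 F := ⟨diagonal d3, by
      rw [det_diagonal, hprod]; simp [d3, hca.symm, hcb.symm, hcd.symm]; linear_combination -hζ⟩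
    have hmul : ((s1 : PSL4 F)) * (s2 : PSL4 F) = (s3 : PSL4 F) := by
      rw [← QuotientGroup.mk_mul]
      congr 1
      apply Subtype.ext
      change diagonal d1 * diagonal d2 = diagonal d3
      rw [diagonal_mul_diagonal]
      congr 1
      ext i
      simp only [d1, d2, d3]
      by_cases h1 : i = c
      · subst h1; simp [hcd]
      · by_cases h2 : i = d
        · simp [h1, h2, hcd.symm]
        · simp [h1, h2]
    have ζn : ζ ≠ -ζ := by
      intro h
      apply h2F
      have : ζ * (-1 - 1) = 0 := by linear_combination -h
      rcases mul_eq_zero.1 this with h | h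
      · exact absurd h hζ0
      · linear_combination h
    have o1 : orderOf (s1 : PSL4 F) = 2 := diag_order2 s1 d1 rfl 1 (by
      intro i; simp only [d1]; split_ifs <;> ring) a c (by simp [d1, hca.symm, hda.symm, h2F.symm])
    have o2 : orderOf (s2 : PSL4 F) = 2 := diag_order2 s2 d2 rfl (ζ ^ 2) (by
      intro i; simp only [d2]; split_ifs <;> ring) a d (by simp [d2, hda.symm, ζn])
    have o3 : orderOf (s3 : PSL4 F) = 2 := diag_order2 s3 d3 rfl (ζ ^ 2) (by
      intro i; simp only [d3]; split_ifs <;> ring) a c (by simp [d3, hca.symm, ζn])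
    have c1 := diag_comm_tv hab u s1 d1 rfl (by simp [d1, hca.symm, hcb.symm, hda.symm, hdb.symm])
    have c2 := diag_comm_tv hab u s2 d2 rfl (by simp [d2, hda.symm, hdb.symm])
    have c3 := diag_comm_tv hab u s3 d3 rfl (by simp [d3, hca.symm, hcb.symm])
    set y := ∑ j ∈ Finset.range 3, ρ (((tv hab u : SL4 F) : PSL4 F) ^ j) w with hy
    have n1 : y + ρ s1 y = 0 := by
      by_contra hh
      obtain ⟨h, hh⟩ := N18 ρ _ _ ho o1 c1 w hh he
      exact order_18 ι h hh
    have n2 : y + ρ s2 y = 0 := by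
      by_contra hh
      obtain ⟨h, hh⟩ := N18 ρ _ _ ho o2 c2 w hh he
      exact order_18 ι h hh
    have n3 : y + ρ s3 y = 0 := by
      by_contra hh
      obtain ⟨h, hh⟩ := N18 ρ _ _ ho o3 c3 w hh he
      exact order_18 ι h hh
    rw [← hmul, map_mul, LinearEquiv.mul_apply, eq_neg_of_add_eq_zero_right n2, map_neg,
      eq_neg_of_add_eq_zero_right n1, neg_neg, ← two_smul K y] at n3
    exact hne ((smul_eq_zero.1 n3).resolve_left h2K)

theorem sum_tv (ρ : SL4 F →* (W ≃ₗ[K] W)) {a b : Fin 4} (hab : a ≠ b) 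
    (h : ∀ w, ∑ j ∈ Finset.range p, ρ ((tv hab (1:F) : SL4 F) ^ j) w = 0) (w : W) :
    ∑ u : F, ρ (tv hab u) w = 0 := by
  classical
  let H := AddSubgroup.zmultiples (1 : F)
  rw [← Finset.sum_fiberwise (s := Finset.univ) (g := fun u : F => (u : F ⧸ H))]
  apply Finset.sum_eq_zero
  intro c _
  obtain ⟨v, rfl⟩ := QuotientAddGroup.mk_surjective c
  have hset : Finset.univ.filter (fun u : F => (u : F ⧸ H) = v) =
      (Finset.range p).image (fun j : ℕ => v + j) := by
    ext u
    simp only [Finset.mem_filter, Finset.mem_univ, true_and, Finset.mem_image, Finset.mem_range]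
    rw [eq_comm, QuotientAddGroup.eq, AddSubgroup.mem_zmultiples_iff]
    constructor
    · rintro ⟨n, hn⟩
      have hp : (0 : ℤ) < p := by exact_mod_cast (Fact.out : p.Prime).pos
      refine ⟨(n % p).toNat, ?_, ?_⟩
      · have := Int.emod_lt_of_pos n hp
        have := Int.emod_nonneg n hp.ne'
        omega
      · have h1 : (((n % p).toNat : ℤ) : F) = (n : F) := by
          rw [Int.toNat_of_nonneg (Int.emod_nonneg n hp.ne')]
          have := congrArg (Int.cast : ℤ → F) (Int.emod_add_mul_ediv n p)
          push_cast at this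
          rw [CharP.cast_eq_zero F p, zero_mul, add_zero] at this
          exact this
        rw [Int.cast_natCast] at h1
        rw [h1]
        rw [zsmul_one] at hn
        rw [hn]; ring
    · rintro ⟨j, _, rfl⟩
      exact ⟨j, by simp⟩
  rw [hset, Finset.sum_image]
  · have := congrArg (ρ (tv hab v)) (h w)
    rw [map_sum, map_zero] at this
    rw [← this]
    refine Finset.sum_congr rfl fun j _ => ?_
    rw [tv_pow, ← LinearEquiv.mul_apply, ← map_mul, mul_one]
    congr 2
    exact Matrix.SpecialLinearGroup.transvection_add hab v j
  · intro i hi j hj hij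
    have := add_left_cancel hij
    exact CharP.natCast_injOn_Iio F p (by simpa using hi) (by simpa using hj) this
end D2
end PartD

section PartE5
open Matrix
set_option linter.unusedSectionVars false

section E5
variable (p : ℕ) [hp : Fact p.Prime]

theorem lucas_step (a b : ℕ) : (a.choose b) ≡ (a % p).choose (b % p) * (a / p).choose (b / p) [MOD p] :=
  Choose.choose_modEq_choose_mod_mul_choose_div_nat

theorem small_choose (a b : ℕ) (ha : a < p) (hb : b ≤ a) : ¬ p ∣ a.choose b := by
  intro h
  have h1 : a.choose b ∣ a.factorial := ⟨b.factorial * (a - b).factorial, by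
    rw [← Nat.choose_mul_factorial_mul_factorial hb]; ring⟩
  have := (hp.out.dvd_factorial).1 (h.trans h1)
  omega

theorem lucas_ne (a0 a' b0 b' : ℕ) (ha : a0 < p) (hb : b0 ≤ a0) (h : ¬ p ∣ a'.choose b') :
    ¬ p ∣ (a0 + p * a').choose (b0 + p * b') := by
  have hpos := hp.out.pos
  have h1 := lucas_step p (a0 + p * a') (b0 + p * b')
  have e1 : (a0 + p * a') % p = a0 := by rw [Nat.add_mul_mod_self_left, Nat.mod_eq_of_lt ha]
  have e2 : (b0 + p * b') % p = b0 := by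
    rw [Nat.add_mul_mod_self_left, Nat.mod_eq_of_lt (hb.trans_lt ha)]
  have e3 : (a0 + p * a') / p = a' := by
    rw [Nat.add_mul_div_left _ _ hpos, Nat.div_eq_of_lt ha, zero_add]
  have e4 : (b0 + p * b') / p = b' := by
    rw [Nat.add_mul_div_left _ _ hpos, Nat.div_eq_of_lt (hb.trans_lt ha), zero_add]
  rw [e1, e2, e3, e4] at h1
  rw [h1.dvd_iff dvd_rfl, hp.out.dvd_mul]
  push Not
  exact ⟨small_choose p _ _ ha hb, h⟩

theorem choose_digit (r a i : ℕ) (h : a ≤ r / p ^ i % p) : ¬ p ∣ r.choose (a * p ^ i) := by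
  have hpos := hp.out.pos
  induction i generalizing r with
  | zero =>
    rw [pow_zero, Nat.div_one] at h
    have := lucas_ne p (r % p) (r / p) a 0 (Nat.mod_lt _ hpos) h (by simp [hp.out.ne_one])
    rw [Nat.mod_add_div, mul_zero, add_zero] at this
    simpa using this
  | succ i ih =>
    have := lucas_ne p (r % p) (r / p) 0 (a * p ^ i) (Nat.mod_lt _ hpos) (Nat.zero_le _)
      (ih (r / p) (by rwa [Nat.div_div_eq_div_mul, mul_comm p, ← pow_succ]))
    rw [Nat.mod_add_div, zero_add] at this
    rwa [show a * p ^ (i + 1) = p * (a * p ^ i) by ring]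

variable {F : Type} [Field F] [Fintype F] 

theorem coeff_zero (d : ℕ) (hd : d < Fintype.card F) (f : ℕ → F)
    (h : ∀ β : F, ∑ l ∈ Finset.range (d + 1), f l * β ^ l = 0) : ∀ l ≤ d, f l = 0 := by
  classical
  let P : Polynomial F := ∑ l ∈ Finset.range (d + 1), Polynomial.C (f l) * Polynomial.X ^ l
  have hdeg : P.natDegree ≤ d := by
    apply Polynomial.natDegree_sum_le_of_forall_le
    intro l hl
    refine (Polynomial.natDegree_C_mul_X_pow_le _ _).trans ?_
    have := Finset.mem_range.1 hl; omega
  have h0 : P = 0 := by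
    apply Polynomial.eq_zero_of_natDegree_lt_card_of_eval_eq_zero P (f := id) Function.injective_id
    · intro β
      simp only [P, Polynomial.eval_finsetSum, Polynomial.eval_mul, Polynomial.eval_C,
        Polynomial.eval_pow, Polynomial.eval_X, id]
      exact h β
    · omega
  intro l hl
  have := congrArg (fun Q => Polynomial.coeff Q l) h0
  simp only [P, Polynomial.finsetSum_coeff, Polynomial.coeff_C_mul, Polynomial.coeff_X_pow,
    Polynomial.coeff_zero] at this
  rw [Finset.sum_eq_single l] at this
  · simpa using this
  · intro b _ hb; simp [hb.symm]
  · intro hh; exact absurd (Finset.mem_range.2 (by omega)) hh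

variable [CharP F p]

theorem sum_pm1 (i : ℕ) : ∑ j ∈ Finset.range p, (j : F) ^ ((p - 1) * p ^ i) = -1 := by
  have hpos := hp.out.pos
  have h1 := hp.out.one_lt
  obtain ⟨n, rfl⟩ : ∃ n, p = n + 1 := ⟨p - 1, by omega⟩
  rw [Finset.sum_range_succ']
  rw [Finset.sum_congr rfl (g := fun _ => (1 : F))]
  · have h0 : (n + 1 - 1) * (n + 1) ^ i ≠ 0 := by
      apply mul_ne_zero; omega; positivity
    rw [Nat.cast_zero, zero_pow h0]
    have := CharP.cast_eq_zero F (n + 1)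
    push_cast at this
    simp
    linear_combination this
  · intro j hj
    have hj := Finset.mem_range.1 hj
    rw [pow_mul]
    have : ((j + 1 : ℕ) : F) ^ (n + 1 - 1) = 1 := by
      have h2 : ((j + 1 : ℕ) : ZMod (n + 1)) ≠ 0 := by
        rw [Ne, ZMod.natCast_eq_zero_iff]
        intro h; have := Nat.le_of_dvd (by omega) h; omega
      have h3 := ZMod.pow_card_sub_one_eq_one h2
      have h4 := congrArg (ZMod.castHom dvd_rfl F) h3
      rw [map_pow, map_natCast, map_one] at h4
      exact h4
    rw [this, one_pow]

theorem digit_bound (r s t : ℕ) (hr : r < Fintype.card F) (hs : s < Fintype.card F)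
    (ht : t < Fintype.card F)
    (h : ∀ β1 β2 β3 : F, ∑ j ∈ Finset.range p,
      (1 + j * β1) ^ r * (1 + j * β2) ^ s * (1 + j * β3) ^ t = 0) (i : ℕ) :
    r / p ^ i % p + s / p ^ i % p + t / p ^ i % p ≤ p - 2 := by
  have h1 := hp.out.two_le
  by_contra hcon
  obtain ⟨a, b, c, ha, hb, hc, habc⟩ : ∃ a b c, a ≤ r / p ^ i % p ∧ b ≤ s / p ^ i % p ∧
      c ≤ t / p ^ i % p ∧ a + b + c = p - 1 := by
    generalize r / p ^ i % p = x at *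
    generalize s / p ^ i % p = y at *
    generalize t / p ^ i % p = z at *
    refine ⟨min x (p - 1), min y (p - 1 - min x (p - 1)), p - 1 - min x (p - 1) - min y (p - 1 - min x (p - 1)), ?_, ?_, ?_, ?_⟩ <;> omega
  have ca := choose_digit p r a i ha
  have cb := choose_digit p s b i hb
  have cc := choose_digit p t c i hc
  have exp : ∀ (x : F) (n : ℕ), (1 + x) ^ n = ∑ l ∈ Finset.range (n + 1), (n.choose l : F) * x ^ l := by
    intro x n
    rw [add_comm, add_pow]
    refine Finset.sum_congr rfl fun l _ => ?_
    rw [one_pow]; ring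
  have le : ∀ n x, ¬ p ∣ Nat.choose n x → x ≤ n := by
    intro n x hx
    by_contra hlt
    rw [Nat.choose_eq_zero_of_lt (by omega)] at hx
    exact hx (dvd_zero _)
  -- extract coefficients
  have e1 : ∀ β2 β3 : F, ∀ l ≤ r, (r.choose l : F) * ∑ j ∈ Finset.range p,
      (j : F) ^ l * ((1 + j * β2) ^ s * (1 + j * β3) ^ t) = 0 := by
    intro β2 β3
    apply coeff_zero r hr
    intro β1
    rw [← h β1 β2 β3]
    simp_rw [exp (_ * β1), Finset.mul_sum, Finset.sum_mul]
    rw [Finset.sum_comm]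
    refine Finset.sum_congr rfl fun j _ => Finset.sum_congr rfl fun l _ => ?_
    ring
  have e2 : ∀ β3 : F, ∀ l ≤ s, (s.choose l : F) * ∑ j ∈ Finset.range p,
      (j : F) ^ (a * p ^ i) * (j : F) ^ l * (1 + j * β3) ^ t = 0 := by
    intro β3
    apply coeff_zero s hs
    intro β2
    have := e1 β2 β3 _ (le _ _ ca)
    have := (mul_eq_zero.1 this).resolve_left (by rwa [CharP.cast_eq_zero_iff F p])
    rw [← this]
    simp_rw [exp (_ * β2), Finset.mul_sum, Finset.sum_mul, Finset.mul_sum]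
    rw [Finset.sum_comm]
    refine Finset.sum_congr rfl fun j _ => Finset.sum_congr rfl fun l _ => ?_
    ring
  have e3 : ∀ l ≤ t, (t.choose l : F) * ∑ j ∈ Finset.range p,
      (j : F) ^ (a * p ^ i) * (j : F) ^ (b * p ^ i) * (j : F) ^ l = 0 := by
    apply coeff_zero t ht
    intro β3
    have := e2 β3 _ (le _ _ cb)
    have := (mul_eq_zero.1 this).resolve_left (by rwa [CharP.cast_eq_zero_iff F p])
    rw [← this]
    simp_rw [exp (_ * β3), Finset.mul_sum, Finset.sum_mul]
    rw [Finset.sum_comm]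
    refine Finset.sum_congr rfl fun j _ => Finset.sum_congr rfl fun l _ => ?_
    ring
  have e4 := (mul_eq_zero.1 (e3 _ (le _ _ cc))).resolve_left (by rwa [CharP.cast_eq_zero_iff F p])
  simp_rw [← pow_add, ← add_mul, habc] at e4
  rw [sum_pm1] at e4
  simp at e4

theorem sum_lt (r s t M : ℕ) (h : ∀ i, r / p ^ i % p + s / p ^ i % p + t / p ^ i % p ≤ p - 2)
    (hr : r < p ^ M) (hs : s < p ^ M) (ht : t < p ^ M) : r + s + t + 1 ≤ p ^ M ∧
      (0 < M → r + s + t + 2 ≤ p ^ M) := by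
  have h1 := hp.out.two_le
  induction M generalizing r s t with
  | zero => simp at *; omega
  | succ M ih =>
    have hd : ∀ x, x < p ^ (M + 1) → x / p < p ^ M := by
      intro x hx
      rw [Nat.div_lt_iff_lt_mul (by omega), ← pow_succ]; exact hx
    have := (ih (r / p) (s / p) (t / p) (fun i => by
      have := h (i + 1)
      rw [pow_succ'] at this
      simpa only [Nat.div_div_eq_div_mul] using this) (hd _ hr) (hd _ hs) (hd _ ht)).1
    have h0 := h 0
    simp only [pow_zero, Nat.div_one] at h0
    have e1 := Nat.mod_add_div r p
    have e2 := Nat.mod_add_div s p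
    have e3 := Nat.mod_add_div t p
    have : p * (r / p + s / p + t / p + 1) ≤ p * p ^ M := Nat.mul_le_mul_left _ this
    rw [pow_succ']
    have : p * (r / p + s / p + t / p + 1) = p * (r / p) + p * (s / p) + p * (t / p) + p := by ring
    omega

variable {k : Type} [Field k] {K W : Type} [Field K] [AddCommGroup W] [Module K W]

theorem good_digit (ι : F →+* k) (ρ : SL4 F →* (W ≃ₗ[K] W)) (r s t : ℕ) (hG : Good ι ρ r s t)
    (hr : r < Fintype.card F) (hs : s < Fintype.card F) (ht : t < Fintype.card F)
    (hN : ∀ w, ∑ j ∈ Finset.range p, ρ ((tv (show (3 : Fin 4) ≠ 0 by decide) (1 : F) : SL4 F) ^ j) w = 0)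
    (i : ℕ) : r / p ^ i % p + s / p ^ i % p + t / p ^ i % p ≤ p - 2 := by
  refine digit_bound p r s t hr hs ht (fun β1 β2 β3 => ?_) i
  let g : SL4 F := ⟨!![1, 1, 0, β1; -1, 0, 1, -β2; 1, 0, 0, β3; 0, 0, 0, 1], by rw [det4]; simp⟩
  have := hG.rel (Fin p) (fun j => (tv (show (3 : Fin 4) ≠ 0 by decide) (1 : F)) ^ (j : ℕ)) (by
    intro w; rw [← hN w, Finset.sum_range]) g 1
  rw [← map_sum, map_eq_zero] at this
  rw [← this, Finset.sum_range]
  refine Finset.sum_congr rfl fun j _ => ?_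
  rw [tv_pow, mul_one, mul_one]
  have hm : (g * tv (show (3 : Fin 4) ≠ 0 by decide) ((j : ℕ) : F)).1 =
    !![1, 1, 0, β1; -1, 0, 1, -β2; 1, 0, 0, β3; 0, 0, 0, 1] * (1 + single 3 0 ((j : ℕ) : F)) := rfl
  rw [hm, PP, D1, D2, D3]
  simp [mul_apply, Fin.sum_univ_four, single_apply]
  ring
end E5
end PartE5

section PartE8
set_option linter.unusedSectionVars false

section E8

def Ach0 (r s t : ℕ) (X3 X4 : ℤ) : Prop := ∃ m m' l l' i j : ℕ, r = m + m' ∧ t = l + l' ∧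
  j + l = l' + i ∧ i ≤ m + s + l ∧ j ≤ m' + s + l' ∧ X3 = m + s + l - 2 * i ∧
  X4 = m' - l' + s + 2 * l - 2 * i

def Ach (p r s t : ℕ) (X3 X4 : ℤ) : Prop := ∃ m m' l l' i j : ℕ, r = m + m' ∧ t = l + l' ∧
  j + l = l' + i ∧ (¬ p ∣ (m + m').choose m ∧ ¬ p ∣ (l + l').choose l ∧
  ¬ p ∣ (m + s + l).choose i ∧ ¬ p ∣ (m' + s + l').choose j) ∧ X3 = m + s + l - 2 * i ∧
  X4 = m' - l' + s + 2 * l - 2 * i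

variable (p : ℕ) [hp : Fact p.Prime]

theorem Ach_step {r s t r' s' t' : ℕ} {A B A' B' : ℤ} (h0 : Ach0 r s t A B) (hlt : r + s + t < p)
    (h : Ach p r' s' t' A' B') :
    Ach p (r + p * r') (s + p * s') (t + p * t') (A + p * A') (B + p * B') := by
  obtain ⟨m, m', l, l', i, j, rfl, rfl, h3, hi, hj, rfl, rfl⟩ := h0
  obtain ⟨n, n', o, o', u, v, rfl, rfl, k3, ⟨c1, c2, c3, c4⟩, rfl, rfl⟩ := h
  refine ⟨m + p * n, m' + p * n', l + p * o, l' + p * o', i + p * u, j + p * v, by ring, by ring,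
    ?_, ⟨?_, ?_, ?_, ?_⟩, by push_cast; ring, by push_cast; ring⟩
  · have : p * v + p * o = p * o' + p * u := by rw [← mul_add, k3, mul_add]
    omega
  · have := lucas_ne p (m + m') (n + n') m n (by omega) (by omega) c1
    rwa [show m + p * n + (m' + p * n') = m + m' + p * (n + n') by ring]
  · have := lucas_ne p (l + l') (o + o') l o (by omega) (by omega) c2
    rwa [show l + p * o + (l' + p * o') = l + l' + p * (o + o') by ring]
  · have := lucas_ne p (m + s + l) (n + s' + o) i u (by omega) (by omega) c3
    rwa [show m + p * n + (s + p * s') + (l + p * o) = m + s + l + p * (n + s' + o) by ring]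
  · have := lucas_ne p (m' + s + l') (n' + s' + o') j v (by omega) (by omega) c4
    rwa [show m' + p * n' + (s + p * s') + (l' + p * o') = m' + s + l' + p * (n' + s' + o') by ring]

theorem Ach0_cases (r s t : ℕ) : Ach0 r s t 0 0 ∨ (Ach0 r s t 1 1 ∧ Ach0 r s t (-1) (-1)) ∨
    ∃ ε : ℤ, (ε = 1 ∨ ε = -1) ∧ Ach0 r s t 0 ε ∧ Ach0 r s t ε 0 := by
  rcases Nat.even_or_odd' (r + t) with ⟨c, hc | hc⟩
  · rcases le_total t r with hrt | hrt
    · have hm : (r - t) / 2 + (r + t) / 2 = r := by omega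
      rcases Nat.even_or_odd' ((r - t) / 2 + s) with ⟨d, hd | hd⟩
      · left
        exact ⟨(r - t) / 2, (r + t) / 2, 0, t, d, t + d, by omega, by omega, by omega, by omega, by omega, by omega, by omega⟩
      · right; left
        exact ⟨⟨(r - t) / 2, (r + t) / 2, 0, t, d, t + d, by omega, by omega, by omega, by omega, by omega, by omega, by omega⟩, ⟨(r - t) / 2, (r + t) / 2, 0, t, d + 1, t + d + 1, by omega, by omega, by omega, by omega, by omega, by omega, by omega⟩⟩
    · rcases Nat.even_or_odd' ((t - r) / 2 + s) with ⟨d, hd | hd⟩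
      · left
        exact ⟨0, r, (t - r) / 2, (t + r) / 2, d, r + d, by omega, by omega, by omega, by omega, by omega, by omega, by omega⟩
      · right; left
        exact ⟨⟨0, r, (t - r) / 2, (t + r) / 2, d, r + d, by omega, by omega, by omega, by omega, by omega, by omega, by omega⟩, ⟨0, r, (t - r) / 2, (t + r) / 2, d + 1, r + d + 1, by omega, by omega, by omega, by omega, by omega, by omega, by omega⟩⟩
  · right; right
    rcases le_total t r with hrt | hrt
    · obtain ⟨m, hm⟩ : ∃ m, r = t + 2 * m + 1 := ⟨(r - t - 1) / 2, by omega⟩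
      rcases Nat.even_or_odd' (m + s) with ⟨d, hd | hd⟩
      · exact ⟨1, by simp, ⟨m, t + m + 1, 0, t, d, t + d, by omega, by omega, by omega, by omega, by omega, by omega, by omega⟩, ⟨m + 1, t + m, 0, t, d, t + d, by omega, by omega, by omega, by omega, by omega, by omega, by omega⟩⟩
      · exact ⟨-1, by simp, ⟨m + 1, t + m, 0, t, d + 1, t + d + 1, by omega, by omega, by omega, by omega, by omega, by omega, by omega⟩, ⟨m, t + m + 1, 0, t, d + 1, t + d + 1, by omega, by omega, by omega, by omega, by omega, by omega, by omega⟩⟩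
    · obtain ⟨l, hl⟩ : ∃ l, t = r + 2 * l + 1 := ⟨(t - r - 1) / 2, by omega⟩
      rcases Nat.even_or_odd' (l + s) with ⟨d, hd | hd⟩
      · exact ⟨-1, by simp, ⟨0, r, l, r + l + 1, d, r + 1 + d, by omega, by omega, by omega, by omega, by omega, by omega, by omega⟩, ⟨0, r, l + 1, r + l, d + 1, r + d, by omega, by omega, by omega, by omega, by omega, by omega, by omega⟩⟩
      · exact ⟨1, by simp, ⟨0, r, l + 1, r + l, d + 1, r + d, by omega, by omega, by omega, by omega, by omega, by omega, by omega⟩, ⟨0, r, l, r + l + 1, d, r + 1 + d, by omega, by omega, by omega, by omega, by omega, by omega, by omega⟩⟩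

theorem Ach_main (hodd : Odd p) (M r s t : ℕ)
    (h : ∀ i, r / p ^ i % p + s / p ^ i % p + t / p ^ i % p ≤ p - 2)
    (hr : r < p ^ M) (hs : s < p ^ M) (ht : t < p ^ M) :
    Ach p r s t 0 0 ∨
    (∃ B X, Ach p r s t 0 B ∧ Ach p r s t X (B - X) ∧ X % 2 = 1) ∨
    (∃ X Y, Ach p r s t X X ∧ Ach p r s t (X + Y) (X + Y) ∧ Y % 4 = 2) ∨
    (∃ A B X Y, Ach p r s t A B ∧ Ach p r s t (A + X) (B - X) ∧ Ach p r s t (A + Y) (B + Y) ∧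
      Ach p r s t (A + X + Y) (B - X + Y) ∧ X % 2 = 1 ∧ Y % 4 = 2) := by
  have h1 := hp.out.two_le
  obtain ⟨c, hc⟩ := hodd
  have podd : ∀ X : ℤ, X % 2 = 1 → ((p : ℤ) * X) % 2 = 1 := by
    intro X hX
    obtain ⟨d, rfl⟩ : ∃ d, X = 2 * d + 1 := ⟨X / 2, by omega⟩
    have : (p : ℤ) * (2 * d + 1) = 2 * (p * d + c) + 1 := by rw [hc]; push_cast; ring
    omega
  have p4 : ∀ X : ℤ, X % 4 = 2 → ((p : ℤ) * X) % 4 = 2 := by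
    intro X hX
    obtain ⟨d, rfl⟩ : ∃ d, X = 4 * d + 2 := ⟨X / 4, by omega⟩
    have : (p : ℤ) * (4 * d + 2) = 4 * (p * d + c) + 2 := by rw [hc]; push_cast; ring
    omega
  induction M generalizing r s t with
  | zero =>
    left
    rw [pow_zero] at hr hs ht
    obtain rfl : r = 0 := by omega
    obtain rfl : s = 0 := by omega
    obtain rfl : t = 0 := by omega
    refine ⟨0, 0, 0, 0, 0, 0, rfl, rfl, rfl, ?_, by simp, by simp⟩
    have : ¬ p ∣ 1 := by rw [Nat.dvd_one]; omega
    simpa using this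
  | succ M ih =>
    have hd : ∀ x, x < p ^ (M + 1) → x / p < p ^ M := by
      intro x hx
      rw [Nat.div_lt_iff_lt_mul (by omega), ← pow_succ]; exact hx
    have IH := ih (r / p) (s / p) (t / p) (fun i => by
      have := h (i + 1)
      rw [pow_succ'] at this
      simpa only [Nat.div_div_eq_div_mul] using this) (hd _ hr) (hd _ hs) (hd _ ht)
    have h0 := h 0
    simp only [pow_zero, Nat.div_one] at h0
    have hlt : r % p + s % p + t % p < p := by omega
    have st : ∀ {A B A' B' : ℤ}, Ach0 (r % p) (s % p) (t % p) A B → Ach p (r / p) (s / p) (t / p) A' B' →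
        ∀ C D, C = A + p * A' → D = B + p * B' → Ach p r s t C D := by
      intro A B A' B' a b C D e1 e2
      have := Ach_step p a hlt b
      rw [Nat.mod_add_div, Nat.mod_add_div, Nat.mod_add_div] at this
      rwa [e1, e2]
    rcases Ach0_cases (r % p) (s % p) (t % p) with a | ⟨a, b⟩ | ⟨ε, hε, a, b⟩
    · rcases IH with i1 | ⟨B, X, i1, i2, hX⟩ | ⟨X, Y, i1, i2, hY⟩ | ⟨A, B, X, Y, i1, i2, i3, i4, hX, hY⟩
      · exact Or.inl (st a i1 _ _ (by ring) (by ring))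
      · exact Or.inr (Or.inl ⟨p * B, p * X, st a i1 _ _ (by ring) (by ring),
          st a i2 _ _ (by ring) (by ring), podd X hX⟩)
      · exact Or.inr (Or.inr (Or.inl ⟨p * X, p * Y, st a i1 _ _ (by ring) (by ring),
          st a i2 _ _ (by ring) (by ring), p4 Y hY⟩))
      · exact Or.inr (Or.inr (Or.inr ⟨p * A, p * B, p * X, p * Y, st a i1 _ _ (by ring) (by ring),
          st a i2 _ _ (by ring) (by ring), st a i3 _ _ (by ring) (by ring),
          st a i4 _ _ (by ring) (by ring), podd X hX, p4 Y hY⟩))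
    · rcases IH with i1 | ⟨B, X, i1, i2, hX⟩ | ⟨X, Y, i1, i2, hY⟩ | ⟨A, B, X, Y, i1, i2, i3, i4, hX, hY⟩
      · exact Or.inr (Or.inr (Or.inl ⟨-1, 2, st b i1 _ _ (by ring) (by ring),
          st a i1 _ _ (by ring) (by ring), by norm_num⟩))
      · exact Or.inr (Or.inr (Or.inr ⟨-1, -1 + p * B, p * X, 2, st b i1 _ _ (by ring) (by ring),
          st b i2 _ _ (by ring) (by ring), st a i1 _ _ (by ring) (by ring),
          st a i2 _ _ (by ring) (by ring), podd X hX, by norm_num⟩))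
      · exact Or.inr (Or.inr (Or.inl ⟨1 + p * X, p * Y, st a i1 _ _ (by ring) (by ring),
          st a i2 _ _ (by ring) (by ring), p4 Y hY⟩))
      · exact Or.inr (Or.inr (Or.inr ⟨1 + p * A, 1 + p * B, p * X, p * Y, st a i1 _ _ (by ring) (by ring),
          st a i2 _ _ (by ring) (by ring), st a i3 _ _ (by ring) (by ring),
          st a i4 _ _ (by ring) (by ring), podd X hX, p4 Y hY⟩))
    · rcases IH with i1 | ⟨B, X, i1, i2, hX⟩ | ⟨X, Y, i1, i2, hY⟩ | ⟨A, B, X, Y, i1, i2, i3, i4, hX, hY⟩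
      · exact Or.inr (Or.inl ⟨ε, ε, st a i1 _ _ (by ring) (by ring),
          st b i1 _ _ (by ring) (by ring), by omega⟩)
      · exact Or.inr (Or.inl ⟨ε + p * B, p * X, st a i1 _ _ (by ring) (by ring),
          st a i2 _ _ (by ring) (by ring), podd X hX⟩)
      · exact Or.inr (Or.inr (Or.inr ⟨p * X, ε + p * X, ε, p * Y, st a i1 _ _ (by ring) (by ring),
          st b i1 _ _ (by ring) (by ring), st a i2 _ _ (by ring) (by ring),
          st b i2 _ _ (by ring) (by ring), by omega, p4 Y hY⟩))
      · exact Or.inr (Or.inr (Or.inr ⟨p * A, ε + p * B, p * X, p * Y, st a i1 _ _ (by ring) (by ring),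
          st a i2 _ _ (by ring) (by ring), st a i3 _ _ (by ring) (by ring),
          st a i4 _ _ (by ring) (by ring), podd X hX, p4 Y hY⟩))

theorem Ach_three (hodd : Odd p) (M r s t : ℕ)
    (h : ∀ i, r / p ^ i % p + s / p ^ i % p + t / p ^ i % p ≤ p - 2)
    (hr : r < p ^ M) (hs : s < p ^ M) (ht : t < p ^ M) :
    (∃ X, Ach p r s t X X) ∨ ∃ A B, Ach p r s t A B ∧ B % 2 = 0 := by
  rcases Ach_main p hodd M r s t h hr hs ht with i1 | ⟨B, X, i1, i2, hX⟩ | ⟨X, Y, i1, i2, hY⟩ |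
    ⟨A, B, X, Y, i1, i2, i3, i4, hX, hY⟩
  · exact Or.inl ⟨0, i1⟩
  · right
    by_cases hB : B % 2 = 0
    · exact ⟨_, _, i1, hB⟩
    · exact ⟨_, _, i2, by omega⟩
  · exact Or.inl ⟨X, i1⟩
  · right
    by_cases hB : B % 2 = 0
    · exact ⟨_, _, i1, hB⟩
    · exact ⟨_, _, i2, by omega⟩

theorem Ach_sum {r s t : ℕ} {A B : ℤ} (h : Ach p r s t A B) (h4 : 4 ∣ r + 2 * s + 3 * t) :
    (A + B) % 4 = 0 := by
  obtain ⟨m, m', l, l', i, j, rfl, rfl, h3, -, rfl, rfl⟩ := h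
  omega

theorem Ach_one (hodd : Odd p) (M r s t : ℕ)
    (h : ∀ i, r / p ^ i % p + s / p ^ i % p + t / p ^ i % p ≤ p - 2)
    (hr : r < p ^ M) (hs : s < p ^ M) (ht : t < p ^ M) (h4 : 4 ∣ r + 2 * s + 3 * t) :
    (∃ B, Ach p r s t 0 B) ∨ ∃ A B, Ach p r s t A B ∧ (A - B) % 4 = 0 ∧ (A + B) % 8 = 4 := by
  rcases Ach_main p hodd M r s t h hr hs ht with i1 | ⟨B, X, i1, i2, hX⟩ | ⟨X, Y, i1, i2, hY⟩ |
    ⟨A, B, X, Y, i1, i2, i3, i4, hX, hY⟩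
  · exact Or.inl ⟨0, i1⟩
  · exact Or.inl ⟨B, i1⟩
  · right
    have := Ach_sum p i1 h4
    by_cases hB : (X + X) % 8 = 4
    · exact ⟨_, _, i1, by omega, hB⟩
    · exact ⟨_, _, i2, by omega, by omega⟩
  · right
    have := Ach_sum p i1 h4
    by_cases hB : (A + B) % 8 = 4
    · by_cases hC : (A - B) % 4 = 0
      · exact ⟨_, _, i1, hC, hB⟩
      · exact ⟨_, _, i2, by omega, by omega⟩
    · by_cases hC : (A - B) % 4 = 0
      · exact ⟨_, _, i3, by omega, by omega⟩
      · exact ⟨_, _, i4, by omega, by omega⟩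
end E8
end PartE8

section PartE6
set_option linter.unusedSectionVars false

section E6
open Matrix
variable {k : Type} [Field k]

theorem mon_coeff [Infinite k] {σ α : Type} [Fintype σ] [DecidableEq α] (S : Finset α) (e : α → σ → ℕ)
    (he : Set.InjOn e S) (c : α → k)
    (h : ∀ y : σ → k, (∀ i, y i ≠ 0) → ∑ x ∈ S, c x * ∏ i, y i ^ e x i = 0) : ∀ x ∈ S, c x = 0 := by
  classical
  let P : MvPolynomial σ k := ∑ x ∈ S, MvPolynomial.monomial (Finsupp.equivFunOnFinite.symm (e x)) (c x)
  have hev : ∀ y, MvPolynomial.eval y P = ∑ x ∈ S, c x * ∏ i, y i ^ e x i := by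
    intro y
    simp only [P, map_sum, MvPolynomial.eval_monomial]
    refine Finset.sum_congr rfl fun x _ => ?_
    rw [Finsupp.prod_fintype _ _ (by simp)]
    simp
  have hP : P * ∏ i, MvPolynomial.X i = 0 := by
    apply MvPolynomial.funext
    intro y
    rw [map_mul, map_prod, map_zero, hev]
    by_cases hy : ∀ i, y i ≠ 0
    · rw [h y hy, zero_mul]
    · push Not at hy
      obtain ⟨i, hi⟩ := hy
      rw [Finset.prod_eq_zero (Finset.mem_univ i) (by simpa using hi), mul_zero]
  have hP0 : P = 0 := by
    rcases mul_eq_zero.1 hP with h | h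
    · exact h
    · rw [Finset.prod_eq_zero_iff] at h
      obtain ⟨i, _, hi⟩ := h
      exact absurd hi (MvPolynomial.X_ne_zero i)
  intro x hx
  have := congrArg (MvPolynomial.coeff (Finsupp.equivFunOnFinite.symm (e x))) hP0
  simp only [P, MvPolynomial.coeff_sum, MvPolynomial.coeff_monomial, MvPolynomial.coeff_zero] at this
  rw [Finset.sum_eq_single x] at this
  · simpa using this
  · intro b hb hbx
    rw [if_neg]
    intro hh
    exact hbx (he hb hx (Finsupp.equivFunOnFinite.symm.injective hh))
  · exact fun h => absurd hx h

theorem degs {σ : Type} [DecidableEq σ] (v : σ) {P Q : MvPolynomial σ k} {a b : ℕ} (hP : P.degreeOf v ≤ a)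
    (hQ : Q.degreeOf v ≤ b) : (P * Q).degreeOf v ≤ a + b :=
  (MvPolynomial.degreeOf_mul_le v P Q).trans (add_le_add hP hQ)

theorem dega {σ : Type} [DecidableEq σ] (v : σ) {P Q : MvPolynomial σ k} {a : ℕ} (hP : P.degreeOf v ≤ a)
    (hQ : Q.degreeOf v ≤ a) : (P + Q).degreeOf v ≤ a :=
  (MvPolynomial.degreeOf_add_le v P Q).trans (max_le hP hQ)

theorem degb {σ : Type} [DecidableEq σ] (v : σ) {P Q : MvPolynomial σ k} {a : ℕ} (hP : P.degreeOf v ≤ a)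
    (hQ : Q.degreeOf v ≤ a) : (P - Q).degreeOf v ≤ a :=
  (MvPolynomial.degreeOf_sub_le v P Q).trans (max_le hP hQ)

theorem degp {σ : Type} [DecidableEq σ] (v : σ) {P : MvPolynomial σ k} {a : ℕ} (n : ℕ) (hP : P.degreeOf v ≤ a) :
    (P ^ n).degreeOf v ≤ n * a :=
  (MvPolynomial.degreeOf_pow_le v P n).trans (Nat.mul_le_mul_left n hP)

theorem deg_rows {σ : Type} [DecidableEq σ] (v : σ) (A : Matrix (Fin 4) (Fin 4) (MvPolynomial σ k)) (f : Fin 4 → ℕ)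
    (h : ∀ i j, (A i j).degreeOf v ≤ f i) (r s t : ℕ) : (PP r s t A).degreeOf v ≤
      r * f 0 + s * (f 0 + f 1) + t * (f 0 + f 1 + f 2) := by
  refine degs v (degs v (degp v r (h 0 0)) (degp v s ?_)) (degp v t ?_)
  · exact degb v (degs v (h _ _) (h _ _)) (degs v (h _ _) (h _ _))
  · refine dega v (degb v ?_ ?_) ?_ <;>
    · rw [add_assoc]
      exact degs v (h _ _) (degb v (degs v (h _ _) (h _ _)) (degs v (h _ _) (h _ _)))

theorem deg_det {σ : Type} [DecidableEq σ] (v : σ) (A : Matrix (Fin 4) (Fin 4) (MvPolynomial σ k)) (f : Fin 4 → ℕ)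
    (h : ∀ i j, (A i j).degreeOf v ≤ f i) : A.det.degreeOf v ≤ f 0 + (f 1 + (f 2 + f 3)) := by
  rw [det4]
  refine degb v (dega v (degb v ?_ ?_) ?_) ?_ <;>
  · refine degs v (h _ _) (dega v (degb v ?_ ?_) ?_) <;>
    exact degs v (h _ _) (degb v (degs v (h _ _) (h _ _)) (degs v (h _ _) (h _ _)))

variable {F : Type} [Field F] [Fintype F]

theorem PP_congr {R : Type} [CommRing R] (r s t : ℕ) (A B : Matrix (Fin 4) (Fin 4) R)
    (h : ∀ i j, i ≠ 3 → A i j = B i j) : PP r s t A = PP r s t B := by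
  simp only [PP, D1, D2, D3]
  rw [h 0 0 (by decide), h 0 1 (by decide), h 0 2 (by decide), h 1 0 (by decide), h 1 1 (by decide),
    h 1 2 (by decide), h 2 0 (by decide), h 2 1 (by decide), h 2 2 (by decide)]

theorem PP_map {R R' : Type} [CommRing R] [CommRing R'] (f : R →+* R') (r s t : ℕ)
    (A : Matrix (Fin 4) (Fin 4) R) : PP r s t (A.map f) = f (PP r s t A) := by
  simp [PP, D1, D2, D3]

theorem ext_left (ι : F →+* k) (r s t : ℕ) (hd : r + s + t + 2 ≤ Fintype.card F) (J : Type) [Fintype J]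
    (M : J → Matrix (Fin 4) (Fin 4) k) (h0 : ∀ g : SL4 F, ∑ j, PP r s t (g.1.map ι * M j) = 0)
    (A : Matrix (Fin 4) (Fin 4) k) (hA : A.det ≠ 0) : ∑ j, PP r s t (A * M j) = 0 := by
  classical
  let X : Matrix (Fin 4) (Fin 4) (MvPolynomial (Fin 4 × Fin 4) k) := Matrix.of fun i j => MvPolynomial.X (i, j)
  let Q : MvPolynomial (Fin 4 × Fin 4) k := X.det * ∑ j, PP r s t (X * (M j).map MvPolynomial.C)
  have hev : ∀ B : Matrix (Fin 4) (Fin 4) k, MvPolynomial.eval (fun x => B x.1 x.2) Q =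
      B.det * ∑ j, PP r s t (B * M j) := by
    intro B
    have hX : X.map (MvPolynomial.eval (fun x => B x.1 x.2)) = B := by
      ext i j; simp [X]
    rw [map_mul, RingHom.map_det, map_sum]
    congr 1
    · congr 1
    · refine Finset.sum_congr rfl fun j _ => ?_
      rw [← PP_map, Matrix.map_mul, hX]
      congr 2
      ext i j; simp
  have hQ : Q = 0 := by
    refine MvPolynomial.eq_zero_of_eval_zero_at_prod_finset Q (fun _ => Finset.univ.image ι) ?_ ?_
    · intro v
      rw [Finset.card_image_of_injective _ ι.injective, Finset.card_univ]
      let f : Fin 4 → ℕ := Pi.single v.1 1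
      have hf : ∀ i, f i = if i = v.1 then 1 else 0 := fun i => by simp [f, Pi.single_apply]
      have hfs : f 0 + (f 1 + (f 2 + f 3)) ≤ 1 := by
        have : ∀ a : Fin 4, ∀ g : Fin 4 → ℕ, (∀ i, g i = if i = a then 1 else 0) →
            g 0 + (g 1 + (g 2 + g 3)) ≤ 1 := by
          intro a g hg
          rw [hg, hg, hg, hg]
          clear hg
          revert a; decide
        exact this v.1 f hf
      have hXd : ∀ i j, (X i j).degreeOf v ≤ f i := by
        intro i j
        simp only [X, of_apply, hf]
        rw [MvPolynomial.degreeOf_X]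
        split_ifs with h1 h2
        · exact le_rfl
        · exact absurd (by rw [h1]) h2
        · exact Nat.zero_le _
        · exact le_rfl
      have h1 := deg_det v X f hXd
      have h2 : ∀ j, (PP r s t (X * (M j).map MvPolynomial.C)).degreeOf v ≤ r + s + t := by
        intro j
        refine (deg_rows v _ f ?_ r s t).trans ?_
        · intro i l
          rw [mul_apply, Fin.sum_univ_four]
          have : ∀ x, (X i x * (M j).map MvPolynomial.C x l).degreeOf v ≤ f i := by
            intro x
            refine (degs v (hXd i x) (b := 0) ?_).trans (by omega)
            simp
          exact dega v (dega v (dega v (this 0) (this 1)) (this 2)) (this 3)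
        · have ha : r * f 0 ≤ r * 1 := Nat.mul_le_mul_left _ (by omega)
          have hb : s * (f 0 + f 1) ≤ s * 1 := Nat.mul_le_mul_left _ (by omega)
          have hc : t * (f 0 + f 1 + f 2) ≤ t * 1 := Nat.mul_le_mul_left _ (by omega)
          omega
      have h3 : (∑ j, PP r s t (X * (M j).map MvPolynomial.C)).degreeOf v ≤ r + s + t :=
        (MvPolynomial.degreeOf_sum_le v _ _).trans (Finset.sup_le fun j _ => h2 j)
      have := degs v (h1.trans hfs) h3
      change Q.degreeOf v ≤ _ at this
      omega
    · intro x hx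
      have : ∃ B : Matrix (Fin 4) (Fin 4) F, ∀ i j, ι (B i j) = x (i, j) := by
        have : ∀ i j, ∃ b, ι b = x (i, j) := fun i j => by
          have := hx (i, j)
          simpa using this
        choose B hB using this
        exact ⟨B, hB⟩
      obtain ⟨B, hB⟩ := this
      have hxB : x = fun v => (B.map ι) v.1 v.2 := by
        ext v; simp [hB]
      rw [hxB, hev]
      by_cases hd : B.det = 0
      · have : (B.map ι).det = ι B.det := (RingHom.map_det ι B).symm
        rw [this, hd, map_zero, zero_mul]
      · let d : Fin 4 → F := ![1, 1, 1, B.det⁻¹]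
        let g : SL4 F := ⟨diagonal d * B, by
          rw [det_mul, det_diagonal, Fin.prod_univ_four]
          simp [d, hd]⟩
        have := h0 g
        rw [← this]
        rw [this, mul_eq_zero]
        right
        rw [← this]
        refine Finset.sum_congr rfl fun j _ => PP_congr r s t _ _ ?_
        intro a b ha
        have hg : ∀ c, g.1 a c = B a c := by
          intro c
          simp only [g, diagonal_mul, d]
          fin_cases a <;> simp at ha ⊢
        simp only [mul_apply, map_apply, hg]
  have := hev A
  rw [hQ, map_zero] at this
  exact (mul_eq_zero.1 this.symm).resolve_left hA

theorem ext_both (ι : F →+* k) (r s t : ℕ) (hd : r + s + t + 2 ≤ Fintype.card F) (J : Type) [Fintype J]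
    (γ : J → SL4 F) (h0 : ∀ g g' : SL4 F, ∑ j, ι (PP r s t (g * γ j * g').1) = 0)
    (A A' : Matrix (Fin 4) (Fin 4) k) (hA : A.det ≠ 0) (hA' : A'.det ≠ 0) :
    ∑ j, PP r s t (A * (γ j).1.map ι * A') = 0 := by
  have h1 : ∀ g' : SL4 F, ∑ j, PP r s t (A * ((γ j).1.map ι * g'.1.map ι)) = 0 := by
    intro g'
    refine ext_left ι r s t hd J _ ?_ A hA
    intro g
    rw [← h0 g g']
    refine Finset.sum_congr rfl fun j _ => ?_
    rw [← PP_map, mul_assoc, ← Matrix.map_mul, ← Matrix.map_mul]; rfl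
  have h2 := ext_left ι r s t hd J (fun j => (A * (γ j).1.map ι)ᵀ) (fun g => by
    rw [← h1 (trSL g)]
    refine Finset.sum_congr rfl fun j _ => ?_
    rw [← PP_transpose, transpose_mul, transpose_transpose, mul_assoc]; rfl) A'ᵀ (by rwa [det_transpose])
  rw [← h2]
  refine Finset.sum_congr rfl fun j _ => ?_
  rw [← PP_transpose, transpose_mul]
end E6
end PartE6

section PartE7
set_option linter.unusedSectionVars false

section E7
open Matrix
variable {k : Type} [Field k]

def g0 : Matrix (Fin 4) (Fin 4) k := !![1,1,1,1;0,1,0,1;1,1,0,0;0,1,0,0]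
def g1 (η : k) : Matrix (Fin 4) (Fin 4) k := !![1,0,1,0;1,1,η,1;1,0,0,0;1,1,0,0]

theorem PP_g (y : Fin 4 → k) (η : k) :
    D1 (g0 * diagonal y * g1 η) = (y 0 + y 2) + (y 1 + y 3) ∧
    D2 (g0 * diagonal y * g1 η) = (y 0 + y 2) * (y 1 + y 3) ∧
    D3 (g0 * diagonal y * g1 η) = η * (y 1 * y 3 * (y 0 + y 2)) + y 0 * y 2 * (y 1 + y 3) := by
  simp only [D1, D2, D3, mul_apply, Fin.sum_univ_four]
  simp [g0, g1]
  refine ⟨?_, ?_, ?_⟩ <;> ring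

theorem det_g (η : k) : (g0 : Matrix (Fin 4) (Fin 4) k).det ≠ 0 ∧ (g1 η).det ≠ 0 := by
  rw [det4, det4]
  simp [g0, g1]

/-- index set for the monomial expansion -/
def Sidx (r s t : ℕ) : Finset (Σ _ : ℕ × ℕ, ℕ × ℕ) :=
  (Finset.range (r + 1) ×ˢ Finset.range (t + 1)).sigma fun x =>
    Finset.range (x.1 + s + x.2 + 1) ×ˢ Finset.range (r - x.1 + s + (t - x.2) + 1)

def Sexp (r s t : ℕ) (x : Σ _ : ℕ × ℕ, ℕ × ℕ) : Fin 5 → ℕ :=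
  ![t - x.1.2 + x.2.1, x.1.2 + x.2.2, t - x.1.2 + (x.1.1 + s + x.1.2 - x.2.1),
    x.1.2 + (r - x.1.1 + s + (t - x.1.2) - x.2.2), x.1.2]

def Scoef (r s t : ℕ) (x : Σ _ : ℕ × ℕ, ℕ × ℕ) : ℕ :=
  r.choose x.1.1 * t.choose x.1.2 * (x.1.1 + s + x.1.2).choose x.2.1 *
    (r - x.1.1 + s + (t - x.1.2)).choose x.2.2

theorem Sexp_inj (r s t : ℕ) : Set.InjOn (Sexp r s t) (Sidx r s t) := by
  rintro ⟨⟨m, l⟩, i, j⟩ hx ⟨⟨m', l'⟩, i', j'⟩ hx' h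
  simp only [Sidx, Finset.coe_sigma, Set.mem_sigma_iff, Finset.mem_coe, Finset.mem_product,
    Finset.mem_range] at hx hx'
  have h0 := congrFun h 0
  have h1 := congrFun h 1
  have h2 := congrFun h 2
  have h3 := congrFun h 3
  have h4 := congrFun h 4
  simp only [Sexp] at h0 h1 h2 h3 h4
  simp at h0 h1 h2 h3 h4
  have : l = l' := h4
  subst this
  have : i = i' := by omega
  have : j = j' := by omega
  have : m = m' := by omega
  subst_vars
  rfl

theorem PP_expand (r s t : ℕ) (y : Fin 5 → k) :
    PP r s t (g0 * diagonal (fun i : Fin 4 => y i.castSucc) * g1 (y 4)) =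
      ∑ x ∈ Sidx r s t, (Scoef r s t x : k) * ∏ i, y i ^ Sexp r s t x i := by
  obtain ⟨h1, h2, h3⟩ := PP_g (fun i : Fin 4 => y i.castSucc) (y 4)
  rw [PP, h1, h2, h3]
  change ((y 0 + y 2) + (y 1 + y 3)) ^ r * ((y 0 + y 2) * (y 1 + y 3)) ^ s *
    (y 4 * (y 1 * y 3 * (y 0 + y 2)) + y 0 * y 2 * (y 1 + y 3)) ^ t = _
  rw [Sidx, Finset.sum_sigma, Finset.sum_product, add_pow (y 0 + y 2), add_pow (y 4 * _), Finset.sum_mul,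
    Finset.sum_mul]
  refine Finset.sum_congr rfl fun m hm => ?_
  rw [Finset.mul_sum]
  refine Finset.sum_congr rfl fun l hl => ?_
  have e : (y 0 + y 2) ^ m * (y 1 + y 3) ^ (r - m) * ↑(r.choose m) * ((y 0 + y 2) * (y 1 + y 3)) ^ s *
      ((y 4 * (y 1 * y 3 * (y 0 + y 2))) ^ l * (y 0 * y 2 * (y 1 + y 3)) ^ (t - l) * ↑(t.choose l)) =
      (y 0 + y 2) ^ (m + s + l) * (y 1 + y 3) ^ (r - m + s + (t - l)) *
      ((r.choose m : k) * (t.choose l) * y 4 ^ l * (y 1 * y 3) ^ l * (y 0 * y 2) ^ (t - l)) := by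
    simp only [mul_pow, pow_add]; ring
  rw [e, Finset.sum_product, add_pow (y 0), add_pow (y 1), Finset.sum_mul_sum, Finset.sum_mul]
  refine Finset.sum_congr rfl fun i hi => ?_
  rw [Finset.sum_mul]
  refine Finset.sum_congr rfl fun j hj => ?_
  rw [Fin.prod_univ_five]
  simp only [Sexp, Scoef]
  simp only [mul_pow, pow_add, Nat.cast_mul, Fin.isValue, cons_val_zero, cons_val_one, cons_val]
  ring

theorem Ach_idx (p r s t : ℕ) (X3 X4 : ℤ) (h : Ach p r s t X3 X4) [Fact p.Prime] [CharP k p] (z : Fin 4 → k)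
    (hz : ∏ i, z i = 1) (hX : z 2 ^ X3 * z 3 ^ X4 = 1) :
    ∃ x ∈ Sidx r s t, (Scoef r s t x : k) ≠ 0 ∧ ∏ i : Fin 4, z i ^ Sexp r s t x i.castSucc = 1 := by
  obtain ⟨m, m', l, l', i, j, rfl, rfl, hj, ⟨c1, c2, c3, c4⟩, h3, h4⟩ := h
  have hi : i ≤ m + s + l := by
    by_contra hh
    exact c3 (by rw [Nat.choose_eq_zero_of_lt (by omega)]; exact dvd_zero _)
  have hj' : j ≤ m' + s + l' := by
    by_contra hh
    exact c4 (by rw [Nat.choose_eq_zero_of_lt (by omega)]; exact dvd_zero _)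
  have e1 : m + m' - m = m' := by omega
  have e2 : l + l' - l = l' := by omega
  refine ⟨⟨(m, l), (i, j)⟩, ?_, ?_, ?_⟩
  · simp only [Sidx, Finset.mem_sigma, Finset.mem_product, Finset.mem_range, e1, e2]
    omega
  · simp only [Scoef, e1, e2]
    intro hh
    rw [CharP.cast_eq_zero_iff k p] at hh
    have hp : p.Prime := Fact.out
    rcases (hp.dvd_mul).1 hh with hh | hh
    · rcases (hp.dvd_mul).1 hh with hh | hh
      · rcases (hp.dvd_mul).1 hh with hh | hh
        · exact c1 hh
        · exact c2 hh
      · exact c3 hh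
    · exact c4 hh
  · have hzn : ∀ i, z i ≠ 0 := by
      intro i hi
      rw [Finset.prod_eq_zero (Finset.mem_univ i) hi] at hz
      exact zero_ne_one hz
    rw [Fin.prod_univ_four] at hz ⊢
    change z 0 ^ (l + l' - l + i) * z 1 ^ (l + j) * z 2 ^ (l + l' - l + (m + s + l - i)) *
      z 3 ^ (l + (m + m' - m + s + (l + l' - l) - j)) = 1
    rw [e1, e2]
    have a1 : z 1 ^ (l + j) = z 1 ^ (l' + i) := by congr 1; omega
    have a2 : z 2 ^ (l' + (m + s + l - i)) = z 2 ^ (l' + i) * z 2 ^ X3 := by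
      rw [← zpow_natCast, ← zpow_natCast, ← zpow_add₀ (hzn 2)]
      congr 1; omega
    have a3 : z 3 ^ (l + (m' + s + l' - j)) = z 3 ^ (l' + i) * z 3 ^ X4 := by
      rw [← zpow_natCast, ← zpow_natCast, ← zpow_add₀ (hzn 3)]
      congr 1; omega
    rw [a1, a2, a3]
    calc _ = (z 0 * z 1 * z 2 * z 3) ^ (l' + i) * (z 2 ^ X3 * z 3 ^ X4) := by
          simp only [mul_pow]; ring
      _ = 1 := by rw [hz, hX]; simp

variable {F : Type} [Field F] [Fintype F]

theorem fix_mem (ι : F →+* k) (x : k) (hx : x ^ Fintype.card F = x) : ∃ b, ι b = x := by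
  have h := FiniteField.X_pow_card_sub_X_natDegree_eq k (Fintype.one_lt_card : 1 < Fintype.card F)
  have h0 := FiniteField.X_pow_card_sub_X_ne_zero k (Fintype.one_lt_card : 1 < Fintype.card F)
  classical
  by_contra hb
  push Not at hb
  let P : Polynomial k := Polynomial.X ^ Fintype.card F - Polynomial.X
  have hsub : insert x (Finset.univ.image ι) ⊆ P.roots.toFinset := by
    intro y hy
    rw [Multiset.mem_toFinset, Polynomial.mem_roots h0]
    rw [Finset.mem_insert, Finset.mem_image] at hy
    rcases hy with rfl | ⟨b, _, rfl⟩
    · simp [hx]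
    · simp [← map_pow, FiniteField.pow_card]
  have h1 := Finset.card_le_card hsub
  rw [Finset.card_insert_of_notMem (by simpa using hb), Finset.card_image_of_injective _ ι.injective,
    Finset.card_univ] at h1
  have h2 := (Multiset.toFinset_card_le P.roots).trans (Polynomial.card_roots' P)
  rw [h] at h2
  omega

theorem exists_kappa [IsAlgClosed k] (ι : F →+* k) (p m : ℕ) [Fact p.Prime] [CharP k p]
    (hF : Fintype.card F = p ^ m) (z : Fin 4 → k) (hz : ∏ i, z i = 1) (σ : Equiv.Perm (Fin 4))
    (hσ : ∀ i, z i ^ (p ^ m) = z (σ i)) :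
    ∃ κ : SL4 F, vandermonde z * κ.1.map ι = diagonal z * vandermonde z := by
  let f : Polynomial k := ∏ i, (Polynomial.X - Polynomial.C (z i))
  have hmap : f.map (iterateFrobenius k p m) = f := by
    simp only [f, Polynomial.map_prod, Polynomial.map_sub, Polynomial.map_X, Polynomial.map_C,
      iterateFrobenius_def, hσ]
    exact Equiv.prod_comp σ (fun i => Polynomial.X - Polynomial.C (z i))
  have hc : ∀ n, ∃ b, ι b = f.coeff n := by
    intro n
    apply fix_mem
    have := congrArg (fun g => Polynomial.coeff g n) hmap
    simp only [Polynomial.coeff_map, iterateFrobenius_def] at this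
    rw [hF]; exact this
  choose b hb using hc
  have hmon : f.Monic := Polynomial.monic_prod_of_monic _ _ fun i _ => Polynomial.monic_X_sub_C _
  have hdeg : f.natDegree = 4 := by
    simp only [f]
    rw [Polynomial.natDegree_prod_of_monic _ _ fun i _ => Polynomial.monic_X_sub_C _]
    simp
  have h4 : f.coeff 4 = 1 := by
    rw [← hdeg]; exact hmon
  have h0 : f.coeff 0 = 1 := by
    rw [Polynomial.coeff_zero_eq_eval_zero, Polynomial.eval_prod]
    simp only [Polynomial.eval_sub, Polynomial.eval_X, Polynomial.eval_C, zero_sub]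
    rw [← hz, Fin.prod_univ_four, Fin.prod_univ_four]; ring
  have hroot : ∀ i, z i ^ 4 = -1 - f.coeff 1 * z i - f.coeff 2 * z i ^ 2 - f.coeff 3 * z i ^ 3 := by
    intro i
    have : f.eval (z i) = 0 := by
      rw [Polynomial.eval_prod]
      exact Finset.prod_eq_zero (Finset.mem_univ i) (by simp)
    rw [Polynomial.eval_eq_sum_range, hdeg] at this
    simp only [Finset.sum_range_succ, Finset.sum_range_zero, h0, h4] at this
    linear_combination this
  refine ⟨⟨!![0,0,0,-1;1,0,0,-b 1;0,1,0,-b 2;0,0,1,-b 3], by rw [det4]; simp⟩, ?_⟩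
  ext i j
  rw [diagonal_mul, mul_apply, Fin.sum_univ_four]
  simp only [vandermonde_apply, map_apply]
  fin_cases j
  · simp
  · simp [pow_two]
  · simp; ring
  · have := hroot i
    simp [hb]
    linear_combination -this

theorem kappa_pow (ι : F →+* k) (z : Fin 4 → k) (κ : SL4 F)
    (hk : vandermonde z * κ.1.map ι = diagonal z * vandermonde z) (n : ℕ) :
    vandermonde z * (κ ^ n).1.map ι = diagonal (fun i => z i ^ n) * vandermonde z := by
  induction n with
  | zero =>
    have : (κ ^ 0).1.map ι = 1 := by
      rw [pow_zero]; exact Matrix.map_one ι (map_zero ι) (map_one ι)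
    rw [this]; simp
  | succ n ih =>
    have : (κ ^ (n + 1)).1.map ι = (κ ^ n).1.map ι * κ.1.map ι := by
      rw [pow_succ, ← Matrix.map_mul]; rfl
    rw [this, ← mul_assoc, ih, mul_assoc, hk, ← mul_assoc, diagonal_mul_diagonal]
    simp only [pow_succ]

theorem kappa_ord [IsAlgClosed k] (ι : F →+* k) (z : Fin 4 → k) (hinj : Function.Injective z) (κ : SL4 F)
    (hk : vandermonde z * κ.1.map ι = diagonal z * vandermonde z) (n : ℕ) :
    orderOf (κ : PSL4 F) ∣ n ↔ ∀ i j, z i ^ n = z j ^ n := by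
  have hS : IsUnit (vandermonde z).det := isUnit_iff_ne_zero.2 (det_vandermonde_ne_zero_iff.2 hinj)
  have h := kappa_pow ι z κ hk n
  have hm : (κ ^ n).1.map ι = (κ.1.map ι) ^ n := by
    rw [Matrix.SpecialLinearGroup.coe_pow]; exact map_pow (ι.mapMatrix (m := Fin 4)) κ.1 n
  rw [hm] at h
  rw [ord_dvd_iff' ι]
  constructor
  · rintro ⟨c, hc⟩
    rw [hc, ← (scalar_commute c (fun r' => Commute.all c r') (vandermonde z)).eq] at h
    have h2 := congrArg (· * (vandermonde z)⁻¹) h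
    simp only [mul_assoc, mul_nonsing_inv _ hS, mul_one] at h2
    have h3 : ∀ i, c = z i ^ n := by
      intro i
      have := congrFun (congrFun h2 i) i
      simpa [scalar_apply] using this
    intro i j
    rw [← h3, ← h3]
  · intro hh
    refine ⟨z 0 ^ n, ?_⟩
    have : diagonal (fun i => z i ^ n) = scalar (Fin 4) (z 0 ^ n) := by
      rw [scalar_apply]; congr 1; ext i; exact hh i 0
    rw [this, (scalar_commute _ (fun r' => Commute.all _ r') (vandermonde z)).eq] at h
    have h2 := congrArg ((vandermonde z)⁻¹ * ·) h
    simpa only [← mul_assoc, nonsing_inv_mul _ hS, one_mul] using h2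

theorem kappa_main [IsAlgClosed k] {K W : Type} [Field K] [AddCommGroup W] [Module K W] (ι : F →+* k) (p m : ℕ)
    [Fact p.Prime] [CharP k p] [CharP K p] (hp : Odd p) (hF : Fintype.card F = p ^ m)
    (ρ : PSL4 F →* (W ≃ₗ[K] W))
    (he : elementOrders (SemidirectProduct (Multiplicative W) (PSL4 F) (linToMulAut.comp ρ)) =
      elementOrders (PSL4 F)) (r s t : ℕ)
    (hG : Good ι (ρ.comp (QuotientGroup.mk' (Subgroup.center (SL4 F)))) r s t)
    (hd : r + s + t + 2 ≤ Fintype.card F)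
    (z : Fin 4 → k) (hinj : Function.Injective z) (hz : ∏ i, z i = 1) (σ : Equiv.Perm (Fin 4))
    (hσ : ∀ i, z i ^ (p ^ m) = z (σ i)) (X3 X4 : ℤ) (hA : Ach p r s t X3 X4)
    (hX : z 2 ^ X3 * z 3 ^ X4 = 1) : ∃ n0, BadN (p ^ m) n0 ∧ ∀ i j, z i ^ n0 = z j ^ n0 := by
  classical
  have hpp : p.Prime := Fact.out
  obtain ⟨κ, hk⟩ := exists_kappa ι p m hF z hz σ hσ
  obtain ⟨N, hN⟩ : ∃ N, orderOf (κ : PSL4 F) = N := ⟨_, rfl⟩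
  have hord := kappa_ord ι z hinj κ hk
  rw [hN] at hord
  have hN0 : 0 < N := hN ▸ orderOf_pos _
  have hpN : ¬ p ∣ N := by
    rintro ⟨N', rfl⟩
    have h1 := (hord _).1 dvd_rfl
    have h2 : p * N' ∣ N' := (hord N').2 fun i j => by
      apply frob_inj p 1
      simp only [pow_one, ← pow_mul]
      rw [mul_comm]; exact h1 i j
    have := Nat.le_of_dvd (Nat.pos_of_mul_pos_left hN0) h2
    have := hpp.two_le
    nlinarith [Nat.pos_of_mul_pos_left hN0]
  by_cases hw : ∀ w, ∑ j ∈ Finset.range N, ρ ((κ : PSL4 F) ^ j) w = 0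
  · exfalso
    have hrel := hG.rel (Fin N) (fun j => κ ^ (j : ℕ)) (fun w => by
      have := hw w
      rw [Finset.sum_range] at this
      rw [← this]
      rfl)
    have hrel2 := ext_both ι r s t hd (Fin N) _ hrel
    have hS : IsUnit (vandermonde z).det := isUnit_iff_ne_zero.2 (det_vandermonde_ne_zero_iff.2 hinj)
    obtain ⟨x, hx, hc, hzx⟩ := Ach_idx p r s t X3 X4 hA z hz hX
    have hmon := mon_coeff (k := k) (Sidx r s t) (Sexp r s t) (Sexp_inj r s t)
      (fun x => (Scoef r s t x : k) * ∑ j : Fin N, (∏ i : Fin 4, z i ^ Sexp r s t x i.castSucc) ^ (j : ℕ)) (by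
      intro y hy
      have h := hrel2 (g0 * diagonal (fun i : Fin 4 => y i.castSucc) * vandermonde z)
        ((vandermonde z)⁻¹ * g1 (y 4)) (by
          rw [det_mul, det_mul, det_diagonal]
          refine mul_ne_zero (mul_ne_zero (det_g (y 4)).1 ?_) hS.ne_zero
          exact Finset.prod_ne_zero_iff.2 fun i _ => hy _) (by
          rw [det_mul]
          refine mul_ne_zero ?_ (det_g (y 4)).2
          rw [det_nonsing_inv]
          simpa using hS.ne_zero)
      rw [← h]
      have : ∀ j : Fin N, g0 * diagonal (fun i : Fin 4 => y i.castSucc) * vandermonde z *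
          (κ ^ (j : ℕ)).1.map ι * ((vandermonde z)⁻¹ * g1 (y 4)) =
          g0 * diagonal (fun i : Fin 4 => (Fin.snoc (fun i : Fin 4 => y i.castSucc * z i ^ (j : ℕ)) (y 4) :
            Fin 5 → k) i.castSucc) *
            g1 ((Fin.snoc (fun i : Fin 4 => y i.castSucc * z i ^ (j : ℕ)) (y 4) : Fin 5 → k) 4) := by
        intro j
        have e4 : ((Fin.snoc (fun i : Fin 4 => y i.castSucc * z i ^ (j : ℕ)) (y 4) : Fin 5 → k) 4) = y 4 :=
          Fin.snoc_last (α := fun _ => k) _ _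
        rw [e4]
        simp only [Fin.snoc_castSucc]
        rw [mul_assoc (g0 * _) (vandermonde z), kappa_pow ι z κ hk]
        have : diagonal (fun i : Fin 4 => y i.castSucc * z i ^ (j : ℕ)) =
          diagonal (fun i : Fin 4 => y i.castSucc) * diagonal (fun i : Fin 4 => z i ^ (j : ℕ)) := by
          rw [diagonal_mul_diagonal]
        rw [this]
        simp only [mul_assoc]
        rw [mul_nonsing_inv_cancel_left _ _ hS]
      simp only [this, PP_expand]
      rw [Finset.sum_comm]
      refine Finset.sum_congr rfl fun x _ => ?_
      rw [Finset.mul_sum, Finset.sum_mul]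
      refine Finset.sum_congr rfl fun j _ => ?_
      rw [Fin.prod_univ_castSucc (n := 4) (f := fun i => y i ^ Sexp r s t x i),
        Fin.prod_univ_castSucc (n := 4) (f := fun i => (Fin.snoc _ _ : Fin 5 → k) i ^ _)]
      simp only [Fin.snoc_castSucc, Fin.snoc_last, mul_pow, Finset.prod_mul_distrib, ← Finset.prod_pow,
        ← pow_mul]
      simp only [mul_comm, mul_assoc]
      have hl : y 4 = y (Fin.last 4) := rfl
      rw [hl]
      ring) x hx
    rw [hzx] at hmon
    simp at hmon
    rcases hmon with h | h
    · exact hc h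
    · exact hpN ((CharP.cast_eq_zero_iff k p N).1 h)
  · push Not at hw
    obtain ⟨w, hw⟩ := hw
    obtain ⟨h, hh⟩ := sd_order p ρ (κ : PSL4 F) N hN w hw he
    obtain ⟨n0, hb, hd⟩ := order_restrict p m ι hp hF h N ((Nat.Prime.coprime_iff_not_dvd hpp).2 hpN) hh
    exact ⟨n0, hb, (hord n0).1 hd⟩
end E7
end PartE7

section PartE9
set_option linter.unusedSectionVars false

section E9
variable {k : Type} [Field k]

theorem eqinv {a b : k} (hb : b ≠ 0) : a = b⁻¹ ↔ a * b = 1 := by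
  constructor
  · rintro rfl; exact inv_mul_cancel₀ hb
  · exact fun h => eq_inv_of_mul_eq_one_left h

theorem inj4 (z : Fin 4 → k) (h01 : z 0 ≠ z 1) (h02 : z 0 ≠ z 2) (h03 : z 0 ≠ z 3) (h12 : z 1 ≠ z 2)
    (h13 : z 1 ≠ z 3) (h23 : z 2 ≠ z 3) : Function.Injective z := by
  intro i j h
  fin_cases i <;> fin_cases j <;> first | rfl | (exfalso; first | exact h01 h | exact h02 h | exact h03 h | exact h12 h | exact h13 h | exact h23 h | exact h01 h.symm | exact h02 h.symm | exact h03 h.symm | exact h12 h.symm | exact h13 h.symm | exact h23 h.symm)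

theorem exists_prim [IsAlgClosed k] (p n : ℕ) [Fact p.Prime] [CharP k p] (hn : ¬ p ∣ n) :
    ∃ a : k, IsPrimitiveRoot a n := by
  have : NeZero (n : k) := ⟨fun h => hn ((CharP.cast_eq_zero_iff k p n).1 h)⟩
  exact HasEnoughRootsOfUnity.exists_primitiveRoot k n

variable {F : Type} [Field F] [Fintype F] [IsAlgClosed k] {K W : Type} [Field K] [AddCommGroup W] [Module K W]
  (ι : F →+* k) (p m : ℕ) [Fact p.Prime] [CharP k p] [CharP K p]

/-- abstract form of the conclusion of kappa_main -/
def Kap (k : Type) [Field k] (p m r s t : ℕ) : Prop :=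
  ∀ (z : Fin 4 → k), Function.Injective z → ∏ i, z i = 1 → ∀ (σ : Equiv.Perm (Fin 4)),
    (∀ i, z i ^ (p ^ m) = z (σ i)) → ∀ X3 X4 : ℤ, Ach p r s t X3 X4 →
    z 2 ^ X3 * z 3 ^ X4 = 1 → ∃ n0, BadN (p ^ m) n0 ∧ ∀ i j, z i ^ n0 = z j ^ n0

theorem p_ndvd_of (hm : 0 < m) (n c : ℕ) (h : n ∣ (p ^ m) * c + 1) : ¬ p ∣ n := by
  intro hp
  have hpp : p.Prime := Fact.out
  have h1 : p ∣ p ^ m * c + 1 := hp.trans h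
  have h2 : p ∣ p ^ m * c := (dvd_pow_self p hm.ne').mul_right c
  exact hpp.one_lt.ne' (Nat.dvd_one.1 ((Nat.dvd_add_right h2).1 h1))

theorem case_XX (hm : 0 < m) (hodd : p ^ m % 2 = 1) (hq : 3 ≤ p ^ m) (r s t : ℕ) (hk : Kap k p m r s t)
    (X : ℤ) (hA : Ach p r s t X X) : False := by
  obtain ⟨q, hqd⟩ : ∃ q, q = p ^ m := ⟨_, rfl⟩
  rw [← hqd] at hodd hq
  obtain ⟨M, hM⟩ : ∃ M, q * q + 1 = 2 * M ∧ M % 2 = 1 := by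
    obtain ⟨c, rfl⟩ : ∃ c, q = 2 * c + 1 := ⟨q / 2, by omega⟩
    exact ⟨2 * (c * c + c) + 1, by ring, by omega⟩
  obtain ⟨a, ha⟩ := exists_prim (k := k) p M (p_ndvd_of p m hm M (p ^ m) ⟨2, by rw [← hqd]; linarith [hM.1]⟩)
  have hMq : q + 1 < M := by nlinarith [hM.1]
  have ha0 : a ≠ 0 := ha.ne_zero (by omega)
  have hcop : Nat.Coprime M 2 := by
    rw [Nat.coprime_two_right]; exact Nat.odd_iff.2 hM.2
  have hne : ∀ n, 0 < n → n < M → a ^ n ≠ 1 := fun n h1 h2 => ha.pow_ne_one_of_pos_of_lt h1.ne' h2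
  have hq2 : a ^ (q * q) = a⁻¹ := by
    rw [eqinv ha0, ← pow_succ, hM.1, mul_comm, pow_mul, ha.pow_eq_one, one_pow]
  have h2 : ∀ n, 0 < n → n < M → a ^ n ≠ (a ^ n)⁻¹ := by
    intro n h1 h3 h
    rw [eqinv (pow_ne_zero _ ha0), ← pow_add, ← two_mul] at h
    have := ha.dvd_of_pow_eq_one _ h
    have := Nat.le_of_dvd h1 (hcop.dvd_of_dvd_mul_left this)
    omega
  have e02 : a ≠ a ^ q := by
    intro h
    apply hne (q - 1) (by omega) (by omega)
    have : a * a ^ (q - 1) = a * 1 := by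
      rw [← pow_succ', show q - 1 + 1 = q by omega, ← h, mul_one]
    exact mul_left_cancel₀ ha0 this
  have e03 : a ≠ (a ^ q)⁻¹ := by
    intro h
    rw [eqinv (pow_ne_zero _ ha0), ← pow_succ'] at h
    exact hne (q + 1) (by omega) (by omega) h
  obtain ⟨n0, hb, hn⟩ := hk ![a, a⁻¹, a ^ q, (a ^ q)⁻¹] (by
    apply inj4 <;> simp
    · simpa using h2 1 (by omega) (by omega)
    · exact e02
    · exact e03
    · intro h; exact e03 (by rw [← h, inv_inv])
    · exact e02
    · exact h2 q (by omega) (by omega)) (by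
      rw [Fin.prod_univ_four]
      simp [ha0]) (⟨![2, 3, 1, 0], ![3, 2, 0, 1], by decide, by decide⟩) (by
      rw [← hqd]
      intro i
      fin_cases i <;> simp [← pow_mul, hq2]) X X hA (by
      simp
      rw [mul_inv_cancel₀ (zpow_ne_zero _ (pow_ne_zero _ ha0))])
  have hpos := BadN_pos (hqd ▸ hq) hb
  have h01 := hn 0 1
  simp at h01
  refine h2 n0 hpos ?_ h01
  rw [← hqd] at hb
  have hM1 := hM.1
  rw [← pow_two] at hM1
  rcases hb with h | h | h | h <;> omega

theorem case_AB3 (hm : 0 < m) (hodd : p ^ m % 4 = 3) (r s t : ℕ) (hk : Kap k p m r s t)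
    (hp2 : p ≠ 2) (A B : ℤ) (hA : Ach p r s t A B) (hB : B % 2 = 0) : False := by
  obtain ⟨q, hqd⟩ : ∃ q, q = p ^ m := ⟨_, rfl⟩
  rw [← hqd] at hodd
  have hpp : p.Prime := Fact.out
  have hnd : ¬ p ∣ 2 * (q + 1) := by
    intro h
    rcases (hpp.dvd_mul).1 h with h | h
    · exact hp2 ((Nat.prime_dvd_prime_iff_eq hpp Nat.prime_two).1 h)
    · exact p_ndvd_of p m hm (q + 1) 1 (by rw [← hqd, mul_one]) h
  obtain ⟨a, ha⟩ := exists_prim (k := k) p _ hnd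
  have ha0 : a ≠ 0 := ha.ne_zero (by omega)
  have hq3 : 3 ≤ q := by omega
  have hne : ∀ n, 0 < n → n < 2 * (q + 1) → a ^ n ≠ 1 := fun n h1 h2 => ha.pow_ne_one_of_pos_of_lt h1.ne' h2
  have hm1 : a ^ (q + 1) = -1 := by
    have h1 : a ^ (q + 1) * a ^ (q + 1) = 1 := by
      rw [← pow_add, ← two_mul, ha.pow_eq_one]
    rcases mul_self_eq_one_iff.1 h1 with h | h
    · exact absurd h (hne _ (by omega) (by omega))
    · exact h
  have haq : a ^ q = -a⁻¹ := by
    rw [eq_neg_iff_add_eq_zero, ← mul_left_inj' ha0, add_mul, ← pow_succ, hm1, inv_mul_cancel₀ ha0]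
    simp
  have hqo : Odd q := Nat.odd_iff.2 (by omega)
  have n1 : a ≠ 1 := by simpa using hne 1 (by omega) (by omega)
  have n2 : a ^ 2 ≠ 1 := hne 2 (by omega) (by omega)
  have n4 : a ^ 4 ≠ 1 := hne 4 (by omega) (by omega)
  have n3 : a ≠ -1 := by rintro h; apply n2; rw [h]; ring
  have n11 : (1 : k) ≠ -1 := by
    intro h
    have : a ^ (q + 1) = 1 := by rw [hm1, ← h]
    exact hne _ (by omega) (by omega) this
  obtain ⟨n0, hb, hn⟩ := hk ![a, -a⁻¹, 1, -1] (by
    apply inj4 <;> simp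
    · intro h
      have : a * a = -1 := by
        rw [eq_neg_iff_add_eq_zero, ← mul_left_inj' ha0, add_mul, inv_mul_cancel₀ ha0, zero_mul] at h
        exact eq_neg_of_add_eq_zero_left h
      apply n4
      calc a ^ 4 = (a * a) * (a * a) := by ring
        _ = 1 := by rw [this]; ring
    · exact n1
    · exact n3
    · intro h
      apply n3
      rw [neg_eq_iff_eq_neg, inv_eq_iff_eq_inv] at h
      rw [h]; simp
    · exact n1
    · exact n11) (by
      rw [Fin.prod_univ_four]
      simp [ha0]) (⟨![1, 0, 2, 3], ![1, 0, 2, 3], by decide, by decide⟩) (by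
      rw [← hqd]
      intro i
      fin_cases i
      · simpa using haq
      · simp [hqo.neg_pow, haq]
      · simp
      · simp [hqo.neg_pow]) A B hA (by
      simp
      exact Even.neg_one_zpow (Int.even_iff.2 hB))
  have hpos := BadN_pos (hqd ▸ hq3) hb
  have h02 := hn 0 2
  simp at h02
  have hdv := ha.dvd_of_pow_eq_one _ h02
  have hle := Nat.le_of_dvd hpos hdv
  rw [← hqd] at hb
  rcases hb with h | h | h | h
  · omega
  · omega
  · omega
  · rw [q_arith3 q hodd] at h
    rw [h.2, mul_comm 2] at hdv
    have := Nat.dvd_of_mul_dvd_mul_left (by omega) hdv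
    omega

theorem excl1 (q : ℕ) (hq : q % 4 = 1) (hq5 : 5 ≤ q) (T ℓ : ℕ) (u : ℕ) (hu : u % 2 = 1) (hT : 2 ≤ T)
    (hqu : q - 1 = 2 ^ T * u) (hl : q + 1 = 2 * ℓ) (w χ : k) (hw : IsPrimitiveRoot w (2 ^ T))
    (hχ : IsPrimitiveRoot χ ℓ) (e : ℤ) (he : e % 2 = 1) (n0 : ℕ) (hb : BadN q n0)
    (h : (w ^ e * χ) ^ n0 = 1) : False := by
  have hlo : Odd ℓ := Nat.odd_iff.2 (by omega)
  have hco : Nat.Coprime ℓ 2 := Nat.coprime_two_right.2 hlo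
  have hw1 : (w ^ e) ^ (2 ^ T) = 1 := by
    rw [← zpow_natCast, ← _root_.zpow_mul, mul_comm, _root_.zpow_mul, zpow_natCast, hw.pow_eq_one, _root_.one_zpow]
  have h1 : ℓ ∣ n0 := by
    have : χ ^ (n0 * 2 ^ T) = 1 := by
      have h2 := congrArg (· ^ (2 ^ T)) h
      simp only [one_pow, mul_pow] at h2
      rw [← pow_mul, mul_comm, ← pow_mul, mul_comm n0, pow_mul (w ^ e), hw1, one_pow, mul_one] at h2
      rw [mul_comm]
      exact h2
    exact (Nat.Coprime.pow_right T hco).dvd_of_dvd_mul_right (hχ.dvd_of_pow_eq_one _ this)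
  have h2 : 2 ^ T ∣ n0 := by
    have : w ^ (e * (n0 * ℓ : ℕ)) = 1 := by
      have h3 := congrArg (· ^ ℓ) h
      simp only [one_pow, ← pow_mul, mul_pow] at h3
      rw [mul_comm n0, pow_mul χ, hχ.pow_eq_one, one_pow, mul_one] at h3
      rw [_root_.zpow_mul, zpow_natCast, mul_comm]; exact h3
    have h4 := (hw.zpow_eq_one_iff_dvd _).1 this
    have h5 : IsCoprime ((2 ^ T : ℕ) : ℤ) (e * ℓ) := by
      push_cast
      apply IsCoprime.pow_left
      rw [Int.isCoprime_iff_gcd_eq_one]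
      have : (e * ℓ) % 2 = 1 := by
        have : (ℓ : ℤ) % 2 = 1 := by have := Nat.odd_iff.1 hlo; omega
        rw [Int.mul_emod, he, this]; rfl
      have hp := (Int.isCoprime_iff_gcd_eq_one (m := 2) (n := e * ℓ)).1
        ⟨-(e * ℓ / 2), 1, by omega⟩
      exact hp
    have h6 : ((2 ^ T : ℕ) : ℤ) ∣ (e * ℓ) * n0 := by
      have e1 : e * ((n0 * ℓ : ℕ) : ℤ) = (e * ℓ) * n0 := by push_cast; ring
      rwa [e1] at h4
    exact Int.natCast_dvd_natCast.1 (h5.dvd_of_dvd_mul_left h6)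
  have h4T : 4 ∣ 2 ^ T := pow_dvd_pow 2 hT
  have h4n := h4T.trans h2
  have hl3 : 3 ≤ ℓ := by omega
  rcases hb with h | h | h | h
  · have : ℓ ∣ 2 := by
      have h3 : ℓ ∣ q + 1 := ⟨2, by omega⟩
      have h4 : q + 1 = n0 + 2 := by omega
      rw [h4] at h3
      exact (Nat.dvd_add_right h1).1 h3
    have := Nat.le_of_dvd (by omega) this
    omega
  · omega
  · rw [q_arith1 q hq] at h
    obtain ⟨c, hc⟩ := h2
    have e4 : q - 1 = 4 * ((q - 1) / 4) := by omega
    have e5 : 2 * n0 = ℓ * (2 ^ T * u) := by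
      rw [← hqu, e4, h.2, hl]; ring
    rw [hc] at e5
    have e6 : 2 ^ T * (2 * c) = 2 ^ T * (ℓ * u) := by linarith
    have e7 := Nat.eq_of_mul_eq_mul_left (by positivity) e6
    have : (ℓ * u) % 2 = 1 := Nat.odd_iff.1 (hlo.mul (Nat.odd_iff.2 hu))
    omega
  · omega

theorem case_one (hm : 0 < m) (hodd : p ^ m % 4 = 1) (hp2 : p ≠ 2) (r s t : ℕ) (hk : Kap k p m r s t)
    (h : (∃ B, Ach p r s t 0 B) ∨ ∃ A B, Ach p r s t A B ∧ (A-B)%4=0 ∧ (A+B)%8=4) : False := by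
  obtain ⟨q, hqd⟩ : ∃ q, q = p ^ m := ⟨_, rfl⟩
  rw [← hqd] at hodd
  have hpp : p.Prime := Fact.out
  have hq5 : 5 ≤ q := by
    have : 1 < q := by rw [hqd]; exact Nat.one_lt_pow hm.ne' hpp.one_lt
    omega
  obtain ⟨T, u, hu, hqu⟩ := Nat.exists_eq_two_pow_mul_odd (n := q - 1) (by omega)
  have hu2 := Nat.odd_iff.1 hu
  have hT : 2 ≤ T := by
    by_contra hT
    have : T = 0 ∨ T = 1 := by omega
    rcases this with rfl | rfl <;> omega
  obtain ⟨ℓ, hl⟩ : ∃ ℓ, q + 1 = 2 * ℓ := ⟨(q + 1) / 2, by omega⟩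
  obtain ⟨w, hw⟩ := exists_prim (k := k) p (2 ^ T) (fun h => hp2 ((Nat.prime_dvd_prime_iff_eq hpp Nat.prime_two).1
    (hpp.dvd_of_dvd_pow h)))
  obtain ⟨χ, hχ⟩ := exists_prim (k := k) p ℓ (p_ndvd_of p m hm ℓ 1 ⟨2, by rw [← hqd]; omega⟩)
  have hw0 : w ≠ 0 := hw.ne_zero (by positivity)
  have hχ0 : χ ≠ 0 := hχ.ne_zero (by omega)
  have hwq : w ^ q = w := by
    have : q = 2 ^ T * u + 1 := by omega
    rw [this, pow_succ, pow_mul, hw.pow_eq_one, one_pow, one_mul]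
  have hχq : χ ^ q = χ⁻¹ := by
    rw [eqinv hχ0, ← pow_succ, hl, mul_comm, pow_mul, hχ.pow_eq_one, one_pow]
  have hwz : ∀ e : ℤ, (w ^ e) ^ q = w ^ e := by
    intro e
    rw [← zpow_natCast, ← _root_.zpow_mul, mul_comm, _root_.zpow_mul, zpow_natCast, hwq]
  have hχ2 : χ * χ ≠ 1 := by
    rw [← pow_two]; exact hχ.pow_ne_one_of_pos_of_lt (by omega) (by omega)
  have hlo : Odd ℓ := Nat.odd_iff.2 (by omega)
  have hχw : ∀ e : ℤ, χ ≠ w ^ e := by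
    intro e h
    have : χ ^ (2 ^ T) = 1 := by
      rw [h, ← zpow_natCast, ← _root_.zpow_mul, mul_comm, _root_.zpow_mul, zpow_natCast, hw.pow_eq_one, _root_.one_zpow]
    have h2 := hχ.dvd_of_pow_eq_one _ this
    have h3 : Nat.Coprime ℓ (2 ^ T) := Nat.Coprime.pow_right T (Nat.coprime_two_right.2 hlo)
    have := Nat.Coprime.eq_one_of_dvd h3 h2
    omega
  have hw2 : w ^ 2 ≠ 1 := by
    apply hw.pow_ne_one_of_pos_of_lt (by omega)
    calc 2 < 2 ^ 2 := by norm_num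
      _ ≤ 2 ^ T := Nat.pow_le_pow_right (by omega) hT
  have d1 : ∀ a b : ℤ, w ^ a * χ ≠ w ^ b := by
    intro a b h
    apply hχw (b - a)
    rw [zpow_sub₀ hw0, ← h]; field_simp
  have d2 : ∀ a b : ℤ, w ^ a * χ⁻¹ ≠ w ^ b := by
    intro a b h
    apply hχw (a - b)
    rw [zpow_sub₀ hw0, ← h]; field_simp
  have d3 : ∀ a : ℤ, w ^ a * χ ≠ w ^ a * χ⁻¹ := by
    intro a h
    have := mul_left_cancel₀ (zpow_ne_zero _ hw0) h
    apply hχ2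
    rwa [eqinv hχ0] at this
  have main : ∀ a b c : ℤ, 2 * a + b + c = 0 → w ^ b ≠ w ^ c → ∀ A B, Ach p r s t A B →
      (w ^ b) ^ A * (w ^ c) ^ B = 1 → ((a - b) % 2 = 1 ∨ (a - c) % 2 = 1) → False := by
    intro a b c habc hbc A B hA hX hpar
    obtain ⟨n0, hb, hn⟩ := hk ![w ^ a * χ, w ^ a * χ⁻¹, w ^ b, w ^ c] (by
      apply inj4
      · exact d3 a
      · exact d1 a b
      · exact d1 a c
      · exact d2 a b
      · exact d2 a c
      · exact hbc) (by
        rw [Fin.prod_univ_four]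
        change w ^ a * χ * (w ^ a * χ⁻¹) * w ^ b * w ^ c = 1
        have : w ^ a * χ * (w ^ a * χ⁻¹) * w ^ b * w ^ c = w ^ a * w ^ a * w ^ b * w ^ c := by
          field_simp
        rw [this, ← zpow_add₀ hw0, ← zpow_add₀ hw0, ← zpow_add₀ hw0,
          show a + a + b + c = 0 by omega, zpow_zero]) (⟨![1, 0, 2, 3], ![1, 0, 2, 3], by decide, by decide⟩) (by
        rw [← hqd]
        intro i
        fin_cases i
        · simp [mul_pow, hwz, hχq]
        · simp [mul_pow, hwz, hχq]
        · simpa using hwz b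
        · simpa using hwz c) A B hA hX
    rw [← hqd] at hb
    have key : ∀ d : ℤ, (a - d) % 2 = 1 → (w ^ a * χ) ^ n0 = (w ^ d) ^ n0 → False := by
      intro d hd h
      apply excl1 q hodd hq5 T ℓ u hu2 hT hqu hl w χ hw hχ (a - d) hd n0 hb
      rw [zpow_sub₀ hw0, div_mul_eq_mul_div, div_pow, h, div_self (pow_ne_zero _ (zpow_ne_zero _ hw0))]
    rcases hpar with h | h
    · exact key b h (hn 0 2)
    · exact key c h (hn 0 3)
  rcases h with ⟨B, hB⟩ | ⟨A, B, hA, h1, h2⟩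
  · refine main 1 (-2) 0 (by norm_num) ?_ 0 B hB (by simp) (by norm_num)
    simp only [_root_.zpow_neg, zpow_zero]
    intro h
    rw [inv_eq_one] at h
    exact hw2 (by exact_mod_cast h)
  · obtain ⟨c, hc⟩ : ∃ c, A - B = 4 * c := ⟨(A - B) / 4, by omega⟩
    obtain ⟨d, hd⟩ : ∃ d, A + B = 4 * (2 * d + 1) := ⟨(A + B) / 8, by omega⟩
    have hco : IsCoprime (2 * d + 1) ((2 : ℤ) ^ T) := by
      apply IsCoprime.pow_right
      exact ⟨1, -d, by ring⟩
    obtain ⟨x, y, hxy⟩ := hco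
    refine main (c * x) (1 - c * x) (-1 - c * x) (by ring) ?_ A B hA ?_ (by left; omega)
    · intro h
      apply hw2
      have : w ^ (2 : ℤ) = 1 := by
        rw [show (2 : ℤ) = (1 - c * x) - (-1 - c * x) by ring, zpow_sub₀ hw0, h,
          div_self (zpow_ne_zero _ hw0)]
      exact_mod_cast this
    · rw [← _root_.zpow_mul, ← _root_.zpow_mul, ← zpow_add₀ hw0]
      have : (1 - c * x) * A + (-1 - c * x) * B = ((2 ^ T : ℕ) : ℤ) * (4 * c * y) := by
        push_cast
        linear_combination hc - c * x * hd - 4 * c * hxy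
      rw [this, _root_.zpow_mul, zpow_natCast, hw.pow_eq_one, _root_.one_zpow]
end E9
end PartE9

section PartE10
set_option linter.unusedSectionVars false

section E10
open Matrix
variable {F : Type} [Field F] [Fintype F]

theorem center_dvd {k K W : Type} [Field k] [Field K] [AddCommGroup W] [Module K W] (p : ℕ) [Fact p.Prime]
    [CharP F p] (hp2 : p ≠ 2) (ι : F →+* k)
    (ρ : PSL4 F →* (W ≃ₗ[K] W)) (r s t : ℕ)
    (hG : Good ι (ρ.comp (QuotientGroup.mk' (Subgroup.center (SL4 F)))) r s t)
    (hq : Fintype.card F % 4 = 1) : 4 ∣ r + 2 * s + 3 * t := by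
  obtain ⟨i, hi⟩ := FiniteField.isSquare_neg_one_iff (F := F) |>.2 (by omega)
  have h11 : (-1 : F) ≠ 1 := by
    have : NeZero (2 : F) := ⟨fun h => by
      have := (CharP.cast_eq_zero_iff F p 2).1 (by exact_mod_cast h)
      exact hp2 ((Nat.prime_dvd_prime_iff_eq Fact.out Nat.prime_two).1 this)⟩
    intro h
    have h2 : (2 : F) = 0 := by linear_combination -h
    exact this.out h2
  have h4 : i ^ 4 = 1 := by
    calc i ^ 4 = (i * i) * (i * i) := by ring
      _ = 1 := by rw [← hi]; ring
  let z : SL4 F := ⟨scalar (Fin 4) i, by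
    rw [← smul_one_eq_scalar', det_smul, det_one, mul_one]; exact h4⟩
  have hz : (z : PSL4 F) = 1 := (mk_eq_one_iff z).2 ⟨i, rfl⟩
  have h := hG.triv z (by
    change ρ (z : PSL4 F) = 1
    rw [hz, map_one])
  have h1 : ι (i ^ (r + 2 * s + 3 * t)) = 1 := by
    rw [← h]
    congr 1
    change _ = PP r s t (scalar (Fin 4) i)
    simp [PP, D1, D2, D3, scalar_apply]
    ring
  have h2 : i ^ (r + 2 * s + 3 * t) = 1 := ι.injective (by rw [h1, map_one])
  have ho : orderOf i = 2 ^ (1 + 1) := orderOf_eq_prime_pow (by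
    rw [pow_one, pow_two, ← hi]; exact h11) h4
  rw [show (4 : ℕ) = 2 ^ (1 + 1) by norm_num, ← ho]
  exact orderOf_dvd_of_pow_eq_one h2

theorem exists_eighth (p : ℕ) [Fact p.Prime] [CharP F p] (hp2 : p ≠ 2)
    (hq : Fintype.card F % 8 = 1) : ∃ ζ : F, ζ ^ 4 = -1 := by
  obtain ⟨i, hi⟩ := FiniteField.isSquare_neg_one_iff (F := F) |>.2 (by omega)
  have hi0 : i ≠ 0 := by
    rintro rfl
    simp at hi
  have h4 : i ^ 4 = 1 := by
    calc i ^ 4 = (i * i) * (i * i) := by ring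
      _ = 1 := by rw [← hi]; ring
  obtain ⟨ζ, hζ⟩ := (FiniteField.isSquare_iff (F := F) (by rwa [ringChar.eq F p]) hi0).2 (by
    obtain ⟨c, hc⟩ : ∃ c, Fintype.card F / 2 = 4 * c := ⟨Fintype.card F / 8, by omega⟩
    rw [hc, pow_mul, h4, one_pow])
  refine ⟨ζ, ?_⟩
  calc ζ ^ 4 = (ζ * ζ) * (ζ * ζ) := by ring
    _ = -1 := by rw [← hζ, hi]

theorem charF (p m : ℕ) [Fact p.Prime] (hF : Fintype.card F = p ^ m) : CharP F p := by
  obtain ⟨p', hp'⟩ := CharP.exists F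
  obtain ⟨n, h1, h2⟩ := FiniteField.card F p'
  have hpp : p.Prime := Fact.out
  have : p' ∣ p ^ m := by
    rw [← hF, h2]; exact dvd_pow_self _ n.ne_zero
  have h3 := (Nat.prime_dvd_prime_iff_eq h1 hpp).1 (h1.dvd_of_dvd_pow this)
  rw [← h3]; exact hp'

theorem exists_iota (p : ℕ) [Fact p.Prime] [CharP F p] (k : Type) [Field k] [IsAlgClosed k] [CharP k p] :
    Nonempty (F →+* k) := by
  let _ := ZMod.algebra F p
  let _ := ZMod.algebra k p
  exact ⟨(IsAlgClosed.lift : F →ₐ[ZMod p] k).toRingHom⟩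

theorem main_generic (p m : ℕ) [Fact p.Prime] (hp : Odd p) (hF : Fintype.card F = p ^ m)
    {K W : Type} [Field K] [CharP K p] [AddCommGroup W] [Module K W] [Nontrivial W]
    {k : Type} [Field k] [IsAlgClosed k] [CharP k p] [CharP F p] (κ : K →+* k) (ι : F →+* k)
    (ρ : PSL4 F →* (W ≃ₗ[K] W)) (hcase : 5 ≤ p ∨ (p = 3 ∧ m % 2 = 0))
    (he : elementOrders (SemidirectProduct (Multiplicative W) (PSL4 F) (linToMulAut.comp ρ)) =
      elementOrders (PSL4 F)) : False := by
  obtain ⟨hq3, hqo⟩ := q_ge hp hF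
  have hm : 0 < m := by
    rcases Nat.eq_zero_or_pos m with rfl | h
    · simp at hq3
    · exact h
  have hp2 : p ≠ 2 := by rintro rfl; revert hp; decide
  have hcase' : 5 ≤ p ∨ (p = 3 ∧ ∃ ζ : F, ζ ^ 4 = -1) := by
    rcases hcase with h | ⟨h, h2⟩
    · exact Or.inl h
    · refine Or.inr ⟨h, exists_eighth p hp2 ?_⟩
      obtain ⟨c, rfl⟩ : ∃ c, m = 2 * c := ⟨m / 2, by omega⟩
      rw [hF, h, pow_mul, Nat.pow_mod]
      norm_num
  let ρ' : SL4 F →* (W ≃ₗ[K] W) := ρ.comp (QuotientGroup.mk' (Subgroup.center (SL4 F)))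
  have hN : ∀ {a b : Fin 4} (hab : a ≠ b) (w : W), ∑ j ∈ Finset.range p, ρ' (tv hab (1 : F) ^ j) w = 0 := by
    intro a b hab w
    exact factN p ι ρ he hcase' hab 1 one_ne_zero w
  have hY : ∀ (i : Fin 3) w, ∑ u : F, ρ' (yy i u) w = 0 := fun i w =>
    sum_tv p ρ' (a := i.succ) (b := i.castSucc) (Fin.castSucc_lt_succ).ne' (hN _) w
  obtain ⟨r, s, t, hr, hs, ht, hG⟩ := key_PP κ ι p ρ' hY
  have hdig := good_digit p ι ρ' r s t hG (by omega) (by omega) (by omega) (hN _)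
  rw [hF] at hr hs ht
  have hsum := (sum_lt p r s t m hdig (by omega) (by omega) (by omega)).2 hm
  have hk : Kap k p m r s t := fun z hinj hz σ hσ X3 X4 hA hX =>
    kappa_main ι p m hp hF ρ he r s t hG (by rw [hF]; exact hsum) z hinj hz σ hσ X3 X4 hA hX
  have h4 : p ^ m % 4 = 1 ∨ p ^ m % 4 = 3 := by omega
  rcases h4 with h4 | h4
  · exact case_one p m hm h4 hp2 r s t hk (Ach_one p hp m r s t hdig (by omega) (by omega) (by omega)
      (center_dvd p hp2 ι ρ r s t hG (by rw [hF]; exact h4)))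
  · rcases Ach_three p hp m r s t hdig (by omega) (by omega) (by omega) with ⟨X, hX⟩ | ⟨A, B, hA, hB⟩
    · exact case_XX p m hm hqo hq3 r s t hk X hX
    · exact case_AB3 p m hm h4 r s t hk hp2 A B hA hB
end E10
end PartE10

section PartE11
set_option linter.unusedSectionVars false

section E11
variable {K W : Type} [Field K] [AddCommGroup W] [Module K W]

theorem eig_step (X : W →ₗ[K] W) (hX : ∀ w, X (X w) = w) (w : W) (hw : w ≠ 0) :
    ∃ w', w' ≠ 0 ∧ (∃ e : ℤ, (e = 1 ∨ e = -1) ∧ X w' = e • w') ∧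
      ∀ Y : W →ₗ[K] W, (∀ v, Y (X v) = X (Y v)) → ∀ e : ℤ, Y w = e • w → Y w' = e • w' := by
  by_cases h : w + X w = 0
  · refine ⟨w, hw, ⟨-1, Or.inr rfl, ?_⟩, fun Y _ e he => he⟩
    rw [neg_one_zsmul]; exact (neg_eq_of_add_eq_zero_right h).symm
  · refine ⟨w + X w, h, ⟨1, Or.inl rfl, ?_⟩, ?_⟩
    · rw [map_add, hX, one_zsmul, add_comm]
    · intro Y hY e he
      rw [map_add, hY, he, map_zsmul, smul_add]

theorem core_eig (h3 : (3 : K) = 0) (X : Fin 5 → (W →ₗ[K] W)) (C : W →ₗ[K] W)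
    (hX : ∀ i w, X i (X i w) = w) (hcomm : ∀ i j w, X i (X j w) = X j (X i w))
    (hC : ∀ i w, X (i + 1) (C w) = C (X i w))
    (hprod : ∀ w, X 0 (X 1 (X 2 (X 3 (X 4 w)))) = w)
    (hN : ∀ w, w + C w + C (C w) + C (C (C w)) + C (C (C (C w))) = 0) :
    ∀ w, X 0 w = w := by
  by_contra hne
  push Not at hne
  obtain ⟨u, hu⟩ := hne
  have h0 : u - X 0 u ≠ 0 := fun h => hu (sub_eq_zero.1 h).symm
  have h0' : X 0 (u - X 0 u) = (-1 : ℤ) • (u - X 0 u) := by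
    rw [map_sub, hX, neg_one_zsmul, neg_sub]
  obtain ⟨w1, hw1, ⟨e1, he1, hx1⟩, hp1⟩ := eig_step (X 1) (hX 1) _ h0
  obtain ⟨w2, hw2, ⟨e2, he2, hx2⟩, hp2⟩ := eig_step (X 2) (hX 2) _ hw1
  obtain ⟨w3, hw3, ⟨e3, he3, hx3⟩, hp3⟩ := eig_step (X 3) (hX 3) _ hw2
  obtain ⟨w, hw, ⟨e4, he4, y4⟩, hp4⟩ := eig_step (X 4) (hX 4) _ hw3
  have y0 := hp4 _ (hcomm 0 4) _ (hp3 _ (hcomm 0 3) _ (hp2 _ (hcomm 0 2) _ (hp1 _ (hcomm 0 1) _ h0')))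
  have y1 := hp4 _ (hcomm 1 4) _ (hp3 _ (hcomm 1 3) _ (hp2 _ (hcomm 1 2) _ hx1))
  have y2 := hp4 _ (hcomm 2 4) _ (hp3 _ (hcomm 2 3) _ hx2)
  have y3 := hp4 _ (hcomm 3 4) _ hx3
  have h3w : (3 : ℤ) • w = 0 := by
    rw [← Int.cast_smul_eq_zsmul K]; push_cast; rw [h3, zero_smul]
  let ε : Fin 5 → ℤ := ![-1, e1, e2, e3, e4]
  have hy : ∀ i, X i w = ε i • w := by
    intro i; fin_cases i
    · exact y0
    · exact y1
    · exact y2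
    · exact y3
    · exact y4
  have hC' : ∀ i w, X i (C w) = C (X (i - 1) w) := by
    intro i w; rw [← hC, sub_add_cancel]
  have hv : ∀ (j : ℕ) i, X i ((C ^ j) w) = ε (i - Fin.ofNat 5 j) • (C ^ j) w := by
    intro j
    induction j with
    | zero => intro i; rw [show i - Fin.ofNat 5 0 = i from sub_zero i]; exact hy i
    | succ j ih =>
      intro i
      rw [pow_succ', Module.End.mul_apply, hC', ih, map_zsmul,
        show Fin.ofNat 5 (j + 1) = Fin.ofNat 5 j + 1 from Fin.ext (by simp [Fin.val_add])]
      congr 2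
      abel
  have hstep : ∀ (f : Fin 5 → ℤ), ∑ j, f j • (C ^ (j : ℕ)) w = 0 → ∀ i,
      ∑ j, (f j * (1 + ε i * ε (i - j))) • (C ^ (j : ℕ)) w = 0 := by
    intro f hf i
    have h1 : X i (∑ j, f j • (C ^ (j : ℕ)) w) = 0 := by rw [hf, map_zero]
    rw [map_sum] at h1
    have h2 : ∑ j, f j • (C ^ (j : ℕ)) w + ε i • ∑ j, X i (f j • (C ^ (j : ℕ)) w) = 0 := by
      rw [hf, h1, smul_zero, add_zero]
    rw [Finset.smul_sum, ← Finset.sum_add_distrib] at h2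
    rw [← h2]
    apply Finset.sum_congr rfl
    intro j _
    rw [map_zsmul, hv, show Fin.ofNat 5 (j : ℕ) = j from Fin.ext (Nat.mod_eq_of_lt j.2), smul_smul, smul_smul, ← add_smul]
    congr 1; ring
  have hs0 : ∑ j : Fin 5, (1 : ℤ) • (C ^ (j : ℕ)) w = 0 := by
    rw [← hN w]
    simp [Fin.sum_univ_five, pow_succ, Module.End.mul_apply]
  have hs := hstep _ (hstep _ (hstep _ (hstep _ (hstep (fun _ => 1) hs0 0) 1) 2) 3) 4
  have hpr := hprod w
  simp only [hy, map_zsmul, smul_smul] at hpr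
  have hpr' : (ε 4 * ε 3 * ε 2 * ε 1 * ε 0 - 1) • w = 0 := by
    rw [sub_smul, hpr, one_smul, sub_self]
  have hcop : ∀ a b : ℤ, a * 3 + b = 1 ∨ a * 3 + b = -1 → b • w ≠ 0 := by
    intro a b hab hb
    have : (a * 3 + b) • w = 0 := by rw [add_smul, mul_smul, h3w, smul_zero, hb, add_zero]
    rcases hab with h | h <;> rw [h] at this <;> simp [hw] at this
  have hprodv : ε 4 * ε 3 * ε 2 * ε 1 * ε 0 = 1 := by
    by_contra hne
    apply hcop 1 (ε 4 * ε 3 * ε 2 * ε 1 * ε 0 - 1) ?_ hpr'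
    left
    simp only [ε] at hne ⊢
    revert hne
    rcases he1 with rfl | rfl <;> rcases he2 with rfl | rfl <;> rcases he3 with rfl | rfl <;>
      rcases he4 with rfl | rfl <;> decide
  have hfin : ∀ j : Fin 5, 1 * (1 + ε 0 * ε (0 - j)) * (1 + ε 1 * ε (1 - j)) * (1 + ε 2 * ε (2 - j)) *
      (1 + ε 3 * ε (3 - j)) * (1 + ε 4 * ε (4 - j)) = if j = 0 then 32 else 0 := by
    simp only [ε] at hprodv ⊢
    revert hprodv
    rcases he1 with rfl | rfl <;> rcases he2 with rfl | rfl <;> rcases he3 with rfl | rfl <;>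
      rcases he4 with rfl | rfl <;> decide
  simp only [hfin] at hs
  rw [Finset.sum_eq_single 0] at hs
  · simp only [if_true, Fin.val_zero, pow_zero, Module.End.one_apply] at hs
    exact hcop (-11) 32 (Or.inr (by norm_num)) hs
  · intro j _ hj; simp [hj]
  · simp

/-- abstract version for a group -/
theorem core_grp (h3 : (3 : K) = 0) {L : Type} [Group L] (ρ : L →* (W ≃ₗ[K] W)) (c x : L)
    (hc : c ^ 5 = 1) (hx : x * x = 1) (h01 : x * (c * x * c⁻¹) = (c * x * c⁻¹) * x)
    (h02 : x * (c ^ 2 * x * (c ^ 2)⁻¹) = (c ^ 2 * x * (c ^ 2)⁻¹) * x) (hxc : (x * c) ^ 5 = 1)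
    (hN : ∀ w, ∑ j ∈ Finset.range 5, ρ (c ^ j) w = 0) : ρ x = 1 := by
  let y : Fin 5 → L := fun i => c ^ (i : ℕ) * x * (c ^ (i : ℕ))⁻¹
  have hstep : ∀ i, c * y i * c⁻¹ = y (i + 1) := by
    intro i
    fin_cases i
    · show c * (c ^ 0 * x * (c ^ 0)⁻¹) * c⁻¹ = c ^ 1 * x * (c ^ 1)⁻¹
      group
    · show c * (c ^ 1 * x * (c ^ 1)⁻¹) * c⁻¹ = c ^ 2 * x * (c ^ 2)⁻¹
      group
    · show c * (c ^ 2 * x * (c ^ 2)⁻¹) * c⁻¹ = c ^ 3 * x * (c ^ 3)⁻¹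
      group
    · show c * (c ^ 3 * x * (c ^ 3)⁻¹) * c⁻¹ = c ^ 4 * x * (c ^ 4)⁻¹
      group
    · show c * (c ^ 4 * x * (c ^ 4)⁻¹) * c⁻¹ = c ^ 0 * x * (c ^ 0)⁻¹
      have : c * (c ^ 4 * x * (c ^ 4)⁻¹) * c⁻¹ = c ^ 5 * x * (c ^ 5)⁻¹ := by group
      rw [this, hc]; simp
  have hconj : ∀ i j, y i * y j = y j * y i → y (i + 1) * y (j + 1) = y (j + 1) * y (i + 1) := by
    intro i j h
    rw [← hstep, ← hstep]
    calc c * y i * c⁻¹ * (c * y j * c⁻¹) = c * (y i * y j) * c⁻¹ := by group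
      _ = _ := by rw [h]; group
  have e01 : y 0 * y 1 = y 1 * y 0 := by simpa [y] using h01
  have e02 : y 0 * y 2 = y 2 * y 0 := by simpa [y] using h02
  have e12 := hconj _ _ e01
  have e23 := hconj _ _ e12
  have e34 := hconj _ _ e23
  have e40 := hconj _ _ e34
  have e13 := hconj _ _ e02
  have e24 := hconj _ _ e13
  have e30 := hconj _ _ e24
  have e41 := hconj _ _ e30
  have hcm : ∀ i j, y i * y j = y j * y i := by
    intro i j
    fin_cases i <;> fin_cases j <;>
    first
    | rfl
    | exact e01 | exact e02 | exact e12 | exact e23 | exact e34 | exact e40 | exact e13 | exact e24 | exact e30 | exact e41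
    | exact e01.symm | exact e02.symm | exact e12.symm | exact e23.symm | exact e34.symm | exact e40.symm | exact e13.symm | exact e24.symm | exact e30.symm | exact e41.symm
  have hsq : ∀ i, y i * y i = 1 := by
    intro i
    show c ^ (i : ℕ) * x * (c ^ (i : ℕ))⁻¹ * (c ^ (i : ℕ) * x * (c ^ (i : ℕ))⁻¹) = 1
    calc _ = c ^ (i : ℕ) * (x * x) * (c ^ (i : ℕ))⁻¹ := by group
      _ = 1 := by rw [hx]; group
  have hpr : y 0 * (y 1 * (y 2 * (y 3 * y 4))) = 1 := by
    have : y 0 * (y 1 * (y 2 * (y 3 * y 4))) = (x * c) ^ 5 * (c ^ 5)⁻¹ := by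
      show c ^ 0 * x * (c ^ 0)⁻¹ * (c ^ 1 * x * (c ^ 1)⁻¹ * (c ^ 2 * x * (c ^ 2)⁻¹ *
        (c ^ 3 * x * (c ^ 3)⁻¹ * (c ^ 4 * x * (c ^ 4)⁻¹)))) = _
      simp only [pow_succ, pow_zero, one_mul, _root_.mul_inv_rev, inv_one, mul_one, mul_assoc,
        inv_mul_cancel_left, mul_inv_cancel_left, mul_inv_cancel, inv_mul_cancel]
    rw [this, hxc, hc]; simp
  have hcomp : ∀ a b w, ρ a (ρ b w) = ρ (a * b) w := by
    intro a b w; rw [map_mul]; rfl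
  have key := core_eig (K := K) h3 (fun i => (ρ (y i)).toLinearMap) (ρ c).toLinearMap
    (by intro i w; show ρ (y i) (ρ (y i) w) = w; rw [hcomp, hsq, map_one]; rfl)
    (by intro i j w; show ρ (y i) (ρ (y j) w) = ρ (y j) (ρ (y i) w); rw [hcomp, hcomp, hcm])
    (by
      intro i w; show ρ (y (i + 1)) (ρ c w) = ρ c (ρ (y i) w)
      rw [hcomp, hcomp, ← hstep]; congr 2; group)
    (by
      intro w; show ρ (y 0) (ρ (y 1) (ρ (y 2) (ρ (y 3) (ρ (y 4) w)))) = w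
      rw [hcomp, hcomp, hcomp, hcomp]
      rw [show y 0 * y 1 * y 2 * y 3 * y 4 = 1 by rw [← hpr]; group, map_one]; rfl)
    (by
      intro w
      show w + ρ c w + ρ c (ρ c w) + ρ c (ρ c (ρ c w)) + ρ c (ρ c (ρ c (ρ c w))) = 0
      rw [← hN w]
      simp only [hcomp, Finset.sum_range_succ, Finset.sum_range_zero, pow_succ, pow_zero, one_mul,
        map_one, zero_add, mul_assoc]
      rfl)
  ext w
  have := key w
  simpa [y] using this
end E11
end PartE11

section PartE12
set_option linter.unusedSectionVars false

section E12
open Matrix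

def cM : Matrix (Fin 4) (Fin 4) (ZMod 3) := !![0,0,0,2;1,0,0,2;0,1,0,2;0,0,1,2]
def xM : Matrix (Fin 4) (Fin 4) (ZMod 3) := !![0,2,0,2;1,0,1,2;1,2,2,2;1,0,2,1]
def tM : Matrix (Fin 4) (Fin 4) (ZMod 3) := !![0,1,2,0;1,0,2,0;0,0,2,0;0,0,2,1]
def hM : Matrix (Fin 4) (Fin 4) (ZMod 3) := !![2,1,1,2;2,0,0,1;1,0,2,0;0,2,1,2]
def sM : Matrix (Fin 4) (Fin 4) (ZMod 3) := !![2,0,0,0;0,2,0,0;0,0,2,0;0,0,0,2]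

theorem cM_det : cM.det = 1 := by decide +kernel
theorem xM_det : xM.det = 1 := by decide +kernel
theorem tM_det : tM.det = 1 := by decide +kernel
theorem hM_det : hM.det = 1 := by decide +kernel
theorem sM_det : sM.det = 1 := by decide +kernel

abbrev S3 := Matrix.SpecialLinearGroup (Fin 4) (ZMod 3)
def cS : S3 := ⟨cM, cM_det⟩
def xS : S3 := ⟨xM, xM_det⟩
def tS : S3 := ⟨tM, tM_det⟩
def hS : S3 := ⟨hM, hM_det⟩
def sS : S3 := ⟨sM, sM_det⟩

theorem id_c : cS ^ 5 = 1 := Subtype.ext (by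
  show cM ^ 5 = 1
  decide +kernel)
theorem id_x : xS * xS = 1 := Subtype.ext (by
  show xM * xM = 1
  decide +kernel)
theorem id_1 : xS * (cS * xS * cS ^ 4) = sS * ((cS * xS * cS ^ 4) * xS) := Subtype.ext (by
  show xM * (cM * xM * cM ^ 4) = sM * ((cM * xM * cM ^ 4) * xM)
  decide +kernel)
theorem id_2 : xS * (cS ^ 2 * xS * cS ^ 3) = sS * ((cS ^ 2 * xS * cS ^ 3) * xS) := Subtype.ext (by
  show xM * (cM ^ 2 * xM * cM ^ 3) = sM * ((cM ^ 2 * xM * cM ^ 3) * xM)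
  decide +kernel)
theorem id_xc : (xS * cS) ^ 5 = sS := Subtype.ext (by
  show (xM * cM) ^ 5 = sM
  decide +kernel)
theorem id_th : tS * hS = hS * xS := Subtype.ext (by
  show tM * hM = hM * xM
  decide +kernel)
theorem id_tc : tS * cS = cS ^ 4 * tS := Subtype.ext (by
  show tM * cM = cM ^ 4 * tM
  decide +kernel)

theorem id_s : sM = scalar (Fin 4) 2 := by decide +kernel

variable {F : Type} [Field F] [Fintype F]

theorem case_C (m : ℕ) (hF : Fintype.card F = 3 ^ m) (hm : m % 2 = 1)
    {K W : Type} [Field K] [CharP K 3] [AddCommGroup W] [Module K W] [Nontrivial W]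
    {k : Type} [Field k] [IsAlgClosed k] [CharP k 3] [CharP F 3] (ι : F →+* k)
    (ρ : PSL4 F →* (W ≃ₗ[K] W))
    (he : elementOrders (SemidirectProduct (Multiplicative W) (PSL4 F) (linToMulAut.comp ρ)) =
      elementOrders (PSL4 F)) : False := by
  have h3 : (3 : K) = 0 := by exact_mod_cast CharP.cast_eq_zero K 3
  let θ : ZMod 3 →+* F := ZMod.castHom (dvd_refl 3) F
  let φ : S3 →* PSL4 F := (QuotientGroup.mk' (Subgroup.center (SL4 F))).comp
    (Matrix.SpecialLinearGroup.map θ)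
  have hs : φ sS = 1 := by
    refine (mk_eq_one_iff _).2 ⟨θ 2, ?_⟩
    show sM.map θ = _
    rw [id_s]
    ext i j
    simp [scalar_apply, diagonal_apply, apply_ite θ]
  have hc1 : φ cS ≠ 1 := by
    intro h
    obtain ⟨r, hr⟩ := (mk_eq_one_iff _).1 h
    have h1 : cM.map θ = scalar (Fin 4) r := hr
    have h2 := congrFun (congrFun h1 1) 0
    simp [cM] at h2
  have hc5 : φ cS ^ 5 = 1 := by rw [← map_pow, id_c, map_one]
  have _h5 : Fact (Nat.Prime 5) := ⟨by norm_num⟩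
  have hord : orderOf (φ cS) = 5 := orderOf_eq_prime hc5 hc1
  have hi1 : (φ cS)⁻¹ = φ cS ^ 4 := inv_eq_of_mul_eq_one_right (by rw [← pow_succ']; exact hc5)
  have hi2 : (φ cS ^ 2)⁻¹ = φ cS ^ 3 := inv_eq_of_mul_eq_one_right (by rw [← pow_add]; exact hc5)
  by_cases hN : ∀ w, ∑ j ∈ Finset.range 5, ρ (φ cS ^ j) w = 0
  · have hx := core_grp h3 ρ (φ cS) (φ xS) hc5 (by rw [← map_mul, id_x, map_one])
      (by rw [hi1]; simp only [← map_mul, ← map_pow]; rw [id_1, map_mul, hs, one_mul])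
      (by rw [hi2]; simp only [← map_mul, ← map_pow]; rw [id_2, map_mul, hs, one_mul])
      (by rw [← map_mul, ← map_pow, id_xc, hs]) hN
    have ht : ρ (φ tS) = 1 := by
      have h := congrArg (fun z => ρ (φ z)) id_th
      simp only [map_mul, hx, mul_one] at h
      exact mul_eq_right.1 h
    have hc : ρ (φ cS) = ρ (φ cS) ^ 4 := by
      have h := congrArg (fun z => ρ (φ z)) id_tc
      simpa only [map_mul, map_pow, ht, mul_one, one_mul] using h
    have hc' : ρ (φ cS) ^ 5 = 1 := by rw [← map_pow, hc5, map_one]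
    have h3' : ρ (φ cS) ^ 3 = 1 := by
      have : ρ (φ cS) ^ 3 * ρ (φ cS) = ρ (φ cS) := by rw [← pow_succ, ← hc]
      exact mul_eq_right.1 this
    have h1' : ρ (φ cS) = 1 := by
      calc ρ (φ cS) = ρ (φ cS) * (ρ (φ cS) ^ 5) := by rw [hc', mul_one]
        _ = (ρ (φ cS) ^ 3) ^ 2 := by rw [← pow_succ', ← pow_mul]
        _ = 1 := by rw [h3', one_pow]
    obtain ⟨w, hw⟩ := exists_ne (0 : W)
    have h5 := hN w
    simp only [map_pow, h1', one_pow, Finset.sum_const, Finset.card_range] at h5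
    rw [← Nat.cast_smul_eq_nsmul K, smul_eq_zero] at h5
    rcases h5 with h5 | h5
    · push_cast at h5
      have : (1 : K) = 0 := by linear_combination 2 * h3 - h5
      exact one_ne_zero this
    · exact hw h5
  · push Not at hN
    obtain ⟨w, hw⟩ := hN
    obtain ⟨g, hg⟩ := sd_order 3 ρ (φ cS) 5 hord w hw he
    obtain ⟨n0, hb, hd⟩ := order_restrict 3 m ι (by decide) hF g 5 (by decide) hg
    have hq : 3 ^ m % 20 = 3 ∨ 3 ^ m % 20 = 7 := by
      obtain ⟨c, rfl⟩ : ∃ c, m = 2 * c + 1 := ⟨m / 2, by omega⟩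
      clear hF hm hb hg
      induction c with
      | zero => left; rfl
      | succ c ih =>
        have : 3 ^ (2 * (c + 1) + 1) = 9 * 3 ^ (2 * c + 1) := by ring
        omega
    unfold BadN at hb
    generalize 3 ^ m = q at hb hq
    have hsq : q ^ 2 % 20 = 9 := by
      rcases hq with h | h <;> rw [Nat.pow_mod, h]
    generalize q ^ 2 = Q at hb hsq
    omega
end E12
end PartE12

/-- If `L = PSL₄(q)`, `q` odd, acts by linear automorphisms on a nonzero vector space `W`
over a field of characteristic `p`, then `ω(W ⋊ L) ≠ ω(L)`. -/
theorem spectrum_ne_of_psl4_semidirect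
    (p m : ℕ) [Fact p.Prime] (hp : Odd p)
    (F : Type) [Field F] [Fintype F] (hF : Fintype.card F = p ^ m)
    (K : Type) [Field K] [CharP K p]
    (W : Type) [AddCommGroup W] [Module K W] [Nontrivial W]
    (ρ : (SpecialLinearGroup (Fin 4) F ⧸
        Subgroup.center (SpecialLinearGroup (Fin 4) F)) →* (W ≃ₗ[K] W)) :
    elementOrders (SemidirectProduct (Multiplicative W)
        (SpecialLinearGroup (Fin 4) F ⧸ Subgroup.center (SpecialLinearGroup (Fin 4) F))
        (linToMulAut.comp ρ)) ≠
      elementOrders (SpecialLinearGroup (Fin 4) F ⧸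
        Subgroup.center (SpecialLinearGroup (Fin 4) F)) := by
  intro he
  have _hcF : CharP F p := charF p m hF
  have _hck : CharP (AlgebraicClosure K) p :=
    charP_of_injective_algebraMap (algebraMap K (AlgebraicClosure K)).injective p
  obtain ⟨ι⟩ := exists_iota (F := F) p (AlgebraicClosure K)
  have hpp : p.Prime := Fact.out
  have h2 := hpp.two_le
  by_cases h5 : 5 ≤ p
  · exact main_generic p m hp hF (algebraMap K (AlgebraicClosure K)) ι ρ (Or.inl h5) he
  · have hp3 : p = 3 := by
      rcases hp with ⟨a, rfl⟩
      omega
    rcases Nat.mod_two_eq_zero_or_one m with hm | hm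
    · exact main_generic p m hp hF (algebraMap K (AlgebraicClosure K)) ι ρ (Or.inr ⟨hp3, hm⟩) he
    · subst hp3
      exact case_C m hF hm ι ρ he
end

section
/- Let a and n be integers with a ≥ 2 and n ≥ 2. Then either there exists a prime r such that r divides aⁿ − 1 and r does not divide aⁱ − 1 for all integers i with 1 ≤ i < n, or one of the following holds: (1) n = 6 and a = 2; (2) n = 2 and a + 1 is a power of 2. -/
open Polynomial in
lemma zs_key (a : ℤ) (n p : ℕ) (hn : 2 ≤ n) (hp : p.Prime)
    (h : (p : ℤ) ∣ (cyclotomic n ℤ).eval a) :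
    ((p : ℤ) ∣ a ^ n - 1 ∧ ∀ i : ℕ, 1 ≤ i → i < n → ¬ (p : ℤ) ∣ a ^ i - 1) ∨
    ∃ k m : ℕ, n = p ^ (k + 1) * m ∧ ¬ p ∣ m ∧ m ∣ p - 1 ∧ (p : ℤ) ∣ a ^ m - 1 := by
  haveI := Fact.mk hp
  obtain ⟨k, m, hm, rfl⟩ := Nat.exists_eq_pow_mul_and_not_dvd (by omega : n ≠ 0) p hp.ne_one
  have cast_iff : ∀ i : ℕ, (p : ℤ) ∣ a ^ i - 1 ↔ (a : ZMod p) ^ i = 1 := by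
    intro i
    rw [← ZMod.intCast_zmod_eq_zero_iff_dvd]
    push_cast
    rw [sub_eq_zero]
  haveI : NeZero (m : ZMod p) := ⟨by rwa [Ne, ZMod.natCast_eq_zero_iff]⟩
  have hroot : (cyclotomic (p ^ k * m) (ZMod p)).IsRoot (a : ZMod p) := by
    rw [IsRoot.def, ← map_cyclotomic_int, eval_intCast_map]
    simpa using (ZMod.intCast_zmod_eq_zero_iff_dvd _ p).2 h
  rw [isRoot_cyclotomic_prime_pow_mul_iff_of_charP] at hroot
  have hmpos : m ≠ 0 := by rintro rfl; simp at hm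
  rcases k with _ | k
  · left
    simp only [pow_zero, one_mul]
    refine ⟨(cast_iff _).2 hroot.pow_eq_one, fun i hi1 hi2 hd => ?_⟩
    have := Nat.le_of_dvd (by omega) (hroot.dvd_of_pow_eq_one _ ((cast_iff _).1 hd))
    omega
  · right
    refine ⟨k, m, rfl, hm, ?_, (cast_iff _).2 hroot.pow_eq_one⟩
    rw [hroot.eq_orderOf]
    apply ZMod.orderOf_dvd_card_sub_one
    exact hroot.ne_zero hmpos

lemma zs_unique {n p q k m k' m' : ℕ} (hn : 2 ≤ n) (hp : p.Prime) (hq : q.Prime)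
    (h1 : n = p ^ (k + 1) * m) (h2 : m ∣ p - 1)
    (h1' : n = q ^ (k' + 1) * m') (h2' : m' ∣ q - 1) : q = p := by
  by_contra hne
  have hp2 := hp.two_le
  have hq2 := hq.two_le
  have hqn : q ∣ p ^ (k + 1) * m := by
    rw [← h1, h1', pow_succ]
    exact ⟨q ^ k' * m', by ring⟩
  have hpn : p ∣ q ^ (k' + 1) * m' := by
    rw [← h1', h1, pow_succ]
    exact ⟨p ^ k * m, by ring⟩
  have a1 : q ∣ m := by
    rcases hq.dvd_mul.1 hqn with h | h
    · exact absurd ((Nat.prime_dvd_prime_iff_eq hq hp).1 (hq.dvd_of_dvd_pow h)) hne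
    · exact h
  have a2 : p ∣ m' := by
    rcases hp.dvd_mul.1 hpn with h | h
    · exact absurd ((Nat.prime_dvd_prime_iff_eq hp hq).1 (hp.dvd_of_dvd_pow h)).symm hne
    · exact h
  have := Nat.le_of_dvd (by omega) (a1.trans h2)
  have := Nat.le_of_dvd (by omega) (a2.trans h2')
  omega

lemma zs_eq {N p : ℕ} (hN : 1 < N) (hu : ∀ q : ℕ, q.Prime → q ∣ N → q = p)
    (hsq : ¬ p ^ 2 ∣ N) : N = p := by
  obtain ⟨q, hq, hqN⟩ := Nat.exists_prime_and_dvd hN.ne'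
  obtain rfl := hu q hq hqN
  obtain ⟨c, rfl⟩ := hqN
  by_cases hc : c = 1
  · simp [hc]
  obtain ⟨r, hr, hrc⟩ := Nat.exists_prime_and_dvd hc
  obtain rfl := hu r hr (hrc.mul_left _)
  exact absurd (by rw [pow_two]; exact mul_dvd_mul_left _ hrc) hsq

open Polynomial in
lemma zs_sq (a : ℤ) (ha : 2 ≤ a) {p k m : ℕ} (hp : p.Prime) (hodd : Odd p) (hm : 0 < m)
    (hd : (p : ℤ) ∣ a ^ m - 1) :
    ¬ ((p : ℤ) ^ 2 ∣ (cyclotomic (p ^ (k + 1) * m) ℤ).eval a) := by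
  intro h
  have hpp : Prime (p : ℤ) := Nat.prime_iff_prime_int.1 hp
  set d := p ^ k * m with hdd
  have hdpos : 0 < d := Nat.mul_pos (pow_pos hp.pos _) hm
  have hnd : p ^ (k + 1) * m = d * p := by rw [hdd]; ring
  have hx : (p : ℤ) ∣ a ^ d - 1 := by
    rw [hdd, mul_comm, pow_mul]
    exact hd.trans (sub_one_dvd_pow_sub_one _ _)
  have hmem : d ∈ (p ^ (k + 1) * m).properDivisors := by
    rw [Nat.mem_properDivisors, hnd]
    exact ⟨dvd_mul_right _ _, by nlinarith [hp.two_le]⟩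
  have hdv := X_pow_sub_one_mul_cyclotomic_dvd_X_pow_sub_one_of_dvd ℤ hmem
  have hdv2 := (eval_dvd (x := a) hdv)
  simp only [eval_mul, eval_sub, eval_pow, eval_X, eval_one] at hdv2
  have hgeo : (a ^ d) ^ p - 1 = (a ^ d - 1) * ∑ i ∈ Finset.range p, (a ^ d) ^ i := by
    rw [mul_comm, geom_sum_mul]
  have hne : a ^ d - 1 ≠ 0 := by
    have : 1 < a ^ d := one_lt_pow₀ (by omega) hdpos.ne'
    omega
  have e1 : a ^ (p ^ (k + 1) * m) = (a ^ d) ^ p := by rw [hnd, pow_mul]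
  rw [e1, hgeo] at hdv2
  have hdv3 := (mul_dvd_mul_iff_left hne).1 hdv2
  have hnx : ¬ (p : ℤ) ∣ a ^ d := by
    intro h'
    have := dvd_sub h' hx
    simp only [sub_sub_cancel] at this
    exact hpp.not_dvd_one this
  have := emultiplicity_geom_sum₂_eq_one hpp hodd (y := 1) hx hnx
  simp only [one_pow, mul_one] at this
  have h2 := le_emultiplicity_of_pow_dvd (h.trans hdv3)
  rw [this] at h2
  norm_num at h2

lemma zs_ineq (b p : ℕ) (hb : 2 ≤ b) (hp : 3 ≤ p) (hx : ¬ (b = 2 ∧ p ≤ 4)) :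
    p * (b + 1) + 1 < b ^ p := by
  rcases Nat.lt_or_ge b 3 with h | h
  · obtain rfl : b = 2 := by omega
    have hp5 : 5 ≤ p := by omega
    clear hx hp
    induction p, hp5 using Nat.le_induction with
    | base => norm_num
    | succ p h ih => rw [pow_succ]; omega
  · have h3 : 2 * p + 2 ≤ b ^ (p - 1) := by
      calc 2 * p + 2 ≤ 3 ^ (p - 1) := by
            clear hx
            induction p, hp using Nat.le_induction with
            | base => norm_num
            | succ p h ih =>
              obtain ⟨q, rfl⟩ : ∃ q, p = q + 1 := ⟨p - 1, by omega⟩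
              simp only [Nat.add_sub_cancel] at ih ⊢
              rw [pow_succ]; omega
        _ ≤ _ := Nat.pow_le_pow_left h _
    obtain ⟨q, rfl⟩ : ∃ q, p = q + 1 := ⟨p - 1, by omega⟩
    simp only [Nat.add_sub_cancel] at h3
    rw [pow_succ]
    nlinarith

open Polynomial in
lemma zs_expand (p m k : ℕ) (hp : p.Prime) (a : ℤ) :
    (cyclotomic (p ^ (k + 1) * m) ℤ).eval a = (cyclotomic (m * p) ℤ).eval (a ^ p ^ k) := by
  induction k generalizing a with
  | zero => simp [mul_comm]
  | succ k ih =>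
    have : p ^ (k + 1 + 1) * m = (p ^ (k + 1) * m) * p := by ring
    rw [this, ← cyclotomic_expand_eq_cyclotomic hp
      (Dvd.dvd.mul_right (dvd_pow_self p (by omega)) m), expand_eval, ih, ← pow_mul, ← pow_succ']

open Polynomial in
lemma zs_big (b : ℤ) (p m : ℕ) (hb : 2 ≤ b) (hp : p.Prime) (hp3 : 3 ≤ p) (hm : 0 < m)
    (hpm : ¬ p ∣ m) (hmp : m ∣ p - 1)
    (h : (cyclotomic (m * p) ℤ).eval b = p) : b = 2 ∧ p = 3 ∧ m = 2 := by
  haveI := Fact.mk hp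
  have hm1 : m ≠ 1 := by
    rintro rfl
    rw [one_mul, cyclotomic_prime, eval_finset_sum] at h
    simp only [eval_pow, eval_X] at h
    have : ∑ i ∈ Finset.range p, (1 : ℤ) < ∑ i ∈ Finset.range p, b ^ i := by
      apply Finset.sum_lt_sum
      · intro i _
        exact one_le_pow₀ (by omega)
      · exact ⟨1, Finset.mem_range.2 (by omega), by simp; omega⟩
    simp at this
    omega
  lift b to ℕ using by omega
  have hb' : 2 ≤ b := by exact_mod_cast hb
  by_cases hx : b = 2 ∧ p ≤ 4
  · have hp4 : p ≠ 4 := by rintro rfl; norm_num at hp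
    have : p = 3 := by omega
    subst this
    have := Nat.le_of_dvd (by norm_num) hmp
    refine ⟨by simp [hx.1], rfl, by omega⟩
  exfalso
  have hi := zs_ineq b p hb' hp3 hx
  have hE := congrArg (eval (b : ℤ)) (cyclotomic_expand_eq_cyclotomic_mul hp hpm ℤ)
  rw [expand_eval, eval_mul, h] at hE
  have hcast : ∀ c : ℤ, (cyclotomic m ℝ).eval (c : ℝ) = (((cyclotomic m ℤ).eval c : ℤ) : ℝ) := by
    intro c
    rw [← map_cyclotomic_int, eval_intCast_map]; simp
  have hER := congrArg (fun z : ℤ => (z : ℝ)) hE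
  simp only [Int.cast_mul] at hER
  rw [← hcast, ← hcast] at hER
  push_cast at hER
  have hbR : (1 : ℝ) < b := by exact_mod_cast (by omega : 1 < b)
  have hiR : (p : ℝ) * (b + 1) + 1 < (b : ℝ) ^ p := by exact_mod_cast hi
  have l1 := sub_one_pow_totient_le_cyclotomic_eval (q := (b : ℝ) ^ p)
    (one_lt_pow₀ hbR (by omega)) m
  have l2 := cyclotomic_eval_le_add_one_pow_totient hbR m
  have ht : m.totient ≠ 0 := (Nat.totient_pos.2 hm).ne'
  have hp1 : (1 : ℝ) ≤ p := by exact_mod_cast hp.one_le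
  have l3 : ((p : ℝ) * (b + 1)) ^ m.totient < ((b : ℝ) ^ p - 1) ^ m.totient :=
    pow_lt_pow_left₀ (by linarith) (by positivity) ht
  have l4 : (p : ℝ) ≤ (p : ℝ) ^ m.totient := le_self_pow₀ hp1 ht
  have l5 : (p : ℝ) * ((b : ℝ) + 1) ^ m.totient ≤ ((p : ℝ) * (b + 1)) ^ m.totient := by
    rw [mul_pow]
    exact mul_le_mul_of_nonneg_right l4 (by positivity)
  have l6 := mul_le_mul_of_nonneg_left l2 (by linarith : (0 : ℝ) ≤ p)
  linarith

/-- Zsigmondy's (Bang's) theorem, case `ε = +`: for integers `a ≥ 2` and `n ≥ 2`, either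
`aⁿ - 1` has a primitive prime divisor, or `n = 6` and `a = 2`, or `n = 2` and `a + 1`
is a power of `2`. -/
theorem zsigmondy_plus (a : ℤ) (n : ℕ) (ha : 2 ≤ a) (hn : 2 ≤ n) :
    (∃ r : ℕ, r.Prime ∧ (r : ℤ) ∣ a ^ n - 1 ∧
      ∀ i : ℕ, 1 ≤ i → i < n → ¬ (r : ℤ) ∣ a ^ i - 1) ∨
    (n = 6 ∧ a = 2) ∨ (n = 2 ∧ ∃ k : ℕ, a + 1 = 2 ^ k) := by
  rw [or_iff_not_imp_left]
  intro hno
  have key : ∀ p : ℕ, p.Prime → (p : ℤ) ∣ (Polynomial.cyclotomic n ℤ).eval a →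
      ∃ k m : ℕ, n = p ^ (k + 1) * m ∧ ¬ p ∣ m ∧ m ∣ p - 1 ∧ (p : ℤ) ∣ a ^ m - 1 := by
    intro p hp h
    rcases zs_key a n p hn hp h with h | h
    · exact absurd ⟨p, hp, h⟩ hno
    · exact h
  obtain ⟨N, hN⟩ : ∃ N : ℕ, (Polynomial.cyclotomic n ℤ).eval a = N := by
    refine ⟨((Polynomial.cyclotomic n ℤ).eval a).toNat, (Int.toNat_of_nonneg ?_).symm⟩
    exact Polynomial.cyclotomic_nonneg n (by omega)
  have hN1 : 1 < N := by
    have := Polynomial.sub_one_lt_natAbs_cyclotomic_eval (n := n) (q := a.toNat) (by omega)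
      (by omega)
    rw [Int.toNat_of_nonneg (by omega), hN] at this
    simp only [Int.natAbs_natCast] at this
    omega
  obtain ⟨p, hp, hpN⟩ := Nat.exists_prime_and_dvd hN1.ne'
  obtain ⟨k, m, hnk, hpm, hmp, hpa⟩ := key p hp (by rw [hN]; exact_mod_cast hpN)
  have hu : ∀ q : ℕ, q.Prime → q ∣ N → q = p := by
    intro q hq hqN
    obtain ⟨k', m', hnk', -, hmp', -⟩ := key q hq (by rw [hN]; exact_mod_cast hqN)
    exact zs_unique hn hp hq hnk hmp hnk' hmp'
  have hm : 0 < m := by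
    rcases Nat.eq_zero_or_pos m with rfl | h
    · simp at hpm
    · exact h
  rcases hp.eq_two_or_odd' with rfl | hodd
  · right
    obtain rfl : m = 1 := by simpa using hmp
    have hval : (N : ℤ) = a ^ 2 ^ k + 1 := by
      rw [← hN, hnk, mul_one, Polynomial.cyclotomic_prime_pow_eq_geom_sum Nat.prime_two]
      simp [Finset.sum_range_succ, add_comm]
    rcases k with _ | k
    · refine ⟨by simpa using hnk, N.primeFactorsList.length, ?_⟩
      have := Nat.eq_prime_pow_of_unique_prime_dvd (n := N) (p := 2) (by omega)
        (fun {d} hd hdn => hu d hd hdn)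
      simp only [pow_zero, pow_one] at hval
      rw [← hval]
      exact_mod_cast this
    · exfalso
      rw [pow_succ, pow_mul] at hval
      set x := a ^ 2 ^ k with hx
      have hx2 : 2 ≤ x := by
        have : a ^ 1 ≤ a ^ 2 ^ k := pow_le_pow_right₀ (by omega) Nat.one_le_two_pow
        rw [pow_one] at this
        omega
      have h4 : ¬ 2 ^ 2 ∣ N := by
        intro h
        have h' : (4 : ℤ) ∣ x ^ 2 + 1 := by rw [← hval]; exact_mod_cast h
        rcases Int.even_or_odd' x with ⟨c, hc | hc⟩
        · rw [hc] at h'; ring_nf at h'; omega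
        · rw [hc] at h'; ring_nf at h'; omega
      have := zs_eq hN1 hu h4
      subst this
      push_cast at hval
      nlinarith
  · left
    have hp3 : 3 ≤ p := by
      have := hp.two_le
      rcases hodd with ⟨c, hc⟩
      omega
    have hsq : ¬ p ^ 2 ∣ N := by
      intro h
      apply zs_sq a ha (k := k) hp hodd hm hpa
      rw [← hnk, hN]
      exact_mod_cast h
    have hNp := zs_eq hN1 hu hsq
    rw [hnk, zs_expand p m k hp, hNp] at hN
    have hale : a ≤ a ^ p ^ k := le_self_pow₀ (by omega) (pow_pos hp.pos k).ne'
    obtain ⟨hb, rfl, rfl⟩ := zs_big _ p m (by omega) hp hp3 hm hpm hmp hN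
    have ha2 : a = 2 := by omega
    refine ⟨?_, ha2⟩
    rcases k with _ | k
    · simpa using hnk
    · exfalso
      rw [ha2] at hb
      have : (2 : ℤ) ^ 3 ≤ 2 ^ 3 ^ (k + 1) :=
        pow_le_pow_right₀ (by norm_num) (Nat.le_self_pow (by omega) 3)
      omega
end
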